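/- arXiv:1305.6691 — 3 statements merged into one kernel-verified Lean document; each statement's English description precedes it below -/
import Mathlib

section
/- Let X be a real Banach space and let A, B : X ⇉ X* be maximally monotone operators such that star(dom A) ∩ int(dom B) ≠ ∅ and A is of type (FPV). Then the sum A + B is maximally monotone. -/
open Set Filter Topology

noncomputable section

variable {X : Type*} [NormedAddCommGroup X] [NormedSpace ℝ X]

/-- A set-valued operator `A : X ⇉ X*`, identified with its graph,
is monotone if `⟨x − y, x* − y*⟩ ≥ 0` for all `(x, x*), (y, y*)` in the graph. -/
def IsMonotoneOp (A : Set (X × (X →L[ℝ] ℝ))) : Prop :=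
  ∀ p ∈ A, ∀ q ∈ A, 0 ≤ (p.2 - q.2) (p.1 - q.1)

/-- `A` is maximally monotone if it is monotone and its graph is not properly contained
in the graph of any monotone operator. -/
def IsMaxMonotoneOp (A : Set (X × (X →L[ℝ] ℝ))) : Prop :=
  IsMonotoneOp A ∧ ∀ B : Set (X × (X →L[ℝ] ℝ)), IsMonotoneOp B → A ⊆ B → B = A

/-- The domain of a set-valued operator. -/
def opDom (A : Set (X × (X →L[ℝ] ℝ))) : Set X :=
  {x | ∃ xs, (x, xs) ∈ A}

/-- `(z, z*)` is monotonically related to `S` if `⟨z − y, z* − y*⟩ ≥ 0` for all `(y, y*) ∈ S`. -/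
def MonotonicallyRelated (S : Set (X × (X →L[ℝ] ℝ))) (p : X × (X →L[ℝ] ℝ)) : Prop :=
  ∀ q ∈ S, 0 ≤ (p.2 - q.2) (p.1 - q.1)

/-- A maximally monotone operator `A` is of type (FPV) if for every open convex set `U`
meeting `dom A`, every `(x, x*)` with `x ∈ U` monotonically related to
`gra A ∩ (U × X*)` belongs to `gra A`. -/
def IsFPV (A : Set (X × (X →L[ℝ] ℝ))) : Prop :=
  IsMaxMonotoneOp A ∧
    ∀ U : Set X, IsOpen U → Convex ℝ U → (U ∩ opDom A).Nonempty →
      ∀ x : X, ∀ xs : X →L[ℝ] ℝ, x ∈ U →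
        MonotonicallyRelated (A ∩ (U ×ˢ (univ : Set (X →L[ℝ] ℝ)))) (x, xs) →
        (x, xs) ∈ A

/-- The graph of the sum `A + B`: `(A + B)x = {a* + b* : a* ∈ A x, b* ∈ B x}`. -/
def opSum (A B : Set (X × (X →L[ℝ] ℝ))) : Set (X × (X →L[ℝ] ℝ)) :=
  {p | ∃ as bs, (p.1, as) ∈ A ∧ (p.1, bs) ∈ B ∧ p.2 = as + bs}

/-- The star (centre) of a set `C`: points `x ∈ C` with `[x, c] ⊆ C` for all `c ∈ C`. -/
def starSet (C : Set X) : Set X :=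
  {x ∈ C | ∀ c ∈ C, segment ℝ x c ⊆ C}

/-- The Fitzpatrick function of `A`:
`F_A(x, x*) = sup_{(a, a*) ∈ gra A} (⟨x, a*⟩ + ⟨a, x*⟩ − ⟨a, a*⟩)`, with values in `(−∞, +∞]`. -/
def fitz (A : Set (X × (X →L[ℝ] ℝ))) (p : X × (X →L[ℝ] ℝ)) : EReal :=
  ⨆ q ∈ A, ((q.2 p.1 + p.2 q.1 - q.2 q.1 : ℝ) : EReal)


section helpers
variable {A B : Set (X × (X →L[ℝ] ℝ))}

theorem mem_of_related (h : IsMaxMonotoneOp A) {x : X} {xs : X →L[ℝ] ℝ}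
    (hr : ∀ y ys, (y, ys) ∈ A → 0 ≤ (xs - ys) (x - y)) : (x, xs) ∈ A := by
  have h2 := h.2 (insert (x, xs) A) ?_ (subset_insert _ _)
  · rw [← h2]; exact mem_insert _ _
  · rintro p (rfl | hp) q (rfl | hq)
    · simp
    · exact hr q.1 q.2 hq
    · have := hr p.1 p.2 hp
      have e : (p.2 - xs) (p.1 - x) = (xs - p.2) (x - p.1) := by
        simp only [sub_apply, map_sub]; ring
      simpa [e] using this
    · exact h.1 p hp q hq

theorem sandwich (S T : Set (X × ℝ)) (hS : Convex ℝ S) (hT : Convex ℝ T)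
    (hST : ∀ w r r', (w, r) ∈ S → (w, r') ∈ T → 0 ≤ r + r')
    (w0 : X) (r0 M ρ : ℝ) (hρ : 0 < ρ) (h0 : (w0, r0) ∈ S)
    (hb : ∀ w, ‖w - w0‖ < ρ → ∃ r ≤ M, (w, r) ∈ T) :
    ∃ (u : X →L[ℝ] ℝ) (α : ℝ), (∀ w r, (w, r) ∈ S → u w + α ≤ r) ∧
      (∀ w r, (w, r) ∈ T → - u w - α ≤ r) := by
  let E : Set (X × ℝ) := {p | ∃ w r w' r', (w, r) ∈ T ∧ (w', r') ∈ S ∧ p.1 = w - w' ∧ r + r' < p.2}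
  have hE : Convex ℝ E := by
    rintro ⟨p1, p2⟩ ⟨w1, r1, w1', r1', h1, h1', e1, l1⟩ ⟨q1, q2⟩ ⟨w2, r2, w2', r2', h2, h2', e2, l2⟩
      a b ha hb hab
    refine ⟨a • w1 + b • w2, a * r1 + b * r2, a • w1' + b • w2', a * r1' + b * r2',
      hT h1 h2 ha hb hab, hS h1' h2' ha hb hab, ?_, ?_⟩
    · simp only at e1 e2
      simp only [e1, e2, Prod.smul_mk, Prod.mk_add_mk]
      module
    · simp only [Prod.smul_mk, Prod.mk_add_mk, smul_eq_mul] at *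
      rcases ha.eq_or_lt with rfl | ha'
      · have : b = 1 := by linarith
        subst this; linarith
      · nlinarith
  have h0E : ∀ p ∈ E, p ≠ 0 := by
    rintro p ⟨w, r, w', r', h1, h2, e, l⟩ rfl
    have : w = w' := by simpa [eq_comm, sub_eq_zero] using e
    subst this
    have := hST _ _ _ h2 h1
    simp at l; linarith
  have hO : Metric.ball (0:X) ρ ×ˢ Ioi (M + r0) ⊆ E := by
    rintro ⟨w, r⟩ ⟨hw, hr⟩
    obtain ⟨r1, hr1, hm⟩ := hb (w + w0) (by simpa using hw)
    refine ⟨_, _, _, _, hm, h0, by simp, ?_⟩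
    simp at hr ⊢; linarith
  have hOo : IsOpen (Metric.ball (0:X) ρ ×ˢ Ioi (M + r0)) := Metric.isOpen_ball.prod isOpen_Ioi
  have hOi := interior_maximal hO hOo
  have hpt : ((0:X), M + r0 + 1) ∈ Metric.ball (0:X) ρ ×ˢ Ioi (M + r0) := by simp [hρ]
  obtain ⟨f, hf⟩ := geometric_hahn_banach_point_open (E := X × ℝ) hE.interior isOpen_interior
    (x := 0) (fun h => h0E 0 (interior_subset h) rfl)
  simp only [map_zero] at hf
  have hfE : ∀ p ∈ E, 0 ≤ f p := by
    have hcl : closure (interior E) = closure E :=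
      hE.closure_interior_eq_closure_of_nonempty_interior ⟨_, hOi hpt⟩
    have : E ⊆ {p | 0 ≤ f p} := by
      refine subset_closure.trans (hcl ▸ closure_minimal (fun p hp => (hf p hp).le) ?_)
      exact isClosed_le continuous_const f.continuous
    exact this
  set g : X →L[ℝ] ℝ := f.comp (ContinuousLinearMap.inl ℝ X ℝ) with hg
  set κ : ℝ := f (0, 1) with hκ
  have hdec : ∀ w r, f (w, r) = g w + κ * r := by
    intro w r
    have : (w, r) = (w, (0:ℝ)) + r • ((0:X), (1:ℝ)) := by simp
    rw [this, map_add, map_smul]; simp [hg, hκ, mul_comm]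
  have hκpos : 0 < κ := by
    have h1 : ∀ w, ‖w‖ < ρ → ∀ r, M + r0 < r → 0 < g w + κ * r := by
      intro w hw r hr
      rw [← hdec]; exact hf _ (hOi ⟨by simpa using hw, hr⟩)
    by_contra hneg
    push Not at hneg
    have h2 := h1 0 (by simpa using hρ) (|M + r0| + 1) (by linarith [le_abs_self (M+r0)])
    simp at h2
    nlinarith [abs_nonneg (M+r0)]
  have key : ∀ w r w' r', (w, r) ∈ T → (w', r') ∈ S → 0 ≤ g w - g w' + κ * (r + r') := by
    intro w r w' r' h1 h2
    refine le_of_forall_pos_le_add fun e he => ?_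
    have := hfE (w - w', r + r' + e / κ) ⟨_, _, _, _, h1, h2, rfl, by simp; positivity⟩
    rw [hdec, map_sub, mul_add, mul_div_cancel₀ _ hκpos.ne'] at this
    linarith
  obtain ⟨rT, -, hrT⟩ := hb w0 (by simpa using hρ)
  let Q : Set ℝ := {c | ∃ w r, (w, r) ∈ T ∧ c = - r - (g w) / κ}
  have hQb : ∀ w' r', (w', r') ∈ S → ∀ c ∈ Q, c ≤ r' - g w' / κ := by
    rintro w' r' h c ⟨w, r, h1, rfl⟩
    have := key _ _ _ _ h1 h
    have h3 : 0 ≤ (g w - g w' + κ * (r + r')) / κ := by positivity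
    have h4 : (g w - g w' + κ * (r + r')) / κ = g w / κ - g w' / κ + (r + r') := by
      field_simp
    linarith
  refine ⟨κ⁻¹ • g, sSup Q, fun w r h => ?_, fun w r h => ?_⟩
  · have := csSup_le (s := Q) ⟨_, w0, rT, hrT, rfl⟩ (hQb w r h)
    simp only [smul_apply, smul_eq_mul]
    have e : κ⁻¹ * g w = g w / κ := by ring
    linarith
  · have := le_csSup (s := Q) ⟨_, hQb _ _ h0⟩ ⟨w, r, h, rfl⟩
    simp only [smul_apply, smul_eq_mul]
    have e : κ⁻¹ * g w = g w / κ := by ring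
    linarith

theorem norm_le_of_ball (b : X →L[ℝ] ℝ) {ρ N : ℝ} (hρ : 0 < ρ)
    (h : ∀ y, ‖y‖ < ρ → b y ≤ N) : ρ * ‖b‖ ≤ N := by
  have hN : 0 ≤ N := by simpa using h 0 (by simpa using hρ)
  have : ‖b‖ ≤ N / ρ := by
    refine le_of_forall_gt_imp_ge_of_dense fun r hr => ?_
    have hr0 : 0 < r := lt_of_le_of_lt (by positivity) hr
    have hN' : N < r * ρ := by rwa [div_lt_iff₀ hρ] at hr
    refine b.opNorm_le_bound hr0.le fun x => ?_
    rcases eq_or_ne x 0 with rfl | hx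
    · simp
    have hxp : 0 < ‖x‖ := norm_pos_iff.2 hx
    set t := N / (r * ‖x‖) with ht
    have ht0 : 0 ≤ t := by positivity
    have ht1 : t * ‖x‖ < ρ := by
      have : t * ‖x‖ = N / r := by rw [ht]; field_simp
      rw [this, div_lt_iff₀ hr0]; linarith
    obtain ⟨t', htt, ht'⟩ : ∃ t', t < t' ∧ t' * ‖x‖ < ρ := by
      have : t < ρ / ‖x‖ := by rwa [lt_div_iff₀ hxp]
      obtain ⟨t', h1, h2⟩ := exists_between this
      exact ⟨t', h1, by rwa [lt_div_iff₀ hxp] at h2⟩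
    have htp0 : 0 < t' := lt_of_le_of_lt ht0 htt
    have e1 := h (t' • x) (by rw [norm_smul, Real.norm_of_nonneg htp0.le]; exact ht')
    have e2 := h (-(t' • x)) (by rw [norm_neg, norm_smul, Real.norm_of_nonneg htp0.le]; exact ht')
    simp only [map_neg, map_smul, smul_eq_mul] at e1 e2
    have hNt : N ≤ t' * (r * ‖x‖) := by
      have : N = t * (r * ‖x‖) := by rw [ht]; field_simp
      rw [this]; gcongr
    rw [Real.norm_eq_abs, abs_le]
    constructor
    · have : t' * (-(b x)) ≤ t' * (r * ‖x‖) := by linarith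
      have := le_of_mul_le_mul_left this htp0
      linarith
    · have : t' * (b x) ≤ t' * (r * ‖x‖) := by linarith
      exact le_of_mul_le_mul_left this htp0
  rw [le_div_iff₀ hρ] at this; linarith

theorem apply_le (b : X →L[ℝ] ℝ) (x : X) : b x ≤ ‖b‖ * ‖x‖ :=
  (le_abs_self _).trans (b.le_opNorm x)

theorem neg_apply_le (b : X →L[ℝ] ℝ) (x : X) : - b x ≤ ‖b‖ * ‖x‖ :=
  (neg_le_abs _).trans (b.le_opNorm x)

theorem mono4 (h : IsMonotoneOp B) {x y : X} {b c : X →L[ℝ] ℝ} (hx : (x, b) ∈ B) (hy : (y, c) ∈ B) :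
    0 ≤ b x - b y - c x + c y := by
  have := h _ hx _ hy
  simp only [sub_apply, map_sub] at this
  linarith

theorem locbdd [CompleteSpace X] (h : IsMonotoneOp B) {x0 : X} (hx0 : x0 ∈ interior (opDom B)) :
    ∃ ρ > 0, ∃ M ≥ 0, (∀ y, ‖y - x0‖ < ρ → y ∈ opDom B) ∧
      ∀ y b, ‖y - x0‖ < ρ → (y, b) ∈ B → ‖b‖ ≤ M := by
  obtain ⟨ρ0, hρ0, hball⟩ := Metric.mem_nhds_iff.1 (mem_interior_iff_mem_nhds.1 hx0)
  have hdom : ∀ x ∈ opDom B, ∃ n : ℕ, ∀ y c, (y, c) ∈ B → ‖y - x0‖ ≤ 1 → c (x - y) ≤ n := by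
    rintro x ⟨b, hb⟩
    obtain ⟨n, hn⟩ := exists_nat_ge (‖b‖ * (‖x - x0‖ + 1))
    refine ⟨n, fun y c hc hy => ?_⟩
    have h1 := mono4 h hb hc
    have h2 := apply_le b (x - y)
    have h3 : ‖x - y‖ ≤ ‖x - x0‖ + 1 := by
      have : x - y = (x - x0) - (y - x0) := by abel
      rw [this]; exact (norm_sub_le _ _).trans (by linarith)
    have h4 : ‖b‖ * ‖x - y‖ ≤ ‖b‖ * (‖x - x0‖ + 1) := by gcongr
    rw [map_sub] at *
    linarith
  let G : ℕ × ℕ → Set X := fun k => {u | ∀ y c, (y, c) ∈ B → ‖y - x0‖ ≤ 1 →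
    c (x0 + (1 / ((k.1 : ℝ) + 1)) • u - y) ≤ k.2}
  have hGc : ∀ k, IsClosed (G k) := by
    intro k
    have : G k = ⋂ (y) (c) (_ : (y, c) ∈ B) (_ : ‖y - x0‖ ≤ 1),
      {u | c (x0 + (1 / ((k.1 : ℝ) + 1)) • u - y) ≤ k.2} := by
      ext u; simp [G]
    rw [this]
    refine isClosed_iInter fun y => isClosed_iInter fun c => isClosed_iInter fun _ =>
      isClosed_iInter fun _ => ?_
    exact isClosed_le (by fun_prop) continuous_const
  have hGu : ⋃ k, G k = univ := by
    rw [eq_univ_iff_forall]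
    intro u
    obtain ⟨k, hk⟩ := exists_nat_gt (‖u‖ / ρ0)
    have hmem : x0 + (1 / ((k : ℝ) + 1)) • u ∈ opDom B := by
      apply hball
      rw [mem_ball_iff_norm, add_sub_cancel_left, norm_smul, Real.norm_of_nonneg (by positivity)]
      rw [div_lt_iff₀ hρ0] at hk
      rw [div_mul_eq_mul_div, one_mul, div_lt_iff₀ (by positivity)]
      nlinarith
    obtain ⟨n, hn⟩ := hdom _ hmem
    exact mem_iUnion.2 ⟨(k, n), hn⟩
  obtain ⟨k, u1, hu1⟩ := nonempty_interior_of_iUnion_of_closed hGc hGu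
  obtain ⟨r1, hr1, hb1⟩ := Metric.mem_nhds_iff.1 (mem_interior_iff_mem_nhds.1 hu1)
  set κ : ℝ := 1 / ((k.1 : ℝ) + 1) with hκ
  have hκ0 : 0 < κ := by positivity
  obtain ⟨s, hs0, hs⟩ : ∃ s > 0, s * ‖u1‖ < ρ0 := by
    refine ⟨ρ0 / (‖u1‖ + 1), by positivity, ?_⟩
    rw [div_mul_eq_mul_div, div_lt_iff₀ (by positivity)]
    nlinarith [norm_nonneg u1]
  obtain ⟨m, hm⟩ := hdom (x0 - s • u1) (by
    apply hball
    rw [mem_ball_iff_norm, sub_sub_cancel_left, norm_neg, norm_smul, Real.norm_of_nonneg hs0.le]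
    exact hs)
  set N : ℝ := k.2 + m with hN
  set r2 : ℝ := s * κ * r1 / (κ + s) with hr2
  have hr2p : 0 < r2 := by positivity
  have hNb : ∀ e, ‖e‖ < r2 → ∀ y c, (y, c) ∈ B → ‖y - x0‖ ≤ 1 → c (x0 + e - y) ≤ N := by
    intro e he y c hc hy
    set e' := ((κ + s) / (s * κ)) • e with he'
    have he'n : ‖e'‖ < r1 := by
      rw [he', norm_smul, Real.norm_of_nonneg (by positivity), div_mul_eq_mul_div,
        div_lt_iff₀ (by positivity)]
      rw [hr2, lt_div_iff₀ (by positivity)] at he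
      linarith
    have h1 : c (x0 + κ • (u1 + e') - y) ≤ k.2 :=
      hb1 (a := u1 + e') (by rw [mem_ball_iff_norm, add_sub_cancel_left]; exact he'n) y c hc hy
    have h2 := hm y c hc hy
    have h3 : c (x0 + e - y) = (s / (κ + s)) * c (x0 + κ • (u1 + e') - y)
        + (κ / (κ + s)) * c (x0 - s • u1 - y) := by
      simp only [he', map_add, map_sub, map_smul, smul_eq_mul]
      field_simp
      ring
    rw [h3]
    have e1 : s / (κ + s) ≤ 1 := by rw [div_le_one (by positivity)]; linarith
    have e2 : κ / (κ + s) ≤ 1 := by rw [div_le_one (by positivity)]; linarith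
    have e3 : 0 ≤ s / (κ + s) := by positivity
    have e4 : 0 ≤ κ / (κ + s) := by positivity
    have hk2 : (0:ℝ) ≤ k.2 := by positivity
    have hm2 : (0:ℝ) ≤ m := by positivity
    nlinarith
  have hN0 : 0 ≤ N := by positivity
  refine ⟨min ρ0 (min 1 (r2 / 2)), by positivity, 2 * N / r2, by positivity, fun y hy => ?_,
    fun y b hy hb => ?_⟩
  · apply hball
    rw [mem_ball_iff_norm]
    exact hy.trans_le (min_le_left _ _)
  · have hy1 : ‖y - x0‖ ≤ 1 := hy.le.trans ((min_le_right _ _).trans (min_le_left _ _))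
    have hy2 : ‖y - x0‖ ≤ r2 / 2 := hy.le.trans ((min_le_right _ _).trans (min_le_right _ _))
    have h1 : r2 * ‖b‖ ≤ N + ‖b‖ * (r2 / 2) := by
      refine norm_le_of_ball b hr2p fun e he => ?_
      have h1 := hNb e he y b hb hy1
      have h2 := apply_le b (y - x0)
      have h3 : ‖b‖ * ‖y - x0‖ ≤ ‖b‖ * (r2 / 2) := by gcongr
      simp only [map_sub, map_add] at h1 h2
      linarith
    rw [le_div_iff₀ hr2p]
    linarith

/-- projection of the domain of the Fitzpatrick function -/
def pdom (B : Set (X × (X →L[ℝ] ℝ))) : Set X :=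
  {w | ∃ (v : X →L[ℝ] ℝ) (c : ℝ), ∀ y ys, (y, ys) ∈ B → ys w + v y - ys y ≤ c}

theorem fz_combo {w1 w2 : X} {v1 v2 : X →L[ℝ] ℝ} {c1 c2 a b : ℝ}
    (ha : 0 ≤ a) (hb : 0 ≤ b) (hab : a + b = 1)
    {y : X} {ys : X →L[ℝ] ℝ}
    (h1 : ys w1 + v1 y - ys y ≤ c1) (h2 : ys w2 + v2 y - ys y ≤ c2) :
    ys (a • w1 + b • w2) + (a • v1 + b • v2) y - ys y ≤ a * c1 + b * c2 := by
  simp only [map_add, map_smul, smul_eq_mul, add_apply, smul_apply]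
  obtain rfl : b = 1 - a := by linarith
  nlinarith

theorem convex_pdom (B : Set (X × (X →L[ℝ] ℝ))) : Convex ℝ (pdom B) := by
  rintro w1 ⟨v1, c1, h1⟩ w2 ⟨v2, c2, h2⟩ a b ha hb hab
  exact ⟨a • v1 + b • v2, a * c1 + b * c2, fun y ys h => fz_combo ha hb hab (h1 y ys h) (h2 y ys h)⟩

theorem dom_sub_pdom (h : IsMonotoneOp B) : opDom B ⊆ pdom B := by
  rintro x ⟨b, hb⟩
  refine ⟨b, b x, fun y c hc => ?_⟩
  have := mono4 h hb hc
  linarith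

/-- epigraph-type set -/
def epiT (B : Set (X × (X →L[ℝ] ℝ))) (z : X) : Set (X × ℝ) :=
  {p | ∃ (v : X →L[ℝ] ℝ) (c : ℝ), (∀ y ys, (y, ys) ∈ B → ys p.1 + v y - ys y ≤ c) ∧ p.2 = c - v z}

theorem convex_epiT (B : Set (X × (X →L[ℝ] ℝ))) (z : X) : Convex ℝ (epiT B z) := by
  rintro ⟨w1, r1⟩ ⟨v1, c1, h1, e1⟩ ⟨w2, r2⟩ ⟨v2, c2, h2, e2⟩ a b ha hb hab
  refine ⟨a • v1 + b • v2, a * c1 + b * c2, fun y ys h => fz_combo ha hb hab (h1 y ys h) (h2 y ys h), ?_⟩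
  simp only at e1 e2
  simp only [e1, e2, Prod.smul_mk, Prod.mk_add_mk, smul_eq_mul, add_apply, smul_apply]
  ring

theorem epiT_of_mem (h : IsMonotoneOp B) (z : X) {w : X} {v : X →L[ℝ] ℝ} (hw : (w, v) ∈ B) :
    (w, v (w - z)) ∈ epiT B z := by
  refine ⟨v, v w, fun y c hc => ?_, by simp⟩
  have := mono4 h hw hc
  simp only
  linarith

theorem fz_ge (h : IsMaxMonotoneOp B) {w : X} {v : X →L[ℝ] ℝ} {c : ℝ}
    (hc : ∀ y ys, (y, ys) ∈ B → ys w + v y - ys y ≤ c) : v w ≤ c := by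
  by_contra hlt
  push Not at hlt
  have hm : (w, v) ∈ B := by
    refine mem_of_related h fun y ys hy => ?_
    have := hc y ys hy
    simp only [sub_apply, map_sub]
    linarith
  have := hc w v hm
  linarith

theorem smul_mem_dom [CompleteSpace X] (h : IsMaxMonotoneOp B) (h0 : (0:X) ∈ interior (opDom B))
    {w : X} (hw : w ∈ pdom B) {t : ℝ} (ht0 : 0 ≤ t) (ht1 : t < 1) : t • w ∈ opDom B := by
  obtain ⟨ρ, hρ, M, hM, hd, hb⟩ := locbdd h.1 h0
  simp only [sub_zero] at hd hb
  set x := t • w with hx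
  obtain ⟨v, c, hv⟩ := hw
  have h1t : 0 < 1 - t := by linarith
  obtain ⟨u, α, hu1, hu2⟩ := sandwich {((x : X), (0:ℝ))} (epiT B x) (convex_singleton _)
    (convex_epiT B x) (by
      rintro w' r r' hs ⟨v', c', hv', hr⟩
      simp only [mem_singleton_iff, Prod.mk.injEq] at hs
      obtain ⟨rfl, rfl⟩ := hs
      have := fz_ge h hv'
      simp only at hr this
      linarith) x 0 (t * (c - v x) + (1 - t) * (M * (ρ + ‖x‖))) ((1 - t) * ρ) (by positivity)
    (by simp) (by
      intro x' hx'
      set e := (1 / (1 - t)) • (x' - x) with he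
      have hen : ‖e‖ < ρ := by
        rw [he, norm_smul, Real.norm_of_nonneg (by positivity), div_mul_eq_mul_div, one_mul,
          div_lt_iff₀ h1t]
        linarith
      obtain ⟨es, hes⟩ := hd e hen
      have hM' := hb e es hen hes
      have m1 := epiT_of_mem h.1 x hes
      have m2 : (w, c - v x) ∈ epiT B x := ⟨v, c, hv, rfl⟩
      have m3 := convex_epiT B x m2 m1 ht0 h1t.le (by ring)
      refine ⟨t * (c - v x) + (1 - t) * es (e - x), ?_, ?_⟩
      · have h5 := apply_le es (e - x)
        have h6 : ‖e - x‖ ≤ ρ + ‖x‖ := (norm_sub_le _ _).trans (by linarith)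
        have h7 : ‖es‖ * ‖e - x‖ ≤ M * (ρ + ‖x‖) := by gcongr
        have h8 : es (e - x) ≤ M * (ρ + ‖x‖) := h5.trans h7
        gcongr
      · have e9 : x' = t • w + (1 - t) • e := by
          rw [he, smul_smul, mul_one_div_cancel h1t.ne', one_smul, ← hx]; abel
        rw [e9]; simpa using m3)
  have hα := hu1 x 0 (by simp)
  refine ⟨-u, mem_of_related h fun y ys hy => ?_⟩
  have := hu2 _ _ (epiT_of_mem h.1 x hy)
  simp only [sub_apply, map_sub, neg_apply] at this ⊢
  linarith

theorem int_sub_dom {w : X} (hw : w ∈ interior (pdom B)) : ∃ κ : ℝ, κ > 0 ∧ (1 + κ) • w ∈ interior (pdom B) := by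
  have hc : Continuous fun κ : ℝ => (1 + κ) • w := by fun_prop
  have : (fun κ : ℝ => (1 + κ) • w) ⁻¹' interior (pdom B) ∈ 𝓝 (0:ℝ) := by
    apply hc.continuousAt.preimage_mem_nhds
    simpa using isOpen_interior.mem_nhds hw
  obtain ⟨r, hr, hb⟩ := Metric.mem_nhds_iff.1 this
  refine ⟨r / 2, by positivity, hb (a := r / 2) ?_⟩
  rw [mem_ball_iff_norm, sub_zero, Real.norm_of_nonneg (by positivity)]
  linarith

theorem int_pdom_sub [CompleteSpace X] (h : IsMaxMonotoneOp B) (h0 : (0:X) ∈ interior (opDom B))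
    {w : X} (hw : w ∈ interior (pdom B)) : w ∈ opDom B := by
  obtain ⟨κ, hκ, hm⟩ := int_sub_dom hw
  have h1 := smul_mem_dom h h0 (interior_subset hm) (t := (1 + κ)⁻¹) (by positivity)
    (inv_lt_one_of_one_lt₀ (by linarith))
  rwa [smul_smul, inv_mul_cancel₀ (by positivity), one_smul] at h1

theorem B0 (h : IsMonotoneOp B) {ρ M : ℝ} (hρ : 0 < ρ)
    (hd : ∀ y, ‖y‖ < ρ → y ∈ opDom B)
    (hb : ∀ y b, ‖y‖ < ρ → (y, b) ∈ B → ‖b‖ ≤ M) {x : X} {b : X →L[ℝ] ℝ} (hx : (x, b) ∈ B) :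
    ρ * ‖b‖ ≤ b x + M * (‖x‖ + ρ) := by
  refine norm_le_of_ball b hρ fun y hy => ?_
  obtain ⟨c, hc⟩ := hd y hy
  have h1 := hb y c hy hc
  have h2 := mono4 h hx hc
  have h3 := neg_apply_le c (x - y)
  have h4 : ‖x - y‖ ≤ ‖x‖ + ρ := (norm_sub_le _ _).trans (by linarith)
  have h5 : ‖c‖ * ‖x - y‖ ≤ M * (‖x‖ + ρ) :=
    mul_le_mul h1 h4 (norm_nonneg _) ((norm_nonneg _).trans h1)
  rw [map_sub] at h3
  linarith

theorem Bseg [CompleteSpace X] (h : IsMaxMonotoneOp B) (h0 : (0:X) ∈ interior (opDom B))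
    {ρ M : ℝ} (hρ : 0 < ρ) (hM : 0 ≤ M)
    (hd : ∀ y, ‖y‖ < ρ → y ∈ opDom B)
    (hb : ∀ y b, ‖y‖ < ρ → (y, b) ∈ B → ‖b‖ ≤ M) {q : X} (hq : q ∈ interior (pdom B)) :
    ∃ δ > 0, ∃ L ≥ 0, ∀ (τ : ℝ) (e : X), 0 ≤ τ → τ ≤ 1 → ‖e‖ < δ →
      τ • q + e ∈ opDom B ∧ ∀ b, (τ • q + e, b) ∈ B → ‖b‖ ≤ L := by
  obtain ⟨κ, hκ, hm⟩ := int_sub_dom hq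
  set w := (1 + κ) • q with hw
  obtain ⟨ws, hws⟩ := int_pdom_sub h h0 hm
  set δ := κ * ρ / (2 * (1 + κ)) with hδ
  have hδ0 : 0 < δ := by positivity
  have hδe : 2 * ((1 + κ) * δ) = κ * ρ := by rw [hδ]; field_simp
  set R := ‖q‖ + δ with hR
  set C0 := M * (R + ρ) with hC0
  set C1 := ‖ws‖ * (‖w‖ + R) with hC1
  have hC0p : 0 ≤ C0 := by positivity
  have hC1p : 0 ≤ C1 := by positivity
  refine ⟨δ, hδ0, ((1 + κ) * C0 + C1) / ((1 + κ) * δ), by positivity, fun τ e ht0 ht1 he => ⟨?_, ?_⟩⟩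
  · apply int_pdom_sub h h0
    set σ := τ / (1 + κ) with hσ
    have hσ0 : 0 ≤ σ := by positivity
    have hσ1 : κ / (1 + κ) ≤ 1 - σ := by
      rw [hσ, div_le_iff₀ (by positivity), sub_mul, div_mul_cancel₀ _ (by positivity)]; linarith
    have hσ2 : 0 < 1 - σ := lt_of_lt_of_le (by positivity) hσ1
    have hball : Metric.ball (0:X) ρ ⊆ interior (pdom B) := by
      apply interior_maximal _ Metric.isOpen_ball
      intro y hy
      exact dom_sub_pdom h.1 (hd y (by simpa using hy))
    have he' : (1 / (1 - σ)) • e ∈ interior (pdom B) := by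
      apply hball
      rw [mem_ball_zero_iff, norm_smul, Real.norm_of_nonneg (by positivity), div_mul_eq_mul_div,
        one_mul, div_lt_iff₀ hσ2]
      refine he.trans_le (le_trans ?_ (mul_le_mul_of_nonneg_left hσ1 hρ.le))
      rw [hδ, mul_div_assoc', div_le_div_iff₀ (by positivity) (by positivity)]
      have : 0 ≤ κ * ρ * (1 + κ) := by positivity
      nlinarith
    have := (convex_pdom B).interior hm he' hσ0 hσ2.le (by ring)
    have hσκ : σ * (1 + κ) = τ := by rw [hσ, div_mul_cancel₀ _ (by positivity)]
    rw [hw, smul_smul, smul_smul, mul_one_div_cancel hσ2.ne', one_smul, hσκ] at this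
    exact this
  · intro b hbx
    set x := τ • q + e with hx
    have hxn : ‖x‖ ≤ R := by
      refine (norm_add_le _ _).trans ?_
      rw [norm_smul, Real.norm_of_nonneg ht0]
      nlinarith [norm_nonneg q]
    have h1 := mono4 h.1 hws hbx
    have h2 := apply_le ws (w - x)
    have h3 : ‖ws‖ * ‖w - x‖ ≤ C1 := by
      rw [hC1]; gcongr; exact (norm_sub_le _ _).trans (by linarith)
    have h4 := B0 h.1 hρ hd hb hbx
    have h5 : M * (‖x‖ + ρ) ≤ C0 := by rw [hC0]; gcongr
    have h6 : (1 + κ) * b x = τ * b w + (1 + κ) * b e := by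
      simp only [hx, hw, map_add, map_smul, smul_eq_mul]; ring
    have h7 := apply_le b e
    have h8 : ‖b‖ * ‖e‖ ≤ ‖b‖ * δ := by gcongr
    rw [map_sub] at h2
    have h9 : b w ≤ b x + C1 := by linarith
    have h10 : τ * b w ≤ τ * (b x + C1) := by gcongr
    have h11 : (1 + κ - τ) * b x ≤ C1 + (1 + κ) * (‖b‖ * δ) := by nlinarith
    have h12 : (1 + κ - τ) * (ρ * ‖b‖ - C0) ≤ (1 + κ - τ) * b x :=
      mul_le_mul_of_nonneg_left (by linarith) (by linarith)
    have h13 : κ * (ρ * ‖b‖) ≤ (1 + κ - τ) * (ρ * ‖b‖) :=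
      mul_le_mul_of_nonneg_right (by linarith) (by positivity)
    have h14 : (1 + κ - τ) * C0 ≤ (1 + κ) * C0 :=
      mul_le_mul_of_nonneg_right (by linarith) hC0p
    rw [le_div_iff₀ (by positivity)]
    have h15 : κ * (ρ * ‖b‖) = 2 * (‖b‖ * ((1 + κ) * δ)) := by
      rw [← mul_assoc, ← hδe]; ring
    nlinarith

open scoped Pointwise in
theorem lemA (hF : ∀ U : Set X, IsOpen U → Convex ℝ U → (U ∩ opDom A).Nonempty →
      ∀ x : X, ∀ xs : X →L[ℝ] ℝ, x ∈ U →
        MonotonicallyRelated (A ∩ (U ×ˢ (univ : Set (X →L[ℝ] ℝ)))) (x, xs) → (x, xs) ∈ A)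
    (h0 : (0:X) ∈ opDom A) (q : X) {K η δ : ℝ} (hK : 0 ≤ K) (hη : 0 < η) (hδ : 0 < δ) :
    ∃ (τ : ℝ) (e : X) (a : X →L[ℝ] ℝ), 0 ≤ τ ∧ τ ≤ 1 ∧ ‖e‖ < δ ∧ (τ • q + e, a) ∈ A ∧
      a (τ • q + e - q) ≤ - K * ‖τ • q + e - q‖ + η := by
  by_cases hq : q ∈ opDom A
  · obtain ⟨a, ha⟩ := hq
    exact ⟨1, 0, a, by norm_num, le_rfl, by simpa, by simpa using ha, by simp [hη.le]⟩
  set δ' := min δ (η / (2 * (K + 1))) with hδ'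
  have hδ'0 : 0 < δ' := by positivity
  have hKδ : 2 * (K * δ') ≤ η := by
    have h1 : δ' ≤ η / (2 * (K + 1)) := min_le_right _ _
    rw [le_div_iff₀ (by positivity)] at h1
    nlinarith
  obtain ⟨g, hg1, hg2⟩ := exists_dual_vector'' ℝ q
  simp only [RCLike.ofReal_real_eq_id, id_eq] at hg2
  have hnot : (q, K • g) ∉ A := fun hh => hq ⟨_, hh⟩
  have hne := mt (hF (segment ℝ 0 q + Metric.ball 0 δ') (Metric.isOpen_ball.add_left)
    ((convex_segment _ _).add (convex_ball _ _))
    ⟨0, ⟨0, left_mem_segment _ _ _, 0, by simpa using hδ'0, by simp⟩, h0⟩ q (K • g)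
    ⟨q, right_mem_segment _ _ _, 0, by simpa using hδ'0, by simp⟩) hnot
  unfold MonotonicallyRelated at hne
  push Not at hne
  obtain ⟨⟨x, a⟩, ⟨hxa, hxU, -⟩, hlt⟩ := hne
  obtain ⟨s, hs, e, he, rfl⟩ := hxU
  rw [segment_eq_image_lineMap] at hs
  obtain ⟨τ, ⟨ht0, ht1⟩, rfl⟩ := hs
  simp only [AffineMap.lineMap_apply, vsub_eq_sub, sub_zero, vadd_eq_add, add_zero] at hxa hlt
  rw [mem_ball_zero_iff] at he
  refine ⟨τ, e, a, ht0, ht1, he.trans_le (min_le_left _ _), hxa, ?_⟩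
  set x := τ • q + e with hx
  have h1 : a (x - q) < K * g (x - q) := by
    simp only [sub_apply, smul_apply, smul_eq_mul, map_sub] at hlt ⊢
    linarith
  have h2 : g (x - q) = -(1 - τ) * ‖q‖ + g e := by
    rw [← hg2, hx]; simp only [map_sub, map_add, map_smul, smul_eq_mul]; ring
  have h3 : g e ≤ δ' := (apply_le g e).trans (by nlinarith [norm_nonneg e, norm_nonneg g])
  have h4 : ‖x - q‖ ≤ (1 - τ) * ‖q‖ + δ' := by
    have : x - q = -((1 - τ) • q) + e := by rw [hx]; module
    rw [this]
    refine (norm_add_le _ _).trans ?_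
    rw [norm_neg, norm_smul, Real.norm_of_nonneg (by linarith)]
    linarith
  have h5 : g (x - q) ≤ - ‖x - q‖ + 2 * δ' := by linarith
  have h6 : K * g (x - q) ≤ K * (- ‖x - q‖ + 2 * δ') := by gcongr
  linarith

set_option maxHeartbeats 1000000 in
theorem lem3 [CompleteSpace X] (hA : IsMonotoneOp A)
    (hF : ∀ U : Set X, IsOpen U → Convex ℝ U → (U ∩ opDom A).Nonempty →
      ∀ x : X, ∀ xs : X →L[ℝ] ℝ, x ∈ U →
        MonotonicallyRelated (A ∩ (U ×ˢ (univ : Set (X →L[ℝ] ℝ)))) (x, xs) → (x, xs) ∈ A)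
    (h : IsMaxMonotoneOp B) (h0 : (0:X) ∈ interior (opDom B)) {ε : ℝ} (hε : 0 < ε) {z : X}
    (hs : ∀ x a b, (x, a) ∈ A → (x, b) ∈ B → ε ≤ a (x - z) + b (x - z))
    {a0 ap : X →L[ℝ] ℝ} {p q : X} (ha0 : (0, a0) ∈ A) (hap : (p, ap) ∈ A)
    (hq : q ∈ interior (pdom B)) {m1 m2 m3 : ℝ} (hm1 : 0 < m1) (hm2 : 0 ≤ m2) (hm3 : 0 ≤ m3)
    (hm : m1 + m2 + m3 = 1) (hqe : q = m1 • z + m2 • p) {η : ℝ} (hη : 0 < η) :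
    ∃ x a b, (x, a) ∈ A ∧ (x, b) ∈ B ∧ ‖x - q‖ ≤ η ∧ ‖b‖ * ‖x - q‖ ≤ η ∧
      m1 * a (x - z) ≤ η + m2 * (‖ap‖ * (η + ‖q - p‖)) + m3 * (‖a0‖ * (η + ‖q‖)) := by
  obtain ⟨ρ, hρ, M, hM, hd, hb⟩ := locbdd h.1 h0
  simp only [sub_zero] at hd hb
  obtain ⟨δ, hδ, L, hL, hseg⟩ := Bseg h h0 hρ hM hd hb hq
  set R := ‖q‖ + δ with hR
  have hRp : 0 ≤ R := by positivity
  set C := 1 + ‖ap‖ * (R + ‖p‖) + ‖a0‖ * R + L * (R + ‖z‖) with hC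
  have hCp : 0 < C := by positivity
  obtain ⟨τ, e, a, ht0, ht1, he, hxa, hle⟩ := lemA hF ⟨a0, ha0⟩ q (K := C * (1 + L) / η)
    (η := min 1 η) (by positivity) (by positivity) hδ
  obtain ⟨⟨b, hxb⟩, hbL⟩ := hseg τ e ht0 ht1 he
  have hbn := hbL b hxb
  have hxn : ‖τ • q + e‖ ≤ R := by
    refine (norm_add_le _ _).trans ?_
    rw [norm_smul, Real.norm_of_nonneg ht0]
    nlinarith [norm_nonneg q]
  set x := τ • q + e with hx
  have hid : m1 * a (x - z) = a (x - q) - m2 * a (x - p) - m3 * a x := by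
    obtain rfl : m3 = 1 - m1 - m2 := by linarith
    rw [hqe]; simp only [map_sub, map_add, map_smul, smul_eq_mul]; ring
  have i1 : - a (x - p) ≤ ‖ap‖ * ‖x - p‖ := by
    have := mono4 hA hxa hap
    have h2 := neg_apply_le ap (x - p)
    rw [map_sub] at *; linarith
  have i2 : - a x ≤ ‖a0‖ * ‖x‖ := by
    have := mono4 hA hxa ha0
    have h2 := neg_apply_le a0 x
    simp only [map_zero] at this; linarith
  have j1 : m2 * (- a (x - p)) ≤ m2 * (‖ap‖ * ‖x - p‖) := by gcongr
  have j2 : m3 * (- a x) ≤ m3 * (‖a0‖ * ‖x‖) := by gcongr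
  have k1 : m2 * (‖ap‖ * ‖x - p‖) ≤ ‖ap‖ * (R + ‖p‖) := by
    have : ‖ap‖ * ‖x - p‖ ≤ ‖ap‖ * (R + ‖p‖) := by
      gcongr; exact (norm_sub_le _ _).trans (by linarith)
    have h' : 0 ≤ ‖ap‖ * ‖x - p‖ := by positivity
    nlinarith
  have k2 : m3 * (‖a0‖ * ‖x‖) ≤ ‖a0‖ * R := by
    have : ‖a0‖ * ‖x‖ ≤ ‖a0‖ * R := by gcongr
    have h' : 0 ≤ ‖a0‖ * ‖x‖ := by positivity
    nlinarith
  have k3 : m1 * b (x - z) ≤ L * (R + ‖z‖) := by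
    have h1 : b (x - z) ≤ L * (R + ‖z‖) := by
      refine (apply_le b _).trans ?_
      gcongr; exact (norm_sub_le _ _).trans (by linarith)
    have h2 : 0 ≤ L * (R + ‖z‖) := by positivity
    nlinarith
  have k4 : 0 < m1 * a (x - z) + m1 * b (x - z) := by
    have := hs x a b hxa hxb
    nlinarith
  have k5 : min 1 η ≤ 1 := min_le_left _ _
  have k5' : min 1 η ≤ η := min_le_right _ _
  have k6 : C * (1 + L) / η * ‖x - q‖ ≤ C := by linarith
  have k7 : (1 + L) * ‖x - q‖ ≤ η := by
    rw [div_mul_eq_mul_div, div_le_iff₀ hη, mul_assoc] at k6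
    exact le_of_mul_le_mul_left k6 hCp
  have hnx := norm_nonneg (x - q)
  have k8 : ‖x - q‖ ≤ η := by nlinarith
  refine ⟨x, a, b, hxa, hxb, k8, ?_, ?_⟩
  · have : ‖b‖ * ‖x - q‖ ≤ L * ‖x - q‖ := by gcongr
    linarith
  · have l1 : ‖x - p‖ ≤ η + ‖q - p‖ := by
      have : x - p = (x - q) + (q - p) := by abel
      rw [this]; exact (norm_add_le _ _).trans (by linarith)
    have l2 : ‖x‖ ≤ η + ‖q‖ := by
      have : x = (x - q) + q := by abel
      rw [this]; exact (norm_add_le _ _).trans (by linarith)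
    have l3 : m2 * (‖ap‖ * ‖x - p‖) ≤ m2 * (‖ap‖ * (η + ‖q - p‖)) := by gcongr
    have l4 : m3 * (‖a0‖ * ‖x‖) ≤ m3 * (‖a0‖ * (η + ‖q‖)) := by gcongr
    have l5 : 0 ≤ C * (1 + L) / η * ‖x - q‖ := by positivity
    linarith

theorem near_ray (h : IsMonotoneOp B) {ρ M : ℝ} (hρ : 0 < ρ)
    (hd : ∀ y, ‖y‖ < ρ → y ∈ opDom B)
    (hb : ∀ y b, ‖y‖ < ρ → (y, b) ∈ B → ‖b‖ ≤ M) (hM : 0 ≤ M)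
    {x z : X} {b : X →L[ℝ] ℝ} (hx : (x, b) ∈ B) {τ : ℝ} (ht0 : 0 ≤ τ) (ht1 : τ < 1)
    (hn : ‖x - τ • z‖ ≤ (1 - τ) * (3 / 4 * ρ)) :
    τ * b (x - z) ≤ - ((1 - τ) * (ρ / 4) * ‖b‖) + M * (‖x‖ + ρ) := by
  have h1 := B0 h hρ hd hb hx
  have h2 : τ * b (x - z) = - (1 - τ) * b x + b (x - τ • z) := by
    simp only [map_sub, map_smul, smul_eq_mul]; ring
  have h3 := apply_le b (x - τ • z)
  have h4 : ‖b‖ * ‖x - τ • z‖ ≤ ‖b‖ * ((1 - τ) * (3 / 4 * ρ)) := by gcongr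
  have h5 : (1 - τ) * (ρ * ‖b‖) ≤ (1 - τ) * (b x + M * (‖x‖ + ρ)) :=
    mul_le_mul_of_nonneg_left h1 (by linarith)
  have h6 : 0 ≤ M * (‖x‖ + ρ) := by positivity
  rw [h2]
  nlinarith

theorem limit_dom (h : IsMaxMonotoneOp B) {p : X} {L : ℝ}
    (hl : ∀ η > 0, ∃ x b, (x, b) ∈ B ∧ ‖x - p‖ ≤ η ∧ ‖b‖ ≤ L) : p ∈ opDom B := by
  have hl' : ∀ n : ℕ, ∃ x b, (x, b) ∈ B ∧ ‖x - p‖ ≤ 1 / ((n : ℝ) + 1) ∧ ‖b‖ ≤ L :=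
    fun n => hl _ (by positivity)
  choose x b hB hx hb using hl'
  have hcomp := WeakDual.isCompact_closedBall (𝕜 := ℝ) (0 : StrongDual ℝ X) L
  let u : Ultrafilter ℕ := Filter.hyperfilter ℕ
  let F : ℕ → WeakDual ℝ X := fun n => StrongDual.toWeakDual (b n)
  obtain ⟨c, hc, hlim⟩ := hcomp.ultrafilter_le_nhds (u.map F) (by
    rw [Filter.le_principal_iff]
    refine Filter.mem_map.2 (Filter.univ_mem' fun n => ?_)
    simpa [F] using hb n)
  have hlim' : Tendsto F u (𝓝 c) := hlim
  have hu : (u : Filter ℕ) ≤ atTop := by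
    rw [← Nat.cofinite_eq_atTop]; exact Filter.hyperfilter_le_cofinite
  have hev : ∀ v : X, Tendsto (fun n => b n v) u (𝓝 (c v)) := fun v =>
    ((WeakDual.eval_continuous v).tendsto c).comp hlim'
  have hxl : Tendsto x u (𝓝 p) := by
    refine Tendsto.mono_left ?_ hu
    rw [tendsto_iff_norm_sub_tendsto_zero]
    exact squeeze_zero (fun _ => norm_nonneg _) hx tendsto_one_div_add_atTop_nhds_zero_nat
  refine ⟨WeakDual.toStrongDual c, mem_of_related h fun y ys hy => ?_⟩
  have hdiff : Tendsto (fun n => b n (x n - p)) u (𝓝 0) := by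
    have h1 : Tendsto (fun n => |L| * ‖x n - p‖) u (𝓝 0) := by
      have := (tendsto_iff_norm_sub_tendsto_zero.1 hxl).const_mul |L|
      simpa using this
    refine squeeze_zero_norm (fun n => ?_) h1
    refine ((b n).le_opNorm _).trans ?_
    gcongr
    exact (hb n).trans (le_abs_self L)
  have hT : Tendsto (fun n => b n (x n - p) + b n (p - y) - ys (x n) + ys y) u
      (𝓝 (0 + c (p - y) - ys p + ys y)) :=
    ((hdiff.add (hev (p - y))).sub ((ys.continuous.tendsto p).comp hxl)).add tendsto_const_nhds
  have hge := ge_of_tendsto' hT (b := 0) (fun n => by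
    have := mono4 h.1 (hB n) hy
    simp only [map_sub]; linarith)
  have e1 : (WeakDual.toStrongDual c) (p - y) = c (p - y) := rfl
  rw [sub_apply, e1, map_sub ys]
  linarith

set_option maxHeartbeats 1000000 in
theorem finish [CompleteSpace X] (hA : IsMonotoneOp A)
    (hF : ∀ U : Set X, IsOpen U → Convex ℝ U → (U ∩ opDom A).Nonempty →
      ∀ x : X, ∀ xs : X →L[ℝ] ℝ, x ∈ U →
        MonotonicallyRelated (A ∩ (U ×ˢ (univ : Set (X →L[ℝ] ℝ)))) (x, xs) → (x, xs) ∈ A)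
    (h : IsMaxMonotoneOp B) (h0 : (0:X) ∈ interior (opDom B)) {ε : ℝ} (hε : 0 < ε) {z : X}
    (hs : ∀ x a b, (x, a) ∈ A → (x, b) ∈ B → ε ≤ a (x - z) + b (x - z))
    {ρ M : ℝ} (hρ : 0 < ρ) (hM : 0 ≤ M)
    (hd : ∀ y, ‖y‖ < ρ → y ∈ opDom B)
    (hb : ∀ y b, ‖y‖ < ρ → (y, b) ∈ B → ‖b‖ ≤ M)
    {a0 ap : X →L[ℝ] ℝ} {p : X} (ha0 : (0, a0) ∈ A) (hap : (p, ap) ∈ A)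
    (hp1 : p ∈ closure (interior (pdom B))) (hp2 : p ∉ interior (pdom B))
    {τ : ℝ} (ht0 : 0 < τ) (ht1 : τ < 1) (hn : ‖p - τ • z‖ ≤ (1 - τ) * (ρ / 2)) : False := by
  have hball : Metric.ball (0:X) ρ ⊆ interior (pdom B) := by
    apply interior_maximal _ Metric.isOpen_ball
    intro y hy
    exact dom_sub_pdom h.1 (hd y (by simpa using hy))
  have ht1' : 0 < 1 - τ := by linarith
  set c := (1 - τ) * (ρ / 4) with hc
  have hcp : 0 < c := by positivity
  have hpdom : p ∈ opDom B := by
    set θ := min (1/2) (ρ / (2 * (‖z‖ + 1))) with hθ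
    have hθ0 : 0 < θ := by positivity
    have hθ1 : θ ≤ 1/2 := min_le_left _ _
    have hθz : θ • z ∈ interior (pdom B) := by
      apply hball
      rw [mem_ball_zero_iff, norm_smul, Real.norm_of_nonneg hθ0.le]
      have : θ ≤ ρ / (2 * (‖z‖ + 1)) := min_le_right _ _
      rw [le_div_iff₀ (by positivity)] at this
      nlinarith [norm_nonneg z]
    set G := ‖z‖ + ‖p‖ with hG
    have hGp : 0 ≤ G := by positivity
    set W := 1 + ‖ap‖ * (1 + G) + ‖a0‖ * (1 + G) with hW
    have hWp : 0 ≤ W := by positivity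
    refine limit_dom h (L := (W / θ + M * (‖p‖ + 2 * ρ)) / c) fun η0 hη0 => ?_
    set σ := min (1/2) (min η0 c / (1 + G)) with hσ
    have hσ0 : 0 < σ := by positivity
    have hσ1 : σ ≤ 1/2 := min_le_left _ _
    have hσ2 : σ * (1 + G) ≤ min η0 c := by
      have : σ ≤ min η0 c / (1 + G) := min_le_right _ _
      rwa [le_div_iff₀ (by positivity)] at this
    set q := (σ * θ) • z + (1 - σ) • p with hq
    have hqD : q ∈ interior (pdom B) := by
      have := (convex_pdom B).combo_interior_closure_mem_interior hθz
        (closure_mono interior_subset hp1) hσ0 (b := 1 - σ) (by linarith) (by ring)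
      rwa [smul_smul] at this
    obtain ⟨x, a, b, hxa, hxb, hxq, -, hle⟩ := lem3 hA hF h h0 hε hs ha0 hap hqD
      (m1 := σ * θ) (m2 := 1 - σ) (m3 := σ * (1 - θ)) (by positivity) (by linarith)
      (mul_nonneg hσ0.le (by linarith)) (by ring) hq hσ0
    have hqp : ‖q - p‖ ≤ σ * G := by
      have : q - p = σ • (θ • z - p) := by rw [hq]; module
      rw [this, norm_smul, Real.norm_of_nonneg hσ0.le]
      have h1 : ‖θ • z - p‖ ≤ G := by
        refine (norm_sub_le _ _).trans ?_
        rw [norm_smul, Real.norm_of_nonneg hθ0.le]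
        nlinarith [norm_nonneg z]
      gcongr
    have hqn : ‖q‖ ≤ G := by
      have h1 : ‖q‖ ≤ (σ * θ) * ‖z‖ + (1 - σ) * ‖p‖ := by
        refine (norm_add_le _ _).trans ?_
        rw [norm_smul, norm_smul, Real.norm_of_nonneg (by positivity : 0 ≤ σ * θ),
          Real.norm_of_nonneg (by linarith : (0:ℝ) ≤ 1 - σ)]
      have h2 : (σ * θ) * ‖z‖ ≤ 1 * ‖z‖ := by gcongr; nlinarith
      have h3 : (1 - σ) * ‖p‖ ≤ 1 * ‖p‖ := by gcongr; linarith
      linarith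
    have hxp : ‖x - p‖ ≤ σ * (1 + G) := by
      have : x - p = (x - q) + (q - p) := by abel
      rw [this]; exact (norm_add_le _ _).trans (by linarith)
    have hxp1 : ‖x - p‖ ≤ η0 := hxp.trans (hσ2.trans (min_le_left _ _))
    have hxp2 : ‖x - p‖ ≤ c := hxp.trans (hσ2.trans (min_le_right _ _))
    have hcρ : c ≤ ρ := by rw [hc]; nlinarith
    have hxn : ‖x‖ ≤ ‖p‖ + ρ := by
      have : x = (x - p) + p := by abel
      rw [this]; exact (norm_add_le _ _).trans (by linarith)
    have hxz : ‖x - τ • z‖ ≤ (1 - τ) * (3 / 4 * ρ) := by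
      have : x - τ • z = (x - p) + (p - τ • z) := by abel
      rw [this]; refine (norm_add_le _ _).trans ?_
      rw [hc] at hxp2
      linarith
    have hN := near_ray h.1 hρ hd hb hM hxb ht0.le ht1 hxz
    have hM2 : M * (‖x‖ + ρ) ≤ M * (‖p‖ + 2 * ρ) :=
      mul_le_mul_of_nonneg_left (by linarith) hM
    have haW : σ * θ * a (x - z) ≤ σ * W := by
      have i1 : (1 - σ) * (‖ap‖ * (σ + ‖q - p‖)) ≤ 1 * (‖ap‖ * (σ + σ * G)) := by
        gcongr
        linarith
      have i2 : σ * (1 - θ) * (‖a0‖ * (σ + ‖q‖)) ≤ σ * 1 * (‖a0‖ * (1 + G)) := by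
        gcongr
        · linarith
        · linarith
      rw [hW]
      linarith
    have haW' : a (x - z) ≤ W / θ := by
      rw [le_div_iff₀ hθ0]
      rw [mul_assoc] at haW
      have := le_of_mul_le_mul_left haW hσ0
      linarith
    have hW2 : 0 ≤ W / θ := by positivity
    have hfin := hs x a b hxa hxb
    refine ⟨x, b, hxb, hxp1, ?_⟩
    rw [le_div_iff₀ hcp]
    have e1 : τ * a (x - z) ≤ W / θ :=
      le_trans (mul_le_mul_of_nonneg_left haW' ht0.le) (mul_le_of_le_one_left hW2 ht1.le)
    have e2 : 0 < τ * (a (x - z) + b (x - z)) := mul_pos ht0 (by linarith)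
    rw [← hc] at hN
    linarith
  obtain ⟨bp, hbp⟩ := hpdom
  obtain ⟨f, hf⟩ := geometric_hahn_banach_open_point (convex_pdom B).interior isOpen_interior hp2
  have h0D : (0:X) ∈ interior (pdom B) := hball (by simpa using hρ)
  have hfdom : ∀ y ∈ opDom B, f y ≤ f p := by
    have hcl : closure (interior (pdom B)) = closure (pdom B) :=
      (convex_pdom B).closure_interior_eq_closure_of_nonempty_interior ⟨0, h0D⟩
    intro y hy
    have h1 : y ∈ closure (interior (pdom B)) := hcl ▸ subset_closure (dom_sub_pdom h.1 hy)
    exact closure_minimal (t := {y | f y ≤ f p}) (fun y hy => (hf y hy).le)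
      (isClosed_le f.continuous continuous_const) h1
  have hf0 : 0 < ‖f‖ := by
    rw [norm_pos_iff]
    rintro rfl
    simpa using hf 0 h0D
  have hmem : ∀ l : ℝ, 0 ≤ l → (p, bp + l • f) ∈ B := by
    intro l hl
    refine mem_of_related h fun y ys hy => ?_
    have i1 := mono4 h.1 hbp hy
    have i2 := hfdom y ⟨ys, hy⟩
    have i3 : 0 ≤ l * (f p - f y) := mul_nonneg hl (by linarith)
    simp only [sub_apply, add_apply, smul_apply, map_sub, smul_eq_mul]
    linarith
  set C := ‖ap‖ * ‖p - z‖ + M * (‖p‖ + ρ) with hC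
  have hCp : 0 ≤ C := by positivity
  have hbd : ∀ l : ℝ, 0 ≤ l → c * ‖bp + l • f‖ ≤ C := by
    intro l hl
    have hN := near_ray h.1 hρ hd hb hM (hmem l hl) ht0.le ht1 (hn.trans (by nlinarith))
    have hfin := hs _ _ _ hap (hmem l hl)
    have i1 := apply_le ap (p - z)
    have i2 : 0 ≤ ‖ap‖ * ‖p - z‖ := by positivity
    have e1 : τ * ap (p - z) ≤ ‖ap‖ * ‖p - z‖ :=
      le_trans (mul_le_mul_of_nonneg_left i1 ht0.le) (mul_le_of_le_one_left i2 ht1.le)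
    have e2 : 0 < τ * (ap (p - z) + (bp + l • f) (p - z)) := mul_pos ht0 (by linarith)
    rw [← hc] at hN
    linarith
  set l := (C / c + ‖bp‖ + 1) / ‖f‖ with hl
  have hl0 : 0 ≤ l := by positivity
  have i1 := hbd l hl0
  have i2 : l * ‖f‖ ≤ ‖bp + l • f‖ + ‖bp‖ := by
    have : l • f = (bp + l • f) - bp := by abel
    have h2 := norm_sub_le (bp + l • f) bp
    rw [← this, norm_smul, Real.norm_of_nonneg hl0] at h2
    exact h2
  have i3 : l * ‖f‖ = C / c + ‖bp‖ + 1 := by rw [hl]; field_simp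
  have i4 : ‖bp + l • f‖ ≤ C / c := by rw [le_div_iff₀ hcp]; linarith
  linarith

set_option maxHeartbeats 1000000 in
theorem findp [CompleteSpace X] (hA : IsMonotoneOp A)
    (hF : ∀ U : Set X, IsOpen U → Convex ℝ U → (U ∩ opDom A).Nonempty →
      ∀ x : X, ∀ xs : X →L[ℝ] ℝ, x ∈ U →
        MonotonicallyRelated (A ∩ (U ×ˢ (univ : Set (X →L[ℝ] ℝ)))) (x, xs) → (x, xs) ∈ A)
    (hst : ∀ x ∈ opDom A, segment ℝ 0 x ⊆ opDom A)
    (h : IsMaxMonotoneOp B) (h0 : (0:X) ∈ interior (opDom B)) {ε : ℝ} (hε : 0 < ε) {z : X}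
    (hs : ∀ x a b, (x, a) ∈ A → (x, b) ∈ B → ε ≤ a (x - z) + b (x - z))
    {ρ M : ℝ} (hρ : 0 < ρ) (hM : 0 ≤ M)
    (hd : ∀ y, ‖y‖ < ρ → y ∈ opDom B)
    (hb : ∀ y b, ‖y‖ < ρ → (y, b) ∈ B → ‖b‖ ≤ M)
    {a0 : X →L[ℝ] ℝ} (ha0 : (0, a0) ∈ A) (hz : z ∉ closure (interior (pdom B))) :
    ∃ p ∈ opDom A, p ∈ closure (interior (pdom B)) ∧ p ∉ interior (pdom B) ∧
      ∃ τ : ℝ, 0 < τ ∧ τ < 1 ∧ ‖p - τ • z‖ ≤ (1 - τ) * (ρ / 2) := by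
  have hball : Metric.ball (0:X) ρ ⊆ interior (pdom B) := by
    apply interior_maximal _ Metric.isOpen_ball
    intro y hy
    exact dom_sub_pdom h.1 (hd y (by simpa using hy))
  obtain ⟨r, hr, hrb⟩ := Metric.mem_nhds_iff.1 (isClosed_closure.isOpen_compl.mem_nhds hz)
  obtain ⟨s, d, hs0, hs1, hd0, hsd⟩ : ∃ s d : ℝ, 0 < s ∧ s < 1 ∧ 0 < d ∧
      ∀ x ∈ interior (pdom B), d ≤ ‖x - s • z‖ := by
    set κ := min (1/2) (r / (2 * (‖z‖ + 1))) with hκ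
    have hκ0 : 0 < κ := by positivity
    have hκ1 : κ ≤ 1/2 := min_le_left _ _
    have hκ2 : κ * ‖z‖ ≤ r / 2 := by
      have : κ ≤ r / (2 * (‖z‖ + 1)) := min_le_right _ _
      rw [le_div_iff₀ (by positivity)] at this
      nlinarith [norm_nonneg z]
    refine ⟨1 - κ, r / 2, by linarith, by linarith, by positivity, fun x hx => ?_⟩
    by_contra hlt
    push Not at hlt
    have : x ∈ Metric.ball z r := by
      rw [mem_ball_iff_norm]
      have e1 : x - z = (x - (1 - κ) • z) + (-(κ • z)) := by module
      rw [e1]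
      refine (norm_add_le _ _).trans_lt ?_
      rw [norm_neg, norm_smul, Real.norm_of_nonneg hκ0.le]
      linarith
    exact hrb this (subset_closure hx)
  set δ := (1 - s) * (ρ / 2) with hδ
  have h1s : 0 < 1 - s := by linarith
  have hδ0 : 0 < δ := by positivity
  have hδρ : δ ≤ ρ / 2 := by rw [hδ]; nlinarith
  set W := M * (‖z‖ + 2 * ρ) with hW
  have hWp : 0 ≤ W := by positivity
  set CD := W * ‖z‖ * 2 / ρ + M * (ρ + ‖z‖) with hCD
  have hCDp : 0 ≤ CD := by positivity
  set C := 1 + ‖a0‖ * (‖z‖ + ρ) + CD with hC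
  have hCp : 0 < C := by positivity
  obtain ⟨τ, e, a, ht0, ht1, he, hxa, hle⟩ := lemA hF ⟨a0, ha0⟩ (s • z) (K := C / d)
    (η := 1) (by positivity) one_pos hδ0
  set x := τ • s • z + e with hx
  set T := τ * s with hT
  have hT0 : 0 ≤ T := by positivity
  have hTs : T ≤ s := by rw [hT]; nlinarith
  have hxe : x - T • z = e := by rw [hx, smul_smul, ← hT]; abel
  have hxn : ‖x‖ ≤ T * ‖z‖ + ‖e‖ := by
    have : x = T • z + e := by rw [← hxe]; abel
    rw [this]; refine (norm_add_le _ _).trans ?_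
    rw [norm_smul, Real.norm_of_nonneg hT0]
  have hTz : T * ‖z‖ ≤ ‖z‖ := mul_le_of_le_one_left (norm_nonneg _) (by linarith)
  have hδT : δ ≤ (1 - T) * (ρ / 2) := by rw [hδ]; gcongr
  have hxD : x ∉ interior (pdom B) := by
    intro hxD
    obtain ⟨b, hxb⟩ := int_pdom_sub h h0 hxD
    have hbz : b (x - z) ≤ CD := by
      by_cases hxρ : ‖x‖ < ρ
      · have i1 : b (x - z) ≤ M * (ρ + ‖z‖) := by
          refine (apply_le b _).trans ?_
          exact mul_le_mul (hb x b hxρ hxb) ((norm_sub_le _ _).trans (by linarith))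
            (norm_nonneg _) hM
        have i2 : 0 ≤ W * ‖z‖ * 2 / ρ := by positivity
        linarith
      · have hN := near_ray h.1 hρ hd hb hM hxb hT0 (by linarith : T < 1) (z := z) (by
          rw [hxe]; nlinarith)
        have i0 : 0 ≤ (1 - T) * (ρ / 4) * ‖b‖ :=
          mul_nonneg (mul_nonneg (by linarith) (by linarith)) (norm_nonneg _)
        have i1 : T * b (x - z) ≤ W := by
          have : M * (‖x‖ + ρ) ≤ W := by rw [hW]; exact mul_le_mul_of_nonneg_left (by linarith) hM
          linarith
        have i2 : ρ / 2 ≤ T * ‖z‖ := by linarith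
        have i3 : 0 ≤ M * (ρ + ‖z‖) := by positivity
        have i4 : b (x - z) ≤ W * ‖z‖ * 2 / ρ := by
          rcases le_total (b (x - z)) 0 with hneg | hpos
          · exact hneg.trans (by positivity)
          · rw [le_div_iff₀ hρ]
            have j1 := mul_le_mul_of_nonneg_right i2 hpos
            have j2 := mul_le_mul_of_nonneg_right i1 (norm_nonneg z)
            linarith
        linarith
    have hdx := hsd x hxD
    have hid : s * a (x - z) = a (x - s • z) - (1 - s) * a x := by
      simp only [map_sub, map_smul, smul_eq_mul]; ring
    have i2 : - a x ≤ ‖a0‖ * (‖z‖ + ρ) := by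
      have := mono4 hA hxa ha0
      have h2 := neg_apply_le a0 x
      have h3 : ‖a0‖ * ‖x‖ ≤ ‖a0‖ * (‖z‖ + ρ) :=
        mul_le_mul_of_nonneg_left (by linarith) (norm_nonneg _)
      simp only [map_zero] at this; linarith
    have i3 : (1 - s) * (- a x) ≤ ‖a0‖ * (‖z‖ + ρ) := by
      refine le_trans (mul_le_mul_of_nonneg_left i2 h1s.le) ?_
      exact mul_le_of_le_one_left (by positivity) (by linarith)
    have i4 : C ≤ C / d * ‖x - s • z‖ := by
      rw [div_mul_eq_mul_div, le_div_iff₀ hd0]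
      gcongr
    have i5 : s * b (x - z) ≤ CD := by
      refine le_trans (mul_le_mul_of_nonneg_left hbz hs0.le) ?_
      exact mul_le_of_le_one_left hCDp hs1.le
    have i6 : 0 < s * (a (x - z) + b (x - z)) := mul_pos hs0 (by linarith [hs x a b hxa hxb])
    linarith
  obtain ⟨p, hp, hpf⟩ : ∃ p ∈ segment ℝ 0 x,
      p ∈ closure (interior (pdom B)) ∧ p ∉ interior (pdom B) := by
    by_contra hcon
    push Not at hcon
    obtain ⟨q, -, hq1, hq2⟩ := (convex_segment (𝕜 := ℝ) 0 x).isPreconnected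
      (interior (pdom B)) (closure (interior (pdom B)))ᶜ isOpen_interior
      isClosed_closure.isOpen_compl
      (fun q hq => by
        by_cases hc : q ∈ closure (interior (pdom B))
        · exact Or.inl (hcon q hq hc)
        · exact Or.inr hc)
      ⟨0, left_mem_segment _ _ _, hball (by simpa using hρ)⟩
      ⟨x, right_mem_segment _ _ _, fun hc => hxD (hcon x (right_mem_segment _ _ _) hc)⟩
    exact hq2 (subset_closure hq1)
  refine ⟨p, hst x ⟨a, hxa⟩ hp, hpf.1, hpf.2, ?_⟩
  rw [segment_eq_image_lineMap] at hp
  obtain ⟨l, ⟨hl0, hl1⟩, rfl⟩ := hp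
  simp only [AffineMap.lineMap_apply, vsub_eq_sub, sub_zero, vadd_eq_add, add_zero] at hpf ⊢
  have hlx : l • x - (l * T) • z = l • e := by rw [← hxe]; module
  have hle' : ‖l • e‖ ≤ δ := by
    rw [norm_smul, Real.norm_of_nonneg hl0]
    exact (mul_le_of_le_one_left (norm_nonneg _) hl1).trans he.le
  have hlT : l * T ≤ s := (mul_le_of_le_one_left hT0 hl1).trans hTs
  refine ⟨l * T, ?_, by linarith, ?_⟩
  · refine lt_of_le_of_ne (by positivity) fun h00 => hpf.2 (hball ?_)
    rw [← h00, zero_smul, sub_zero] at hlx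
    rw [hlx, mem_ball_zero_iff]
    linarith
  · rw [hlx]
    refine hle'.trans ?_
    rw [hδ]; gcongr

set_option maxHeartbeats 1000000 in
theorem partI0 [CompleteSpace X] (hA : IsMonotoneOp A)
    (hF : ∀ U : Set X, IsOpen U → Convex ℝ U → (U ∩ opDom A).Nonempty →
      ∀ x : X, ∀ xs : X →L[ℝ] ℝ, x ∈ U →
        MonotonicallyRelated (A ∩ (U ×ˢ (univ : Set (X →L[ℝ] ℝ)))) (x, xs) → (x, xs) ∈ A)
    (hst : ∀ x ∈ opDom A, segment ℝ 0 x ⊆ opDom A) (hA0 : (0:X) ∈ opDom A)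
    (h : IsMaxMonotoneOp B) (h0 : (0:X) ∈ interior (opDom B)) {ε : ℝ} (hε : 0 < ε) {z : X}
    (hs : ∀ x a b, (x, a) ∈ A → (x, b) ∈ B → ε ≤ a (x - z) + b (x - z)) : False := by
  obtain ⟨ρ, hρ, M, hM, hd, hb⟩ := locbdd h.1 h0
  simp only [sub_zero] at hd hb
  obtain ⟨a0, ha0⟩ := hA0
  by_cases hz : z ∈ closure (interior (pdom B))
  · obtain ⟨b0, hb0⟩ := interior_subset h0
    have h0D : (0:X) ∈ interior (pdom B) := interior_mono (dom_sub_pdom h.1) h0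
    set S := (‖a0‖ + ‖b0‖) * (1 + ‖z‖) with hS
    have hSp : 0 ≤ S := by positivity
    set σ := ε / (8 * (S + ε)) with hσ
    have hσ0 : 0 < σ := by positivity
    have hσe : σ * (8 * (S + ε)) = ε := by rw [hσ]; field_simp
    have hσS : σ * S ≤ ε / 8 := by nlinarith
    have hσ1 : σ ≤ 1 / 8 := by
      rw [hσ, div_le_iff₀ (by positivity)]; linarith
    have hq := (convex_pdom B).combo_interior_closure_mem_interior h0D
        (closure_mono interior_subset hz) hσ0 (b := 1 - σ) (by linarith) (by ring)
    rw [smul_zero, zero_add] at hq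
    have hη : 0 < min 1 (ε / 16) := by positivity
    obtain ⟨x, a, b, hxa, hxb, hxq, hbq, hle⟩ := lem3 hA hF h h0 hε hs ha0 ha0 hq
      (m1 := 1 - σ) (m2 := 0) (m3 := σ) (by linarith) le_rfl hσ0.le (by ring) (by simp) hη
    set η := min 1 (ε / 16) with hηd
    have hη1 : η ≤ 1 := min_le_left _ _
    have hη2 : η ≤ ε / 16 := min_le_right _ _
    set q := (1 - σ) • z with hqd
    have hqn : ‖q‖ ≤ ‖z‖ := by
      rw [hqd, norm_smul, Real.norm_of_nonneg (by linarith)]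
      exact mul_le_of_le_one_left (norm_nonneg _) (by linarith)
    have hxn : ‖x‖ ≤ 1 + ‖z‖ := by
      have : x = (x - q) + q := by abel
      rw [this]; exact (norm_add_le _ _).trans (by linarith)
    have i1 : - b x ≤ ‖b0‖ * (1 + ‖z‖) := by
      have := mono4 h.1 hxb hb0
      have h2 := neg_apply_le b0 x
      have h3 : ‖b0‖ * ‖x‖ ≤ ‖b0‖ * (1 + ‖z‖) := by gcongr
      simp only [map_zero] at this; linarith
    have i2 : (1 - σ) * b (x - z) = b (x - q) - σ * b x := by
      rw [hqd]; simp only [map_sub, map_smul, smul_eq_mul]; ring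
    have i3 : σ * (- b x) ≤ σ * (‖b0‖ * (1 + ‖z‖)) := by gcongr
    have i4 := apply_le b (x - q)
    have i5 : σ * (‖a0‖ * (η + ‖q‖)) ≤ σ * (‖a0‖ * (1 + ‖z‖)) := by gcongr
    have i6 := mul_le_mul_of_nonneg_left (hs x a b hxa hxb) (by linarith : 0 ≤ 1 - σ)
    have i7 : σ * (‖a0‖ * (1 + ‖z‖)) + σ * (‖b0‖ * (1 + ‖z‖)) = σ * S := by rw [hS]; ring
    have i8 : σ * ε ≤ 1 / 8 * ε := by gcongr
    simp only [zero_mul, add_zero] at hle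
    linarith
  · obtain ⟨p, ⟨ap, hap⟩, hp1, hp2, τ, ht0, ht1, hn⟩ :=
      findp hA hF hst h h0 hε hs hρ hM hd hb ha0 hz
    exact finish hA hF h h0 hε hs hρ hM hd hb ha0 hap hp1 hp2 ht0 ht1 hn

/-- translated operator -/
def tr (A : Set (X × (X →L[ℝ] ℝ))) (x0 : X) (u : X →L[ℝ] ℝ) : Set (X × (X →L[ℝ] ℝ)) :=
  {p | (p.1 + x0, p.2 + u) ∈ A}

theorem mem_tr {x0 : X} {u : X →L[ℝ] ℝ} {x : X} {a : X →L[ℝ] ℝ} :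
    (x, a) ∈ tr A x0 u ↔ (x + x0, a + u) ∈ A := Iff.rfl

theorem tr_mono (h : IsMonotoneOp A) (x0 : X) (u : X →L[ℝ] ℝ) : IsMonotoneOp (tr A x0 u) := by
  rintro ⟨x, a⟩ hx ⟨y, b⟩ hy
  have := h _ hx _ hy
  simpa using this

theorem dom_tr {x0 : X} {u : X →L[ℝ] ℝ} {x : X} : x ∈ opDom (tr A x0 u) ↔ x + x0 ∈ opDom A := by
  constructor
  · rintro ⟨a, ha⟩; exact ⟨_, ha⟩
  · rintro ⟨a, ha⟩; exact ⟨a - u, by rw [mem_tr]; simpa using ha⟩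

theorem max_of_related (h : IsMonotoneOp A) (hr : ∀ x xs,
    (∀ y ys, (y, ys) ∈ A → 0 ≤ (xs - ys) (x - y)) → (x, xs) ∈ A) : IsMaxMonotoneOp A := by
  refine ⟨h, fun C hC hAC => Subset.antisymm ?_ hAC⟩
  rintro ⟨x, xs⟩ hx
  exact hr x xs fun y ys hy => hC _ hx _ (hAC hy)

theorem tr_max (h : IsMaxMonotoneOp A) (x0 : X) (u : X →L[ℝ] ℝ) : IsMaxMonotoneOp (tr A x0 u) := by
  refine max_of_related (tr_mono h.1 x0 u) fun x xs hr => ?_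
  refine mem_of_related h fun y ys hy => ?_
  have := hr (y - x0) (ys - u) (by rw [mem_tr]; simpa using hy)
  have e1 : xs + u - ys = xs - (ys - u) := by abel
  have e2 : x + x0 - y = x - (y - x0) := by abel
  simp only at *
  rw [e1, e2]; exact this

theorem partI [CompleteSpace X] (hFPV : IsFPV A) (h : IsMaxMonotoneOp B) {x0 : X}
    (hx0 : x0 ∈ starSet (opDom A)) (hx0' : x0 ∈ interior (opDom B)) (z : X) (zs : X →L[ℝ] ℝ)
    {ε : ℝ} (hε : 0 < ε) :
    ∃ x a b, (x, a) ∈ A ∧ (x, b) ∈ B ∧ (a + b) z + zs x - (a + b) x > zs z - ε := by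
  by_contra hcon
  push Not at hcon
  have hcont : Continuous fun y : X => y + x0 := by fun_prop
  refine partI0 (A := tr A x0 zs) (B := tr B x0 0) (tr_mono hFPV.1.1 _ _) ?_ ?_ ?_ (tr_max h _ _) ?_
    hε (z := z - x0) ?_
  · rintro U hUo hUc ⟨v, hvU, hv⟩ x xs hx hr
    rw [dom_tr] at hv
    rw [mem_tr]
    have hpre : ∀ y, y ∈ (fun y => y - x0) ⁻¹' U ↔ y - x0 ∈ U := fun _ => Iff.rfl
    refine hFPV.2 ((fun y => y - x0) ⁻¹' U) (hUo.preimage (by fun_prop)) ?_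
      ⟨v + x0, by simpa using hvU, hv⟩ _ _ (by simpa using hx) ?_
    · intro y1 h1 y2 h2 a b ha hb hab
      have := hUc h1 h2 ha hb hab
      rw [hpre]
      convert this using 1
      obtain rfl : b = 1 - a := by linarith
      module
    · rintro ⟨y, ys⟩ ⟨hy, hyU, -⟩
      have := hr (y - x0, ys - zs) ⟨by rw [mem_tr]; simpa using hy, hyU, mem_univ _⟩
      have e1 : xs + zs - ys = xs - (ys - zs) := by abel
      have e2 : x + x0 - y = x - (y - x0) := by abel
      simp only at *
      rw [e1, e2]; exact this
  · intro x hx y hy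
    rw [dom_tr] at hx ⊢
    apply hx0.2 _ hx
    have := (mem_segment_translate ℝ x0 (x := y) (b := 0) (c := x)).2 hy
    simpa [add_comm] using this
  · rw [dom_tr]; simpa using hx0.1
  · have : opDom (tr B x0 0) = (fun y => y + x0) ⁻¹' opDom B := by
      ext y; exact dom_tr
    rw [this]
    apply preimage_interior_subset_interior_preimage hcont
    simpa using hx0'
  · intro x a b ha hb
    rw [mem_tr] at ha hb
    have := hcon _ _ _ ha hb
    simp only [add_apply, map_add, map_sub, add_zero] at *
    linarith

theorem partII [CompleteSpace X] (hFPV : IsFPV A) (h : IsMaxMonotoneOp B) {x0 : X}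
    (hx0 : x0 ∈ starSet (opDom A)) (hx0' : x0 ∈ interior (opDom B)) (z : X) (zs : X →L[ℝ] ℝ)
    (hr : ∀ x a b, (x, a) ∈ A → (x, b) ∈ B → 0 ≤ (zs - (a + b)) (z - x)) :
    ∃ a b, (z, a) ∈ A ∧ (z, b) ∈ B ∧ zs = a + b := by
  have hAm := hFPV.1
  obtain ⟨ρ, hρ, M, hM, hd, hb⟩ := locbdd h.1 hx0'
  have key : ∀ (w : X) (u v : X →L[ℝ] ℝ) (c1 c2 : ℝ),
      (∀ y ys, (y, ys) ∈ A → ys w + u y - ys y ≤ c1) →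
      (∀ y ys, (y, ys) ∈ B → ys w + v y - ys y ≤ c2) →
      (u + v) z + zs w - zs z ≤ c1 + c2 := by
    intro w u v c1 c2 h1 h2
    set ws := u + v with hws
    have hineq : ∀ t : ℝ, 0 < t → t ≤ 1 →
        (1 - t) * (zs w + ws z) + t * ws w ≤ (c1 + c2) + (1 - t) * zs z := by
      intro t ht0 ht1
      have hsub : ((1 - t) • zs + t • ws) ((1 - t) • z + t • w) ≤
          (1 - t) * zs z + t * (c1 + c2) := by
        refine le_of_forall_pos_le_add fun ε hε => ?_
        obtain ⟨x, a, b, ha, hb', hgt⟩ := partI hFPV h hx0 hx0' ((1 - t) • z + t • w)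
          ((1 - t) • zs + t • ws) hε
        have i1 := h1 x a ha
        have i2 := h2 x b hb'
        have i3 := hr x a b ha hb'
        have i4 : (a + b) z + zs x - (a + b) x ≤ zs z := by
          simp only [sub_apply, map_sub, add_apply] at i3 ⊢; linarith
        have i5 : (a + b) w + ws x - (a + b) x ≤ c1 + c2 := by
          simp only [hws, add_apply]; linarith
        have := fz_combo (a := 1 - t) (b := t) (by linarith) ht0.le (by ring) i4 i5
        linarith
      simp only [add_apply, smul_apply, map_add, map_smul, smul_eq_mul] at hsub
      have : t * ((1 - t) * (zs w + ws z) + t * ws w) ≤ t * ((c1 + c2) + (1 - t) * zs z) := by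
        linarith
      exact le_of_mul_le_mul_left this ht0
    have hl1 : Tendsto (fun t : ℝ => (1 - t) * (zs w + ws z) + t * ws w) (𝓝[>] 0)
        (𝓝 ((1 - 0) * (zs w + ws z) + 0 * ws w)) :=
      (Continuous.tendsto (by fun_prop) 0).mono_left nhdsWithin_le_nhds
    have hl2 : Tendsto (fun t : ℝ => (c1 + c2) + (1 - t) * zs z) (𝓝[>] 0)
        (𝓝 ((c1 + c2) + (1 - 0) * zs z)) :=
      (Continuous.tendsto (by fun_prop) 0).mono_left nhdsWithin_le_nhds
    have := le_of_tendsto_of_tendsto hl1 hl2 (by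
      filter_upwards [Ioc_mem_nhdsGT (zero_lt_one (α := ℝ))] with t ht
      exact hineq t ht.1 ht.2)
    linarith
  let S : Set (X × ℝ) := {p | (p.1, p.2 + zs p.1 - zs z) ∈ epiT A z}
  have hS : Convex ℝ S := by
    intro p hp q hq a b ha hb' hab
    have := convex_epiT A z hp hq ha hb' hab
    simp only [S, mem_setOf_eq]
    convert this using 1
    ext
    · simp
    · obtain rfl : b = 1 - a := by linarith
      simp only [Prod.snd_add, Prod.smul_snd, Prod.fst_add, Prod.smul_fst, map_add, map_smul,
        smul_eq_mul]
      ring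
  obtain ⟨as0, has0⟩ := hx0.1
  obtain ⟨u, α, hu1, hu2⟩ := sandwich S (epiT B z) hS (convex_epiT B z) (by
      rintro w r r' ⟨u, c1, h1, e1⟩ ⟨v, c2, h2, e2⟩
      have := key w u v c1 c2 h1 h2
      simp only [add_apply] at *
      linarith) x0 (as0 (x0 - z) - zs x0 + zs z) (M * (ρ + ‖x0 - z‖)) ρ hρ
    (by
      have := epiT_of_mem hAm.1 z has0
      simp only [S, mem_setOf_eq]
      convert this using 2
      ring)
    (by
      intro w hw
      obtain ⟨ws, hws⟩ := hd w hw
      refine ⟨_, ?_, epiT_of_mem h.1 z hws⟩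
      have e1 : w - z = (w - x0) + (x0 - z) := by abel
      refine (apply_le _ _).trans ?_
      refine mul_le_mul (hb w ws hw hws) ?_ (norm_nonneg _) hM
      rw [e1]; exact (norm_add_le _ _).trans (by linarith))
  have hA1 : ∀ y ys, (y, ys) ∈ A → (u + zs) y + α + - zs z ≤ ys (y - z) := by
    intro y ys hy
    have := hu1 y (ys (y - z) - zs y + zs z) (by
      have := epiT_of_mem hAm.1 z hy
      simp only [S, mem_setOf_eq]
      convert this using 2
      ring)
    simp only [add_apply]; linarith
  have hB1 : ∀ y ys, (y, ys) ∈ B → - u y - α ≤ ys (y - z) :=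
    fun y ys hy => hu2 _ _ (epiT_of_mem h.1 z hy)
  have gA : (u + zs) z ≤ - α + zs z := fz_ge hAm fun y ys hy => by
    have := hA1 y ys hy
    simp only [map_sub] at this; linarith
  have gB : (-u) z ≤ α := fz_ge h fun y ys hy => by
    have := hB1 y ys hy
    simp only [map_sub, neg_apply] at this ⊢; linarith
  simp only [add_apply, neg_apply] at gA gB
  refine ⟨u + zs, -u, mem_of_related hAm fun y ys hy => ?_, mem_of_related h fun y ys hy => ?_,
    by abel⟩
  · have := hA1 y ys hy
    simp only [map_sub, add_apply, sub_apply] at this ⊢; linarith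
  · have := hB1 y ys hy
    simp only [map_sub, neg_apply, sub_apply] at this ⊢; linarith

end helpers

/-- (FPV) Sum Theorem. -/
theorem fpv_sum_theorem {X : Type*} [NormedAddCommGroup X] [NormedSpace ℝ X] [CompleteSpace X]
    (A B : Set (X × (X →L[ℝ] ℝ)))
    (hA : IsMaxMonotoneOp A) (hB : IsMaxMonotoneOp B)
    (hFPV : IsFPV A)
    (hstar : (starSet (opDom A) ∩ interior (opDom B)).Nonempty) :
    IsMaxMonotoneOp (opSum A B) := by
  obtain ⟨x0, hx0, hx0'⟩ := hstar
  refine max_of_related ?_ fun z zs hr => ?_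
  · rintro ⟨x, xs⟩ ⟨a, b, ha, hb, rfl⟩ ⟨y, ys⟩ ⟨c, d, hc, hd, rfl⟩
    have h1 := mono4 hA.1 ha hc
    have h2 := mono4 hB.1 hb hd
    simp only [sub_apply, add_apply, map_sub] at *
    linarith
  · obtain ⟨a, b, ha, hb, e⟩ := partII hFPV hB hx0 hx0' z zs fun x a b ha hb =>
      hr x (a + b) ⟨a, b, ha, hb, rfl⟩
    exact ⟨a, b, ha, hb, e⟩
end
end

section
/- Let X be a real Banach space and let A, B : X ⇉ X* be maximally monotone operators such that star(dom A) ∩ int(dom B) ≠ ∅ and A is of type (FPV). Then the Fitzpatrick function of the sum dominates the duality pairing: F_{A+B}(z, z*) ≥ ⟨z, z*⟩ for every (z, z*) ∈ X × X*. -/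
open Set Filter Topology

noncomputable section

variable {X : Type*} [NormedAddCommGroup X] [NormedSpace ℝ X]

lemma aux_mem_of_related {B : Set (X × (X →L[ℝ] ℝ))} (hB : IsMaxMonotoneOp B)
    {x : X} {xs : X →L[ℝ] ℝ} (h : ∀ y ys, (y, ys) ∈ B → 0 ≤ (xs - ys) (x - y)) :
    (x, xs) ∈ B := by
  have hm : IsMonotoneOp (insert (x, xs) B) := by
    rintro p (rfl | hp) q (rfl | hq)
    · simp
    · exact h q.1 q.2 hq
    · have := h p.1 p.2 hp
      simp only [sub_apply, map_sub] at this ⊢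
      linarith
    · exact hB.1 p hp q hq
  have := hB.2 _ hm (subset_insert _ _)
  rw [← this]
  exact mem_insert _ _

lemma aux_mono {B : Set (X × (X →L[ℝ] ℝ))} (hB : IsMonotoneOp B)
    {x y : X} {xs ys : X →L[ℝ] ℝ} (h : (x, xs) ∈ B) (h' : (y, ys) ∈ B) :
    ys (x - y) ≤ xs (x - y) := by
  have := hB _ h _ h'
  simp only [sub_apply] at this
  linarith

/-- bound on the norm from a one-sided bound on a ball -/
lemma aux_norm_le {f : X →L[ℝ] ℝ} {r c : ℝ} (hr : 0 < r)
    (h : ∀ v : X, ‖v‖ ≤ r → f v ≤ c) : r * ‖f‖ ≤ c := by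
  have hc : 0 ≤ c := by simpa using h 0 (by simpa using hr.le)
  have : ‖f‖ ≤ c / r := by
    refine f.opNorm_le_of_ball hr (by positivity) fun z _ => ?_
    have hb : ∀ v ∈ Metric.closedBall (0 : X) r, ‖f.toLinearMap v‖ ≤ c := by
      intro v hv
      have hv : ‖v‖ ≤ r := by simpa using hv
      refine abs_le.2 ⟨?_, h v hv⟩
      have := h (-v) (by simpa using hv)
      simp only [map_neg] at this
      simp only [ContinuousLinearMap.coe_coe]
      linarith
    exact LinearMap.bound_of_ball_bound' hr c f.toLinearMap hb z
  rw [le_div_iff₀ hr] at this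
  linarith

lemma aux_locbdd [CompleteSpace X] {B : Set (X × (X →L[ℝ] ℝ))} (hB : IsMonotoneOp B)
    {c : X} (hc : c ∈ interior (opDom B)) :
    ∃ δ > 0, ∃ M > 0, Metric.ball c δ ⊆ opDom B ∧
      ∀ y ys, (y, ys) ∈ B → y ∈ Metric.ball c δ → ‖ys‖ ≤ M := by
  set E : ℕ → Set X := fun n => {x | ∀ y ys, (y, ys) ∈ B → ‖y - c‖ ≤ 1 → ys (x - y) ≤ n} with hE
  have hEcl : ∀ n, IsClosed (E n) := by
    intro n
    simp only [hE, ofPred_forall]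
    refine isClosed_iInter fun y => isClosed_iInter fun ys => isClosed_iInter fun _ =>
      isClosed_iInter fun _ => ?_
    exact isClosed_le (by fun_prop) continuous_const
  have hEcv : ∀ n, Convex ℝ (E n) := by
    intro n x hx x' hx' a b ha hb hab y ys hy hyc
    have h1 := hx y ys hy hyc
    have h2 := hx' y ys hy hyc
    have : a • x + b • x' - y = a • (x - y) + b • (x' - y) := by
      have : y = (a + b) • y := by rw [hab, one_smul]
      nth_rewrite 1 [this]
      module
    rw [this, map_add, map_smul, map_smul, smul_eq_mul, smul_eq_mul]
    calc _ ≤ a * n + b * n := by gcongr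
      _ = n := by rw [← add_mul, hab, one_mul]
  have hEmono : ∀ n m, n ≤ m → E n ⊆ E m := by
    intro n m hnm x hx y ys hy hyc
    exact (hx y ys hy hyc).trans (by exact_mod_cast hnm)
  have hED : ∀ x ∈ opDom B, ∃ n, x ∈ E n := by
    rintro x ⟨xs, hx⟩
    obtain ⟨n, hn⟩ := exists_nat_ge (‖xs‖ * (‖x - c‖ + 1))
    refine ⟨n, fun y ys hy hyc => ?_⟩
    calc ys (x - y) ≤ xs (x - y) := aux_mono hB hx hy
      _ ≤ ‖xs (x - y)‖ := Real.le_norm_self _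
      _ ≤ ‖xs‖ * ‖x - y‖ := xs.le_opNorm _
      _ ≤ ‖xs‖ * (‖x - c‖ + 1) := by
        gcongr
        have : x - y = (x - c) - (y - c) := by abel
        rw [this]
        exact (norm_sub_le _ _).trans (by gcongr)
      _ ≤ n := hn
  let F : Option ℕ → Set X := fun o => o.elim (interior (opDom B))ᶜ E
  have hd : Dense (⋃ o, interior (F o)) := by
    apply dense_iUnion_interior_of_closed
    · rintro (_ | n)
      · exact isOpen_interior.isClosed_compl
      · exact hEcl n
    · rw [eq_univ_iff_forall]
      intro x
      by_cases hx : x ∈ interior (opDom B)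
      · obtain ⟨n, hn⟩ := hED x (interior_subset hx)
        exact mem_iUnion.2 ⟨some n, hn⟩
      · exact mem_iUnion.2 ⟨none, hx⟩
  obtain ⟨q, hq, hqU⟩ := hd.inter_open_nonempty _ isOpen_interior ⟨c, hc⟩
  obtain ⟨o, ho⟩ := mem_iUnion.1 hqU
  obtain ⟨n, hn⟩ : ∃ n, q ∈ interior (E n) := by
    cases o with
    | none => exact absurd hq (interior_subset ho)
    | some n => exact ⟨n, ho⟩
  -- reflected point
  have hcont : Tendsto (fun μ : ℝ => c + μ • (c - q)) (𝓝[>] 0) (𝓝 c) := by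
    have : Tendsto (fun μ : ℝ => c + μ • (c - q)) (𝓝 0) (𝓝 (c + (0:ℝ) • (c - q))) :=
      Continuous.tendsto (by fun_prop) 0
    simpa using this.mono_left nhdsWithin_le_nhds
  obtain ⟨μ, hμD, hμ⟩ := ((hcont.eventually (isOpen_interior.mem_nhds hc)).and
    self_mem_nhdsWithin).exists
  have hμ : 0 < μ := hμ
  obtain ⟨m, hm⟩ := hED _ (interior_subset hμD)
  set N := max n m
  have hcE : c ∈ interior (E N) := by
    apply (hEcv N).openSegment_interior_self_subset_interior
      (interior_mono (hEmono _ _ (le_max_left _ _)) hn) (hEmono _ _ (le_max_right n m) hm)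
    refine ⟨μ / (1 + μ), 1 / (1 + μ), by positivity, by positivity, by field_simp; ring, ?_⟩
    match_scalars <;> field_simp <;> ring
  obtain ⟨r, hr, hrE⟩ := Metric.isOpen_iff.1 isOpen_interior c hcE
  obtain ⟨r', hr', hrD⟩ := Metric.isOpen_iff.1 isOpen_interior c hc
  set δ := min (min (r / 2) r') 1
  have hδ : 0 < δ := by positivity
  have hδ1 : δ ≤ r / 2 := (min_le_left _ _).trans (min_le_left _ _)
  have hδ2 : δ ≤ r' := (min_le_left _ _).trans (min_le_right _ _)
  have hδ3 : δ ≤ 1 := min_le_right _ _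
  refine ⟨δ, hδ, N / δ + 1, by positivity,
    ((Metric.ball_subset_ball hδ2).trans hrD).trans interior_subset, ?_⟩
  intro y ys hy hyc
  rw [mem_ball_iff_norm] at hyc
  have : δ * ‖ys‖ ≤ N := by
    refine aux_norm_le hδ fun v hv => ?_
    have : y + v ∈ E N := by
      refine interior_subset (hrE ?_)
      rw [mem_ball_iff_norm]
      have : y + v - c = (y - c) + v := by abel
      rw [this]
      exact (norm_add_le _ _).trans_lt (by linarith)
    simpa using this y ys hy (hyc.le.trans hδ3)
  have : ‖ys‖ ≤ N / δ := by rw [le_div_iff₀ hδ]; linarith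
  linarith

/-- `Σ λᵢ ⟨yᵢ, yᵢ*⟩ ≥ ⟨Σ λᵢ yᵢ, Σ λᵢ yᵢ*⟩` for monotone families -/
lemma aux_hull {T : Set (X × (X →L[ℝ] ℝ) × ℝ)}
    (hT : ∀ p ∈ T, ∀ q ∈ T, 0 ≤ p.2.2 + q.2.2 - q.2.1 p.1 - p.2.1 q.1)
    {p : X × (X →L[ℝ] ℝ) × ℝ} (hp : p ∈ convexHull ℝ T) : p.2.1 p.1 ≤ p.2.2 := by
  have hcv : ∀ q : X × (X →L[ℝ] ℝ) × ℝ,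
      Convex ℝ {p : X × (X →L[ℝ] ℝ) × ℝ | 0 ≤ p.2.2 + q.2.2 - q.2.1 p.1 - p.2.1 q.1} := by
    intro q x hx y hy a b ha hb hab
    simp only [mem_ofPred_eq, Prod.fst_add, Prod.snd_add, Prod.smul_fst, Prod.smul_snd, map_add,
      map_smul, smul_eq_mul, add_apply, smul_apply] at *
    have e : q.2.2 = (a + b) * q.2.2 := by rw [hab, one_mul]
    have := add_nonneg (mul_nonneg ha hx) (mul_nonneg hb hy)
    rw [e]
    linarith
  have h1 : ∀ q ∈ T, ∀ p ∈ convexHull ℝ T, 0 ≤ p.2.2 + q.2.2 - q.2.1 p.1 - p.2.1 q.1 :=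
    fun q hq p hp => convexHull_min (fun p hp => hT p hp q hq) (hcv q) hp
  have h2 : 0 ≤ p.2.2 + p.2.2 - p.2.1 p.1 - p.2.1 p.1 := by
    refine convexHull_min (s := T) (fun q hq => ?_) (hcv p) hp
    have := h1 q hq p hp
    simp only [mem_ofPred_eq]
    linarith
  linarith

lemma aux_seg [CompleteSpace X] {B : Set (X × (X →L[ℝ] ℝ))} (hB : IsMaxMonotoneOp B)
    {c d : X} (hc : c ∈ interior (opDom B)) (hd : d ∈ opDom B) {s : ℝ} (hs0 : 0 ≤ s)
    (hs1 : s < 1) : s • d + (1 - s) • c ∈ opDom B := by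
  rcases hs0.eq_or_lt with rfl | hs0
  · simpa using interior_subset hc
  obtain ⟨δ, hδ, M, hM, hbD, hbM⟩ := aux_locbdd hB.1 hc
  set x := s • d + (1 - s) • c with hx
  set T : Set (X × (X →L[ℝ] ℝ) × ℝ) :=
    {p | (p.1 + x, p.2.1) ∈ B ∧ p.2.2 = p.2.1 p.1} with hT
  have hTm : ∀ p ∈ T, ∀ q ∈ T, 0 ≤ p.2.2 + q.2.2 - q.2.1 p.1 - p.2.1 q.1 := by
    intro p hp q hq
    have := aux_mono hB.1 hp.1 hq.1
    rw [hp.2, hq.2]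
    simp only [add_sub_add_right_eq_sub, map_sub] at this
    linarith
  set G : Set (X × ℝ) := {g | ∃ w r, (g.1, w, r) ∈ convexHull ℝ T ∧ r < g.2} with hG
  have hGcv : Convex ℝ G := by
    rintro g ⟨w, r, h, hr⟩ g' ⟨w', r', h', hr'⟩ a b ha hb hab
    refine ⟨a • w + b • w', a * r + b * r', ?_, ?_⟩
    · exact convex_convexHull ℝ T h h' ha hb hab
    · simp only [Prod.snd_add, Prod.smul_snd, smul_eq_mul]
      rcases ha.eq_or_lt with rfl | ha
      · have : b = 1 := by linarith
        subst this; linarith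
      · have := mul_lt_mul_of_pos_left hr ha
        have := mul_le_mul_of_nonneg_left hr'.le hb
        linarith
  have hmem : ∀ y ys, (y, ys) ∈ B → ∀ r, ys (y - x) < r → (y - x, r) ∈ G := by
    intro y ys hy r hr
    refine ⟨ys, ys (y - x), subset_convexHull ℝ T ⟨by simpa using hy, rfl⟩, hr⟩
  have h0 : (0 : X × ℝ) ∉ G := by
    rintro ⟨w, r, h, hr⟩
    have := aux_hull hTm h
    simp at this hr
    linarith
  set K := M * (‖c - x‖ + δ) with hK
  have hsub : Metric.ball (c - x) δ ×ˢ Ioi K ⊆ G := by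
    rintro ⟨v, r⟩ ⟨hv, hr⟩
    simp only [mem_ball_iff_norm, mem_Ioi] at hv hr
    have hvb : v + x ∈ Metric.ball c δ := by
      rw [mem_ball_iff_norm]
      convert hv using 2; abel
    obtain ⟨ys, hys⟩ := hbD hvb
    have hn := hbM _ _ hys hvb
    have := hmem _ _ hys r ?_
    · simpa using this
    · refine lt_of_le_of_lt ?_ hr
      calc ys (v + x - x) ≤ ‖ys (v + x - x)‖ := Real.le_norm_self _
        _ ≤ ‖ys‖ * ‖v + x - x‖ := ys.le_opNorm _
        _ ≤ M * (‖c - x‖ + δ) := by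
          gcongr
          have : v + x - x = (c - x) + (v - (c - x)) := by abel
          rw [this]
          exact (norm_add_le _ _).trans (by gcongr)
  have hopen : IsOpen (Metric.ball (c - x) δ ×ˢ Ioi K) := Metric.isOpen_ball.prod isOpen_Ioi
  have hcint : (c - x, K + 1) ∈ interior G :=
    interior_maximal hsub hopen ⟨Metric.mem_ball_self hδ, by simp⟩
  obtain ⟨f, hf⟩ := geometric_hahn_banach_open_point hGcv.interior isOpen_interior
    (fun h => h0 (interior_subset h))
  rw [map_zero] at hf
  have hfG : ∀ g ∈ G, f g ≤ 0 := by
    intro g hg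
    have hcl : g ∈ closure (interior G) := by
      rw [hGcv.closure_interior_eq_closure_of_nonempty_interior ⟨_, hcint⟩]
      exact subset_closure hg
    exact closure_minimal (s := interior G) (t := {g | f g ≤ 0}) (fun a ha => (hf a ha).le)
      (isClosed_le f.continuous continuous_const) hcl
  set ℓ : X →L[ℝ] ℝ := f.comp (ContinuousLinearMap.inl ℝ X ℝ) with hℓ
  set β : ℝ := f (0, 1) with hβ
  have hfe : ∀ v r, f (v, r) = ℓ v + r * β := by
    intro v r
    have : ((v, r) : X × ℝ) = (v, 0) + r • (0, 1) := by simp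
    rw [this, map_add, map_smul]
    simp [hℓ, hβ]
  have hβ0 : β ≤ 0 := by
    by_contra! hpos
    set r := max (K + 1) ((-ℓ (c - x)) / β + 1)
    have h1 := hfG (c - x, r) (hsub ⟨Metric.mem_ball_self hδ,
      lt_of_lt_of_le (lt_add_one K) (le_max_left _ _)⟩)
    rw [hfe] at h1
    have : (-ℓ (c - x)) / β < r := lt_of_lt_of_le (lt_add_one _) (le_max_right _ _)
    rw [div_lt_iff₀ hpos] at this
    linarith
  have hβ1 : β ≠ 0 := by
    intro hz
    have hdom : ∀ y ∈ opDom B, ℓ (y - x) ≤ 0 := by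
      rintro y ⟨ys, hy⟩
      have := hfG _ (hmem y ys hy (ys (y - x) + 1) (by linarith))
      rw [hfe, hz] at this
      linarith
    have h1 := hdom d hd
    have e : s • (d - x) = -((1 - s) • (c - x)) := by
      rw [hx]; module
    have h2 : s * ℓ (d - x) = -((1 - s) * ℓ (c - x)) := by
      have := congrArg ℓ e
      simpa only [map_smul, map_neg, smul_eq_mul] using this
    have h3 : ℓ (c - x) < 0 := by
      have := hf _ hcint
      rw [hfe, hz] at this
      linarith
    nlinarith
  have hβ2 : 0 < -β := by
    rcases hβ0.lt_or_eq with h | h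
    · linarith
    · exact absurd h hβ1
  refine ⟨(-β)⁻¹ • ℓ, aux_mem_of_related hB fun y ys hy => ?_⟩
  have key : ℓ (y - x) ≤ (-β) * ys (y - x) := by
    refine le_of_forall_pos_le_add fun e he => ?_
    have := hfG _ (hmem y ys hy (ys (y - x) + e / (-β)) (by
      have : 0 < e / (-β) := by positivity
      linarith))
    rw [hfe] at this
    have e2 : e / (-β) * β = -e := by field_simp
    linarith
  have : (-β)⁻¹ * ℓ (y - x) ≤ ys (y - x) := by
    rw [inv_mul_le_iff₀ hβ2]; exact key
  have e3 : x - y = -(y - x) := by abel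
  simp only [e3, map_neg, sub_apply, smul_apply, smul_eq_mul]
  linarith

/-- weak* closedness -/
lemma aux_blowup {B : Set (X × (X →L[ℝ] ℝ))} (hB : IsMaxMonotoneOp B)
    {b : X} (hb : b ∉ opDom B) (L : ℝ) :
    ∃ r > 0, ∀ y ys, (y, ys) ∈ B → ‖y - b‖ < r → L < ‖ys‖ := by
  by_contra! hcon
  have hpos : ∀ n : ℕ, (0 : ℝ) < 1 / ((n : ℝ) + 1) := fun n => by positivity
  choose y ys hy hyb hL using fun n : ℕ => hcon (1 / ((n : ℝ) + 1)) (hpos n)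
  have hylim : Tendsto y atTop (𝓝 b) := by
    rw [tendsto_iff_norm_sub_tendsto_zero]
    exact squeeze_zero (fun _ => norm_nonneg _) (fun n => (hyb n).le)
      tendsto_one_div_add_atTop_nhds_zero_nat
  have hcomp := WeakDual.isCompact_closedBall (𝕜 := ℝ) (E := X) 0 L
  let u : Ultrafilter ℕ := hyperfilter ℕ
  have hu : (u : Filter ℕ) ≤ atTop := Nat.hyperfilter_le_atTop
  obtain ⟨w, hw, hwl⟩ := hcomp.ultrafilter_le_nhds
    (u.map fun n => StrongDual.toWeakDual (ys n)) (by
      rw [le_principal_iff]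
      refine Filter.mem_map.2 (Filter.univ_mem' fun n => ?_)
      simpa using hL n)
  have hwl : Tendsto (fun n => StrongDual.toWeakDual (ys n)) u (𝓝 w) := hwl
  have hev : ∀ x : X, Tendsto (fun n => ys n x) u (𝓝 (w x)) := fun x =>
    ((WeakDual.eval_continuous x).tendsto w).comp hwl
  refine hb ⟨WeakDual.toStrongDual w, aux_mem_of_related hB fun x xs hx => ?_⟩
  have h1 : Tendsto (fun n => (ys n - xs) (y n - x)) u
      (𝓝 ((WeakDual.toStrongDual w - xs) (b - x))) := by
    have a1 : Tendsto (fun n => ys n (y n - b)) u (𝓝 0) := by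
      have h0 : Tendsto (fun n => L * ‖y n - b‖) u (𝓝 0) := by
        have := (tendsto_iff_norm_sub_tendsto_zero.1 hylim).const_mul L
        simpa using this.mono_left hu
      refine squeeze_zero_norm (fun n => ?_) h0
      exact ((ys n).le_opNorm _).trans (by gcongr; exact hL n)
    have a2 : Tendsto (fun n => xs (y n - x)) u (𝓝 (xs (b - x))) := by
      have : Continuous fun v => xs (v - x) := by fun_prop
      exact (this.tendsto b).comp (hylim.mono_left hu)
    have a3 := (a1.add (hev (b - x))).sub a2
    refine (a3.congr fun n => ?_).trans_eq ?_
    · simp only [sub_apply, map_sub]; ring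
    · simp
  exact ge_of_tendsto' h1 fun n => hB.1 _ (hy n) _ hx

lemma aux_seg_int [CompleteSpace X] {B : Set (X × (X →L[ℝ] ℝ))} (hB : IsMaxMonotoneOp B)
    {c d : X} (hc : c ∈ interior (opDom B)) (hd : d ∈ opDom B) {s : ℝ} (hs0 : 0 ≤ s)
    (hs1 : s < 1) : s • d + (1 - s) • c ∈ interior (opDom B) := by
  have hs : 0 < 1 - s := by linarith
  rw [mem_interior_iff_mem_nhds]
  set g : X → X := fun p => (1 - s)⁻¹ • (p - s • d) with hg
  have hgc : Continuous g := by fun_prop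
  have hgp : g (s • d + (1 - s) • c) = c := by
    simp only [hg, add_sub_cancel_left, smul_smul, inv_mul_cancel₀ hs.ne', one_smul]
  have h1 : ∀ᶠ p in 𝓝 (s • d + (1 - s) • c), g p ∈ interior (opDom B) :=
    hgc.continuousAt.eventually (by rw [hgp]; exact isOpen_interior.mem_nhds hc)
  filter_upwards [h1] with p hp
  have := aux_seg hB hp hd hs0 hs1
  simp only [hg, smul_smul, mul_inv_cancel₀ hs.ne', one_smul, add_sub_cancel] at this
  exact this

lemma aux_int_convex [CompleteSpace X] {B : Set (X × (X →L[ℝ] ℝ))} (hB : IsMaxMonotoneOp B) :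
    Convex ℝ (interior (opDom B)) := by
  intro x hx y hy a b ha hb hab
  rcases hb.eq_or_lt with rfl | hb
  · have : a = 1 := by linarith
    subst this; simpa using hx
  · have e : b = 1 - a := by linarith
    rw [e]
    exact aux_seg_int hB hy (interior_subset hx) ha (by linarith)

lemma aux_normal [CompleteSpace X] {B : Set (X × (X →L[ℝ] ℝ))} (hB : IsMaxMonotoneOp B)
    {b c : X} (hc : c ∈ interior (opDom B)) (hb : b ∉ interior (opDom B)) :
    ∃ n : X →L[ℝ] ℝ, (∀ y ∈ interior (opDom B), n y < n b) ∧ ∀ y ∈ opDom B, n y ≤ n b := by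
  obtain ⟨n, hn⟩ := geometric_hahn_banach_open_point (aux_int_convex hB) isOpen_interior hb
  refine ⟨n, hn, fun y hy => ?_⟩
  have h1 : Tendsto (fun s : ℝ => n (s • y + (1 - s) • c)) (𝓝[<] 1) (𝓝 (n y)) := by
    have : Continuous fun s : ℝ => n (s • y + (1 - s) • c) := by fun_prop
    have := this.tendsto 1
    simp only [sub_self, zero_smul, add_zero, one_smul] at this
    exact this.mono_left nhdsWithin_le_nhds
  refine le_of_tendsto h1 ?_
  have h2 : ∀ᶠ s : ℝ in 𝓝[<] 1, 0 < s :=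
    nhdsWithin_le_nhds (lt_mem_nhds (by norm_num))
  filter_upwards [h2, self_mem_nhdsWithin] with s hs hs1
  exact (hn _ (aux_seg_int hB hc hy hs.le hs1)).le

lemma aux_growth {B : Set (X × (X →L[ℝ] ℝ))} (hB : IsMonotoneOp B) {δ M : ℝ} (hδ : 0 < δ)
    (hbD : Metric.ball 0 δ ⊆ opDom B)
    (hbM : ∀ y ys, (y, ys) ∈ B → y ∈ Metric.ball 0 δ → ‖ys‖ ≤ M)
    {a u : X} {as : X →L[ℝ] ℝ} (ha : (a, as) ∈ B) (hu : ‖u‖ < δ / 2) :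
    δ / 2 * ‖as‖ - M * (‖a‖ + δ) ≤ as (a - u) := by
  have : δ / 2 * ‖as‖ ≤ as (a - u) + M * (‖a‖ + δ) := by
    refine aux_norm_le (half_pos hδ) fun v hv => ?_
    have hn : ‖u + v‖ < δ := (norm_add_le _ _).trans_lt (by linarith)
    have hb : u + v ∈ Metric.ball 0 δ := by simpa using hn
    obtain ⟨ys, hys⟩ := hbD hb
    have hM := hbM _ _ hys hb
    have h1 := aux_mono hB ha hys
    have h2 : -(M * (‖a‖ + δ)) ≤ ys (a - (u + v)) := by
      have : ‖ys (a - (u + v))‖ ≤ M * (‖a‖ + δ) := by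
        refine (ys.le_opNorm _).trans ?_
        have h3 : ‖a - (u + v)‖ ≤ ‖a‖ + δ := (norm_sub_le _ _).trans (by linarith)
        have h4 : 0 ≤ M := (norm_nonneg _).trans hM
        gcongr
      exact (abs_le.1 this).1
    have e : a - (u + v) = (a - u) - v := by abel
    rw [e] at h1 h2
    rw [map_sub as] at h1
    linarith
  linarith

lemma aux_growth' {B : Set (X × (X →L[ℝ] ℝ))} (hB : IsMonotoneOp B) {δ M : ℝ} (hδ : 0 < δ)
    (hbD : Metric.ball 0 δ ⊆ opDom B)
    (hbM : ∀ y ys, (y, ys) ∈ B → y ∈ Metric.ball 0 δ → ‖ys‖ ≤ M)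
    {a u z : X} {as : X →L[ℝ] ℝ} (ha : (a, as) ∈ B) (hu : ‖u‖ < δ / 2) {s : ℝ}
    (hs0 : 0 < s) (hs1 : s < 1) (hau : a = s • z + (1 - s) • u) :
    (1 - s) / s * (δ / 2 * ‖as‖ - M * (‖a‖ + δ)) ≤ as (z - a) := by
  have h := aux_growth hB hδ hbD hbM ha hu
  have e : z - a = ((1 - s) / s) • (a - u) := by
    rw [hau]
    match_scalars <;> field_simp <;> ring
  rw [e, map_smul, smul_eq_mul]
  have : 0 < (1 - s) / s := div_pos (by linarith) hs0
  gcongr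

lemma aux_fpv {A : Set (X × (X →L[ℝ] ℝ))} (hA : IsFPV A) {U : Set X} (hU : IsOpen U)
    (hUc : Convex ℝ U) (hne : (U ∩ opDom A).Nonempty) {x : X} (hx : x ∈ U) (w : X →L[ℝ] ℝ) :
    ∃ a as, (a, as) ∈ A ∧ a ∈ U ∧ w (x - a) ≤ as (x - a) := by
  by_contra! hcon
  have hmem : (x, w) ∈ A := by
    refine hA.2 U hU hUc hne x w hx ?_
    rintro ⟨a, as⟩ ⟨ha, haU, -⟩
    have := hcon a as ha haU
    simp only [sub_apply]
    linarith
  have := hcon x w hmem hx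
  simp at this

lemma aux_abs_le (f : X →L[ℝ] ℝ) {v : X} {C Q : ℝ} (hf : ‖f‖ ≤ C) (hv : ‖v‖ ≤ Q) :
    f v ≤ C * Q ∧ -(C * Q) ≤ f v := by
  have : ‖f v‖ ≤ C * Q := by
    have h0 : 0 ≤ C := (norm_nonneg _).trans hf
    exact (f.le_opNorm v).trans (by gcongr)
  exact ⟨(abs_le.1 this).2, (abs_le.1 this).1⟩

/-- No boundary point of `dom B` in `dom A` near the segment. -/
lemma aux_boundary [CompleteSpace X] {A B : Set (X × (X →L[ℝ] ℝ))} (hA : IsFPV A)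
    (hB : IsMaxMonotoneOp B) (hA0 : ((0 : X), (0 : X →L[ℝ] ℝ)) ∈ A)
    (hst : ∀ a ∈ opDom A, ∀ t : ℝ, 0 ≤ t → t ≤ 1 → t • a ∈ opDom A)
    {δ M : ℝ} (hδ : 0 < δ) (hM : 0 < M)
    (hbD : Metric.ball 0 δ ⊆ opDom B)
    (hbM : ∀ y ys, (y, ys) ∈ B → y ∈ Metric.ball 0 δ → ‖ys‖ ≤ M)
    {z : X} {zs : X →L[ℝ] ℝ} {ε : ℝ} (hε : 0 < ε)
    (H : ∀ a as bs, (a, as) ∈ A → (a, bs) ∈ B → ε ≤ (zs - as - bs) (z - a))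
    {b u₀ : X} {s₀ : ℝ} (hbA : b ∈ opDom A) (hs0 : 0 ≤ s₀) (hs1 : s₀ < 1) (hu : ‖u₀‖ < δ / 2)
    (hbe : b = s₀ • z + (1 - s₀) • u₀) (hbc : b ∈ closure (interior (opDom B)))
    (hbi : b ∉ interior (opDom B)) : False := by
  have hball : Metric.ball 0 δ ⊆ interior (opDom B) := interior_maximal hbD Metric.isOpen_ball
  have hs0 : 0 < s₀ := by
    rcases hs0.eq_or_lt with rfl | h
    · exfalso
      apply hbi
      apply hball
      rw [hbe]
      simp
      linarith
    · exact h
  set k := (1 - s₀) / s₀ with hk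
  have hkpos : 0 < k := div_pos (by linarith) hs0
  obtain ⟨bA, hbA'⟩ := hbA
  by_cases hbD' : b ∈ opDom B
  · obtain ⟨b1, hb1⟩ := hbD'
    have h0i : (0 : X) ∈ interior (opDom B) := hball (Metric.mem_ball_self hδ)
    obtain ⟨n, hn1, hn2⟩ := aux_normal hB h0i hbi
    have hlam : ∀ l : ℝ, 0 ≤ l → (b, b1 + l • n) ∈ B := by
      intro l hl
      refine aux_mem_of_related hB fun y ys hy => ?_
      have h1 := aux_mono hB.1 hb1 hy
      have h2 := mul_nonneg hl (sub_nonneg.2 (hn2 y ⟨ys, hy⟩))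
      simp only [sub_apply, add_apply, smul_apply, smul_eq_mul]
      rw [map_sub n]
      linarith
    have hpos : 0 < n (z - b) := by
      have e : z - b = k • (b - u₀) := by
        rw [hk, hbe]
        match_scalars <;> field_simp <;> ring
      rw [e, map_smul, map_sub, smul_eq_mul]
      have := hn1 u₀ (hball (by simp; linarith))
      exact mul_pos hkpos (by linarith)
    set q := (zs - bA - b1) (z - b) with hq
    have := H b bA _ hbA' (hlam (|q| / n (z - b)) (by positivity))
    have e : (zs - bA - (b1 + (|q| / n (z - b)) • n)) (z - b) = q - |q| := by
      rw [hq]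
      simp only [sub_apply, add_apply, smul_apply, smul_eq_mul]
      field_simp
      ring
    rw [e] at this
    have := le_abs_self q
    linarith
  · set κ := δ / (‖z‖ + δ) with hκ
    have hκ0 : 0 < κ := by positivity
    have hκ1 : κ ≤ 1 := by
      rw [hκ, div_le_one (by positivity)]
      linarith [norm_nonneg z]
    have hκz : κ • z ∈ Metric.ball (0 : X) δ := by
      rw [mem_ball_zero_iff, norm_smul, Real.norm_of_nonneg hκ0.le, hκ, div_mul_eq_mul_div,
        div_lt_iff₀ (by positivity)]
      nlinarith
    set R := ‖κ • z - b‖ + ‖b‖ + 1 with hR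
    have hR0 : 0 < R := by positivity
    set Q := ‖b‖ + R with hQ
    set L := (2 / (δ * k)) * (‖zs‖ * (‖z‖ + Q) + R * ‖bA‖ / κ + k * (M * (Q + δ))) with hL
    obtain ⟨r, hr, hrL⟩ := aux_blowup hB hbD' L
    set r2 := (1 - s₀) * (δ / 2 - ‖u₀‖) with hr2
    have hr2pos : 0 < r2 := mul_pos (by linarith) (by linarith)
    set τ := min (1 / 2) (min (r / R) (r2 / R)) with hτ
    have hτ0 : 0 < τ := by positivity
    have hτ1 : τ ≤ 1 / 2 := min_le_left _ _
    have hτr : τ * R ≤ r := by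
      rw [← le_div_iff₀ hR0]
      exact (min_le_right _ _).trans (min_le_left _ _)
    have hτr2 : τ * R ≤ r2 := by
      rw [← le_div_iff₀ hR0]
      exact (min_le_right _ _).trans (min_le_right _ _)
    have hcv := aux_int_convex hB
    have hcombo : ∀ y ∈ Metric.ball (0 : X) δ, (1 - τ) • b + τ • y ∈ interior (opDom B) := by
      intro y hy
      have := hcv.combo_closure_interior_mem_interior hbc
        (by rw [interior_interior]; exact hball hy) (a := 1 - τ) (b := τ) (by linarith) hτ0 (by ring)
      rwa [interior_interior] at this
    set x := (1 - τ) • b + τ • (κ • z) with hx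
    have hxU : x ∈ Metric.ball b (τ * R) ∩ interior (opDom B) := by
      refine ⟨?_, hcombo _ hκz⟩
      have e : x - b = τ • (κ • z - b) := by rw [hx]; module
      rw [mem_ball_iff_norm, e, norm_smul, Real.norm_of_nonneg hτ0.le]
      have : ‖κ • z - b‖ < R := by rw [hR]; linarith [norm_nonneg b]
      gcongr
    have hne : ((Metric.ball b (τ * R) ∩ interior (opDom B)) ∩ opDom A).Nonempty := by
      refine ⟨(1 - τ) • b, ⟨?_, ?_⟩, hst b ⟨bA, hbA'⟩ _ (by linarith) (by linarith)⟩
      · have e : (1 - τ) • b - b = -(τ • b) := by module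
        rw [mem_ball_iff_norm, e, norm_neg, norm_smul, Real.norm_of_nonneg hτ0.le]
        have : ‖b‖ < R := by rw [hR]; linarith [norm_nonneg (κ • z - b)]
        gcongr
      · simpa using hcombo 0 (Metric.mem_ball_self hδ)
    obtain ⟨a, as, haA, ⟨haU, haD⟩, hax⟩ := aux_fpv hA (Metric.isOpen_ball.inter isOpen_interior)
      ((convex_ball b (τ * R)).inter hcv) hne hxU 0
    rw [mem_ball_iff_norm] at haU
    rw [zero_apply] at hax
    obtain ⟨bs, hbs⟩ := interior_subset haD
    have hbig : L < ‖bs‖ := hrL a bs hbs (by linarith)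
    have haQ : ‖a‖ ≤ Q := by
      have e : a = b + (a - b) := by abel
      rw [e]
      refine (norm_add_le _ _).trans ?_
      have : τ * R ≤ R := by nlinarith
      rw [hQ]; linarith
    -- growth for B
    have hg : k * (δ / 2 * ‖bs‖ - M * (Q + δ)) ≤ bs (z - a) := by
      set u := u₀ + (1 - s₀)⁻¹ • (a - b) with hu'
      have hs1' : 0 < 1 - s₀ := by linarith
      have hun : ‖u‖ < δ / 2 := by
        refine (norm_add_le _ _).trans_lt ?_
        rw [norm_smul, Real.norm_of_nonneg (by positivity)]
        have : (1 - s₀)⁻¹ * ‖a - b‖ < δ / 2 - ‖u₀‖ := by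
          rw [inv_mul_lt_iff₀ hs1']
          linarith
        linarith
      have hae : a = s₀ • z + (1 - s₀) • u := by
        rw [hu', smul_add, smul_smul, mul_inv_cancel₀ hs1'.ne', one_smul, ← add_assoc, ← hbe]
        abel
      refine le_trans ?_ (aux_growth' hB.1 hδ hbD hbM hbs hun hs0 hs1 hae)
      rw [← hk]
      gcongr
    -- lower bound for A
    have hlow : -(R * ‖bA‖ / κ) ≤ as (z - a) := by
      have e : x - a = (1 - τ) • (b - a) + (τ * κ) • (z - a) - (τ * (1 - κ)) • (a - 0) := by
        rw [hx]; module
      rw [e, map_sub, map_add, map_smul, map_smul, map_smul] at hax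
      simp only [smul_eq_mul] at hax
      have h1 := aux_mono hA.1.1 haA hA0
      rw [zero_apply] at h1
      have h2 := aux_mono hA.1.1 hbA' haA
      have h3 := (aux_abs_le bA (v := b - a) (Q := τ * R) le_rfl (by rw [norm_sub_rev]; exact haU.le)).1
      have h4 : 0 ≤ τ * (1 - κ) * as (a - 0) := by
        have : 0 ≤ 1 - κ := by linarith
        positivity
      have h5 : (1 - τ) * as (b - a) ≤ ‖bA‖ * (τ * R) := by
        have h8 : 0 ≤ ‖bA‖ * (τ * R) := by positivity
        have h9 : (1 - τ) * as (b - a) ≤ (1 - τ) * (‖bA‖ * (τ * R)) :=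
          mul_le_mul_of_nonneg_left (h2.trans h3) (by linarith)
        have := mul_nonneg hτ0.le h8
        linarith
      have h6 : 0 ≤ τ * (‖bA‖ * R + κ * as (z - a)) := by linarith
      have h7 : 0 ≤ ‖bA‖ * R + κ * as (z - a) := nonneg_of_mul_nonneg_right h6 hτ0
      have : -(as (z - a)) ≤ R * ‖bA‖ / κ := by
        rw [le_div_iff₀ hκ0]; linarith
      linarith
    have hz := (aux_abs_le zs (v := z - a) (Q := ‖z‖ + Q) le_rfl
      ((norm_sub_le _ _).trans (by linarith))).1
    have hH := H a as bs haA hbs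
    simp only [sub_apply] at hH
    have hLe : k * (δ / 2 * L) =
        ‖zs‖ * (‖z‖ + Q) + R * ‖bA‖ / κ + k * (M * (Q + δ)) := by
      rw [hL]; field_simp
    have : k * (δ / 2 * L) < k * (δ / 2 * ‖bs‖) := by gcongr
    linarith

set_option maxHeartbeats 2000000 in
lemma aux_core [CompleteSpace X] {A B : Set (X × (X →L[ℝ] ℝ))} (hA : IsFPV A)
    (hB : IsMaxMonotoneOp B) (hA0 : ((0 : X), (0 : X →L[ℝ] ℝ)) ∈ A)
    (hst : ∀ a ∈ opDom A, ∀ t : ℝ, 0 ≤ t → t ≤ 1 → t • a ∈ opDom A)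
    (h0B : (0 : X) ∈ interior (opDom B))
    {z : X} {zs : X →L[ℝ] ℝ} {ε : ℝ} (hε : 0 < ε)
    (H : ∀ a as bs, (a, as) ∈ A → (a, bs) ∈ B → ε ≤ (zs - as - bs) (z - a)) : False := by
  obtain ⟨δ, hδ, M, hM, hbD, hbM⟩ := aux_locbdd hB.1 h0B
  -- points of `dom A` near the segment belong to `dom B`
  have hV : ∀ (a u : X) (s : ℝ), a ∈ opDom A → 0 ≤ s → s < 1 → ‖u‖ < δ / 2 →
      a = s • z + (1 - s) • u → a ∈ opDom B := by
    intro a u s ha hs0 hs1 hu hae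
    by_contra hcon
    have hpre : IsPreconnected (segment ℝ (0 : X) a) := (convex_segment 0 a).isPreconnected
    obtain ⟨b, hbs, hbf⟩ : ∃ b ∈ segment ℝ (0 : X) a,
        b ∈ closure (interior (opDom B)) \ interior (opDom B) := by
      by_contra hno
      push Not at hno
      obtain ⟨w, -, hw1, hw2⟩ := hpre (interior (opDom B)) (closure (interior (opDom B)))ᶜ
        isOpen_interior isClosed_closure.isOpen_compl
        (fun b hb => by
          by_cases hb1 : b ∈ interior (opDom B)
          · exact Or.inl hb1
          · exact Or.inr fun hb2 => hno b hb ⟨hb2, hb1⟩)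
        ⟨0, left_mem_segment ℝ 0 a, h0B⟩
        ⟨a, right_mem_segment ℝ 0 a, fun h => hno a (right_mem_segment ℝ 0 a)
          ⟨h, fun h' => hcon (interior_subset h')⟩⟩
      exact hw2 (subset_closure hw1)
    rw [segment_eq_image] at hbs
    obtain ⟨t, ⟨ht0, ht1⟩, hbt⟩ := hbs
    simp only [smul_zero, zero_add] at hbt
    have hts : t * s < 1 := by nlinarith
    have hpos : 0 < 1 - t * s := by linarith
    refine aux_boundary hA hB hA0 hst hδ hM hbD hbM hε H (b := b)
      (u₀ := (t * (1 - s) / (1 - t * s)) • u) (s₀ := t * s)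
      (hbt ▸ hst a ha t ht0 ht1) (mul_nonneg ht0 hs0) hts ?_ ?_ hbf.1 hbf.2
    · rw [norm_smul, Real.norm_of_nonneg (div_nonneg (mul_nonneg ht0 (by linarith)) hpos.le)]
      have : t * (1 - s) / (1 - t * s) ≤ 1 := by
        rw [div_le_one hpos]; nlinarith
      calc _ ≤ 1 * ‖u‖ := by gcongr
        _ < δ / 2 := by linarith
    · rw [← hbt, hae, smul_smul, mul_div_cancel₀ _ hpos.ne']
      module
  by_cases hzc : z ∈ closure (opDom A)
  · -- `z` in the closure of `dom A`
    set C := ‖zs‖ * (‖z‖ + δ) + 2 * (M * (‖z‖ + 2 * δ)) with hC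
    have hC0 : 0 < C := by positivity
    set e := min (1 / 2) (ε / (2 * C)) with he
    have he0 : 0 < e := by positivity
    have he1 : e ≤ 1 / 2 := min_le_left _ _
    have he2 : e * C < ε := by
      have : e ≤ ε / (2 * C) := min_le_right _ _
      rw [le_div_iff₀ (by positivity)] at this
      linarith
    set t := 1 - e with ht
    have ht0 : 0 < t := by linarith
    have ht1 : t < 1 := by linarith
    set θ := e * (δ / 2) with hθ
    have hθ0 : 0 < θ := by positivity
    have hne : (Metric.ball (t • z) θ ∩ opDom A).Nonempty := by
      obtain ⟨a, ha, hda⟩ := Metric.mem_closure_iff.1 hzc θ hθ0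
      refine ⟨t • a, ?_, hst a ha t ht0.le ht1.le⟩
      rw [mem_ball_iff_norm, ← smul_sub, norm_smul, Real.norm_of_nonneg ht0.le]
      rw [dist_comm, dist_eq_norm] at hda
      nlinarith [norm_nonneg (a - z)]
    obtain ⟨a, as, haA, haU, hax⟩ := aux_fpv hA Metric.isOpen_ball (convex_ball (t • z) θ) hne
      (Metric.mem_ball_self hθ0) 0
    rw [mem_ball_iff_norm] at haU
    rw [zero_apply] at hax
    set u := e⁻¹ • (a - t • z) with hu
    have hun : ‖u‖ < δ / 2 := by
      rw [hu, norm_smul, Real.norm_of_nonneg (by positivity), inv_mul_lt_iff₀ he0]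
      exact haU
    have hae : a = t • z + (1 - t) • u := by
      have : 1 - t = e := by rw [ht]; ring
      rw [this, hu, smul_smul, mul_inv_cancel₀ he0.ne', one_smul]
      abel
    obtain ⟨bs, hbs⟩ := hV a u t ⟨as, haA⟩ ht0.le ht1 hun hae
    have hg := aux_growth' hB.1 hδ hbD hbM hbs hun ht0 ht1 hae
    have hte : 1 - t = e := by rw [ht]; ring
    have hza : z - a = e • (z - u) := by
      rw [hae, ← hte]; module
    have haN : ‖a‖ ≤ ‖z‖ + δ := by
      rw [hae, hte]
      refine (norm_add_le _ _).trans ?_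
      rw [norm_smul, norm_smul, Real.norm_of_nonneg ht0.le, Real.norm_of_nonneg he0.le]
      nlinarith [norm_nonneg z, norm_nonneg u]
    have hg2 : -(e * (2 * (M * (‖z‖ + 2 * δ)))) ≤ bs (z - a) := by
      refine le_trans ?_ hg
      rw [hte]
      have h1 : 0 ≤ e / t := by positivity
      have h2 : e / t ≤ e * 2 := by
        rw [div_le_iff₀ ht0]; nlinarith
      have h3 : M * (‖a‖ + δ) ≤ M * (‖z‖ + 2 * δ) :=
          mul_le_mul_of_nonneg_left (by linarith) hM.le
      have h4 : 0 ≤ δ / 2 * ‖bs‖ := by positivity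
      have h5 : 0 ≤ M * (‖z‖ + 2 * δ) := by positivity
      calc -(e * (2 * (M * (‖z‖ + 2 * δ)))) = -((e * 2) * (M * (‖z‖ + 2 * δ))) := by ring
        _ ≤ -((e / t) * (M * (‖z‖ + 2 * δ))) := by gcongr
        _ = (e / t) * (-(M * (‖z‖ + 2 * δ))) := by ring
        _ ≤ _ := mul_le_mul_of_nonneg_left (by linarith) h1
    have hA' : 0 ≤ as (z - a) := by
      have e1 : t • (z - a) = (t • z - a) + (1 - t) • (a - 0) := by module
      have h1 := aux_mono hA.1.1 haA hA0
      rw [zero_apply] at h1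
      have h2 : t * as (z - a) = as (t • z - a) + (1 - t) * as (a - 0) := by
        rw [← smul_eq_mul, ← map_smul, e1, map_add, map_smul, smul_eq_mul]
      have h3 : 0 ≤ t * as (z - a) := by
        rw [h2]
        have := mul_nonneg (by linarith : (0:ℝ) ≤ 1 - t) h1
        linarith
      exact nonneg_of_mul_nonneg_right h3 ht0
    have hz : zs (z - a) ≤ e * (‖zs‖ * (‖z‖ + δ)) := by
      rw [hza, map_smul, smul_eq_mul]
      gcongr
      exact (aux_abs_le zs (v := z - u) (Q := ‖z‖ + δ) le_rfl
        ((norm_sub_le _ _).trans (by linarith))).1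
    have hH := H a as bs haA hbs
    simp only [sub_apply] at hH
    rw [hC, mul_add] at he2
    linarith
  · -- `z` outside the closure of `dom A`
    have hz0 : 0 < ‖z‖ := by
      rw [norm_pos_iff]
      rintro rfl
      exact hzc (subset_closure ⟨0, hA0⟩)
    obtain ⟨η, hη, hηd⟩ : ∃ η > 0, ∀ a ∈ opDom A, η ≤ ‖z - a‖ := by
      rw [Metric.mem_closure_iff] at hzc
      push Not at hzc
      obtain ⟨η, hη, h⟩ := hzc
      exact ⟨η, hη, fun a ha => by simpa [dist_eq_norm] using h a ha⟩
    obtain ⟨f, hf1, hfz⟩ := exists_dual_vector ℝ z hz0.ne'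
    have hfz : f z = ‖z‖ := by simpa using hfz
    set σ := η / (2 * ‖z‖) with hσ
    have hσ0 : 0 < σ := by positivity
    set θ := min (min (η / 4) (δ / 2)) (σ * (δ / 2)) with hθ
    have hθ0 : 0 < θ := by positivity
    have hθ1 : θ ≤ η / 4 := (min_le_left _ _).trans (min_le_left _ _)
    have hθ2 : θ ≤ δ / 2 := (min_le_left _ _).trans (min_le_right _ _)
    have hθ3 : θ ≤ σ * (δ / 2) := min_le_right _ _
    set K := M * (2 * ‖z‖ + δ) + 2 * ‖z‖ / δ * (M * (‖z‖ + 2 * δ)) with hK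
    have hK0 : 0 < K := by positivity
    set l := (2 / η) * (‖zs‖ * (2 * ‖z‖ + δ) + K) with hl
    have hl0 : 0 ≤ l := by positivity
    have hU : IsOpen (Metric.thickening θ (segment ℝ (0 : X) z)) := Metric.isOpen_thickening
    obtain ⟨a, as, haA, haU, hax⟩ := aux_fpv hA hU ((convex_segment 0 z).thickening θ)
      ⟨0, Metric.self_subset_thickening hθ0 _ (left_mem_segment ℝ 0 z), 0, hA0⟩
      (Metric.self_subset_thickening hθ0 _ (right_mem_segment ℝ 0 z)) (l • f)
    obtain ⟨p, hp, hpa⟩ := Metric.mem_thickening_iff.1 haU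
    rw [segment_eq_image] at hp
    obtain ⟨s, ⟨hs0, hs1⟩, hps⟩ := hp
    simp only [smul_zero, zero_add] at hps
    rw [← hps, dist_eq_norm] at hpa
    have hfar := hηd a ⟨as, haA⟩
    have hze : z - a = (1 - s) • z - (a - s • z) := by module
    have h1s : 0 ≤ 1 - s := by linarith
    have hs2 : η - θ ≤ (1 - s) * ‖z‖ := by
      rw [hze] at hfar
      have := norm_sub_le ((1 - s) • z) (a - s • z)
      rw [norm_smul, Real.norm_of_nonneg h1s] at this
      linarith
    have hsσ : σ ≤ 1 - s := by
      rw [hσ, div_le_iff₀ (by positivity)]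
      nlinarith
    have hs1' : 0 < 1 - s := by linarith
    set u := (1 - s)⁻¹ • (a - s • z) with hu
    have hun : ‖u‖ < δ / 2 := by
      rw [hu, norm_smul, Real.norm_of_nonneg (by positivity), inv_mul_lt_iff₀ hs1']
      have : σ * (δ / 2) ≤ (1 - s) * (δ / 2) := by gcongr
      linarith
    have hae : a = s • z + (1 - s) • u := by
      rw [hu, smul_smul, mul_inv_cancel₀ hs1'.ne', one_smul]
      abel
    obtain ⟨bs, hbs⟩ := hV a u s ⟨as, haA⟩ hs0 (by linarith) hun hae
    have haN : ‖a‖ ≤ s * ‖z‖ + θ := by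
      have e : a = s • z + (a - s • z) := by abel
      rw [e]
      refine (norm_add_le _ _).trans ?_
      rw [norm_smul, Real.norm_of_nonneg hs0]
      linarith
    have hsz : s * ‖z‖ ≤ ‖z‖ := by nlinarith
    have hzaN : ‖z - a‖ ≤ 2 * ‖z‖ + δ := (norm_sub_le _ _).trans (by linarith)
    have hg : -K ≤ bs (z - a) := by
      have p1 : 0 ≤ M * (2 * ‖z‖ + δ) := by positivity
      have p2 : 0 ≤ 2 * ‖z‖ / δ * (M * (‖z‖ + 2 * δ)) := by positivity
      by_cases hsmall : ‖a‖ < δ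
      · have hbn := hbM a bs hbs (by simpa using hsmall)
        have := (aux_abs_le bs hbn hzaN).2
        linarith
      · push Not at hsmall
        have hsz2 : δ / 2 ≤ s * ‖z‖ := by linarith
        have hs0' : 0 < s := by
          rcases hs0.eq_or_lt with h | h
          · rw [← h] at hsz2; linarith
          · exact h
        have hg := aux_growth' hB.1 hδ hbD hbM hbs hun hs0' (by linarith) hae
        have h1 : 0 ≤ (1 - s) / s := by positivity
        have h2 : (1 - s) / s ≤ 2 * ‖z‖ / δ := by
          rw [div_le_div_iff₀ hs0' hδ]
          nlinarith
        have h3 : M * (‖a‖ + δ) ≤ M * (‖z‖ + 2 * δ) :=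
          mul_le_mul_of_nonneg_left (by linarith) hM.le
        have h4 : 0 ≤ δ / 2 * ‖bs‖ := by positivity
        have h5 : 0 ≤ M * (‖z‖ + 2 * δ) := by positivity
        calc -K ≤ -(2 * ‖z‖ / δ * (M * (‖z‖ + 2 * δ))) := by linarith
          _ ≤ -((1 - s) / s * (M * (‖z‖ + 2 * δ))) := by gcongr
          _ = (1 - s) / s * (-(M * (‖z‖ + 2 * δ))) := by ring
          _ ≤ (1 - s) / s * (δ / 2 * ‖bs‖ - M * (‖a‖ + δ)) :=
            mul_le_mul_of_nonneg_left (by linarith) h1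
          _ ≤ _ := hg
    have hfa : η / 2 ≤ f (z - a) := by
      rw [hze, map_sub, map_smul, hfz, smul_eq_mul]
      have := (aux_abs_le f (v := a - s • z) hf1.le hpa.le).1
      linarith
    rw [smul_apply, smul_eq_mul] at hax
    have hlf : l * (η / 2) ≤ l * f (z - a) := by gcongr
    have hle : l * (η / 2) = ‖zs‖ * (2 * ‖z‖ + δ) + K := by
      rw [hl]; field_simp
    have hz := (aux_abs_le zs le_rfl hzaN).1
    have hH := H a as bs haA hbs
    simp only [sub_apply] at hH
    linarith

/-- translation of a graph -/
def shiftOp (p : X) (q : X →L[ℝ] ℝ) (A : Set (X × (X →L[ℝ] ℝ))) : Set (X × (X →L[ℝ] ℝ)) :=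
  {g | (g.1 + p, g.2 + q) ∈ A}

lemma shift_mono (p : X) (q : X →L[ℝ] ℝ) {A : Set (X × (X →L[ℝ] ℝ))} (hA : IsMonotoneOp A) :
    IsMonotoneOp (shiftOp p q A) := by
  intro g hg h hh
  have := hA _ hg _ hh
  simpa only [add_sub_add_right_eq_sub] using this

lemma shift_max (p : X) (q : X →L[ℝ] ℝ) {A : Set (X × (X →L[ℝ] ℝ))} (hA : IsMaxMonotoneOp A) :
    IsMaxMonotoneOp (shiftOp p q A) := by
  refine ⟨shift_mono p q hA.1, fun B hB hAB => Subset.antisymm ?_ hAB⟩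
  rintro ⟨x, xs⟩ hx
  refine aux_mem_of_related hA fun y ys hy => ?_
  have hy' : (y - p, ys - q) ∈ B := hAB (by simpa [shiftOp] using hy)
  have := hB _ hx _ hy'
  convert this using 2
  · simp only; abel
  · simp only; abel

lemma shift_fpv (p : X) (q : X →L[ℝ] ℝ) {A : Set (X × (X →L[ℝ] ℝ))} (hA : IsFPV A) :
    IsFPV (shiftOp p q A) := by
  refine ⟨shift_max p q hA.1, fun U hU hUc hne x xs hx hrel => ?_⟩
  have hcont : Continuous fun y : X => y - p := by fun_prop
  refine hA.2 ((fun y => y - p) ⁻¹' U) (hU.preimage hcont) ?_ ?_ (x + p) (xs + q) (by simpa using hx) ?_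
  · intro y hy y' hy' a b ha hb hab
    have e : a • y + b • y' - p = a • (y - p) + b • (y' - p) := by
      have : p = (a + b) • p := by rw [hab, one_smul]
      nth_rewrite 1 [this]
      module
    simp only [mem_preimage] at *
    rw [e]
    exact hUc hy hy' ha hb hab
  · obtain ⟨y, hyU, ys, hy⟩ := hne
    exact ⟨y + p, by simpa using hyU, ys + q, hy⟩
  · rintro ⟨y, ys⟩ ⟨hy, hyU, -⟩
    have := hrel (y - p, ys - q) ⟨by simpa [shiftOp] using hy, hyU, mem_univ _⟩
    convert this using 2
    · simp only; abel
    · simp only; abel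

/-- Fitzpatrick function of the sum dominates the duality pairing. -/
theorem fitz_sum_ge_pairing {X : Type*} [NormedAddCommGroup X] [NormedSpace ℝ X] [CompleteSpace X]
    (A B : Set (X × (X →L[ℝ] ℝ)))
    (hA : IsMaxMonotoneOp A) (hB : IsMaxMonotoneOp B)
    (hFPV : IsFPV A)
    (hstar : (starSet (opDom A) ∩ interior (opDom B)).Nonempty) :
    ∀ (z : X) (zs : X →L[ℝ] ℝ),
      ((zs z : ℝ) : EReal) ≤ fitz (opSum A B) (z, zs) := by
  intro z zs
  obtain ⟨p, ⟨⟨q, hpq⟩, hseg⟩, hpB⟩ := hstar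
  by_contra! hlt
  obtain ⟨r, hr1, hr2⟩ := EReal.lt_iff_exists_real_btwn.1 hlt
  have hr2 : r < zs z := by exact_mod_cast hr2
  have hle : ∀ a as bs, (a, as) ∈ A → (a, bs) ∈ B →
      (as + bs) z + zs a - (as + bs) a ≤ r := by
    intro a as bs ha hb
    have h1 : (((as + bs) z + zs a - (as + bs) a : ℝ) : EReal) ≤ fitz (opSum A B) (z, zs) := by
      refine le_iSup₂_of_le (a, as + bs) ⟨as, bs, ha, hb, rfl⟩ ?_
      exact le_rfl
    exact_mod_cast (h1.trans hr1.le)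
  have hdomA : opDom (shiftOp p q A) = {x | x + p ∈ opDom A} := by
    ext x
    constructor
    · rintro ⟨xs, hx⟩
      exact ⟨xs + q, hx⟩
    · rintro ⟨xs, hx⟩
      exact ⟨xs - q, by simpa [shiftOp] using hx⟩
  have hdomB : opDom (shiftOp p 0 B) = (fun x => x + p) ⁻¹' opDom B := by
    ext x
    constructor
    · rintro ⟨xs, hx⟩
      exact ⟨xs + 0, hx⟩
    · rintro ⟨xs, hx⟩
      exact ⟨xs, by simpa [shiftOp] using hx⟩
  have hcont : Continuous fun x : X => x + p := by fun_prop
  refine aux_core (shift_fpv p q hFPV) (shift_max p 0 hB) (by simpa [shiftOp] using hpq) ?_ ?_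
    (z := z - p) (zs := zs - q) (sub_pos.2 hr2) ?_
  · intro a ha t ht0 ht1
    rw [hdomA] at ha ⊢
    refine hseg _ ha ⟨1 - t, t, by linarith, ht0, by ring, ?_⟩
    module
  · rw [hdomB]
    refine preimage_interior_subset_interior_preimage hcont ?_
    simpa using hpB
  · intro a as bs ha hb
    have := hle (a + p) (as + q) (bs + 0) ha hb
    simp only [add_apply, sub_apply, map_sub, map_add, zero_apply] at *
    linarith
end
end

section
/- Let X be a real Banach space and let A, B : X ⇉ X* be maximally monotone operators with dom A ∩ int(dom B) ≠ ∅. Assume that A is of type (FPV) and that dom A is a convex set. Then A + B is maximally monotone. -/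
open Set Filter Topology

noncomputable section

variable {X : Type*} [NormedAddCommGroup X] [NormedSpace ℝ X]

theorem mono_le {A : Set (X × (X →L[ℝ] ℝ))} (hA : IsMonotoneOp A) {x y : X} {xs ys : X →L[ℝ] ℝ}
    (h1 : (x, xs) ∈ A) (h2 : (y, ys) ∈ A) : 0 ≤ xs x - xs y - ys x + ys y := by
  have := hA _ h1 _ h2
  simp only [_root_.sub_apply, map_sub] at this
  linarith

theorem max_mem {A : Set (X × (X →L[ℝ] ℝ))} (hA : IsMaxMonotoneOp A) {x : X} {xs : X →L[ℝ] ℝ}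
    (h : ∀ a as, (a, as) ∈ A → 0 ≤ xs x - xs a - as x + as a) : (x, xs) ∈ A := by
  have key := hA.2 (insert (x, xs) A) ?_ (Set.subset_insert _ _)
  · rw [← key]; exact Set.mem_insert _ _
  · rintro ⟨p, ps⟩ hp ⟨q, qs⟩ hq
    simp only [_root_.sub_apply, map_sub]
    rcases hp with hp | hp <;> rcases hq with hq | hq
    · obtain ⟨rfl, rfl⟩ := Prod.mk.inj hp
      obtain ⟨rfl, rfl⟩ := Prod.mk.inj hq
      simp
    · obtain ⟨rfl, rfl⟩ := Prod.mk.inj hp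
      have := h _ _ hq
      linarith
    · obtain ⟨rfl, rfl⟩ := Prod.mk.inj hq
      have := h _ _ hp
      linarith
    · have := mono_le hA.1 hp hq
      linarith

/-- epigraph of the Fitzpatrick function -/
def EF (A : Set (X × (X →L[ℝ] ℝ))) (x : X) (xs : X →L[ℝ] ℝ) (s : ℝ) : Prop :=
  ∀ a as, (a, as) ∈ A → as x + xs a - as a ≤ s

theorem EF_graph {A : Set (X × (X →L[ℝ] ℝ))} (hA : IsMonotoneOp A) {x : X} {xs : X →L[ℝ] ℝ}
    (h : (x, xs) ∈ A) : EF A x xs (xs x) := by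
  intro a as ha
  have := mono_le hA h ha
  linarith

theorem EF_ge {A : Set (X × (X →L[ℝ] ℝ))} (hA : IsMaxMonotoneOp A) {x : X} {xs : X →L[ℝ] ℝ}
    {s : ℝ} (h : EF A x xs s) : xs x ≤ s := by
  by_contra hlt
  push Not at hlt
  have hm : (x, xs) ∈ A := max_mem hA (fun a as ha => by have := h a as ha; linarith)
  have := h _ _ hm
  linarith

theorem EF_combo {A : Set (X × (X →L[ℝ] ℝ))} {x y : X} {xs ys : X →L[ℝ] ℝ} {s t : ℝ}
    (hx : EF A x xs s) (hy : EF A y ys t) {p q : ℝ} (hp : 0 ≤ p) (hq : 0 ≤ q) (hpq : p + q = 1) :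
    EF A (p • x + q • y) (p • xs + q • ys) (p * s + q * t) := by
  intro a as ha
  have h1 := mul_le_mul_of_nonneg_left (hx a as ha) hp
  have h2 := mul_le_mul_of_nonneg_left (hy a as ha) hq
  simp only [map_add, map_smul, smul_eq_mul, _root_.add_apply,
    _root_.smul_apply]
  have : as a = p * as a + q * as a := by rw [← add_mul, hpq, one_mul]
  linarith

theorem EF_mono {A : Set (X × (X →L[ℝ] ℝ))} {x : X} {xs : X →L[ℝ] ℝ} {s t : ℝ}
    (hx : EF A x xs s) (h : s ≤ t) : EF A x xs t := fun a as ha => (hx a as ha).trans h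

/-- Hahn–Banach in sandwich form. -/
theorem hb_core (K : Set (X × ℝ)) (hK : Convex ℝ K) (h0 : ∀ r, ((0 : X), r) ∈ K → 0 ≤ r)
    {δ M : ℝ} (hδ : 0 < δ) (hM : ∀ v : X, ‖v‖ ≤ δ → ∃ r ≤ M, (v, r) ∈ K) :
    ∃ b : X →L[ℝ] ℝ, ∀ v r, (v, r) ∈ K → b v ≤ r := by
  set K' : Set (X × ℝ) := {p | ∃ r, (p.1, r) ∈ K ∧ r < p.2} with hK'
  have hK'c : Convex ℝ K' := by
    rintro ⟨v, s⟩ ⟨r, hr, hrs⟩ ⟨w, t⟩ ⟨q, hq, hqt⟩ a b ha hb hab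
    refine ⟨a * r + b * q, ?_, ?_⟩
    · have := hK hr hq ha hb hab
      simpa using this
    · simp only [Prod.smul_mk, Prod.mk_add_mk, smul_eq_mul] at *
      rcases ha.eq_or_lt with rfl | ha'
      · have : b = 1 := by linarith
        subst this; linarith
      · have := mul_lt_mul_of_pos_left hrs ha'
        have := mul_le_mul_of_nonneg_left hqt.le hb
        linarith
  have hsub : Metric.ball (0 : X) δ ×ˢ Ioi M ⊆ interior K' := by
    apply interior_maximal
    · rintro ⟨v, s⟩ ⟨hv, hs⟩
      obtain ⟨r, hr, hrK⟩ := hM v (by simpa using (mem_ball_zero_iff.1 hv).le)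
      exact ⟨r, hrK, lt_of_le_of_lt hr hs⟩
    · exact Metric.isOpen_ball.prod isOpen_Ioi
  have hM0 : 0 ≤ M := by
    obtain ⟨r, hr, hrK⟩ := hM 0 (by simpa using hδ.le)
    exact (h0 r hrK).trans hr
  have h1 : ((0 : X), M + 1) ∈ interior K' := hsub ⟨by simpa using hδ, by simp⟩
  have hnot : ((0 : X), (0 : ℝ)) ∉ interior K' := by
    intro h
    obtain ⟨r, hr, hr0⟩ := interior_subset h
    have := h0 r hr
    simp at hr0
    linarith
  obtain ⟨f, hf⟩ := geometric_hahn_banach_open_point hK'c.interior isOpen_interior hnot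
  have hle : ∀ p ∈ K', f p ≤ 0 := by
    intro p hp
    have hcl : p ∈ closure (interior K') := by
      rw [hK'c.closure_interior_eq_closure_of_nonempty_interior ⟨_, h1⟩]
      exact subset_closure hp
    have : closure (interior K') ⊆ {p | f p ≤ 0} := by
      apply closure_minimal
      · intro q hq
        have := hf q hq
        rw [show ((0 : X), (0 : ℝ)) = 0 from rfl, map_zero] at this
        exact this.le
      · exact isClosed_le f.continuous continuous_const
    exact this hcl
  have hsplit : ∀ v s, f (v, s) = f (v, 0) + s * f (0, 1) := by
    intro v s
    have : (v, s) = (v, (0 : ℝ)) + s • ((0 : X), (1 : ℝ)) := by simp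
    rw [this, map_add, map_smul, smul_eq_mul]
  set γ := f (0, 1) with hγ
  have hγneg : γ < 0 := by
    have := hf _ h1
    rw [show ((0 : X), (0 : ℝ)) = 0 from rfl, map_zero, hsplit] at this
    rw [show ((0 : X), (0 : ℝ)) = 0 from rfl, map_zero] at this
    nlinarith
  refine ⟨(-γ)⁻¹ • (f.comp (ContinuousLinearMap.inl ℝ X ℝ)), ?_⟩
  intro v r hvr
  simp only [_root_.smul_apply, ContinuousLinearMap.comp_apply,
    ContinuousLinearMap.inl_apply, smul_eq_mul]
  rw [inv_mul_le_iff₀ (by linarith)]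
  apply le_of_forall_pos_le_add
  intro e he
  have h2 := hle (v, r + e / (-γ)) ⟨r, hvr, by
    have : 0 < e / (-γ) := div_pos he (by linarith)
    simpa using this⟩
  rw [hsplit] at h2
  have hγne := hγneg.ne
  have h3 : e / (-γ) * γ = - e := by
    rw [div_neg, neg_mul, div_mul_cancel₀ _ hγne]
  nlinarith

theorem norm_bound {b : X →L[ℝ] ℝ} {δ R : ℝ} (hδ : 0 < δ) (h : ∀ v : X, ‖v‖ ≤ δ → b v ≤ R) :
    δ * ‖b‖ ≤ R := by
  have hR : 0 ≤ R := by simpa using h 0 (by simpa using hδ.le)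
  have : ‖b‖ ≤ R / δ := by
    refine ContinuousLinearMap.opNorm_le_bound _ (by positivity) ?_
    intro x
    rcases eq_or_ne x 0 with rfl | hx
    · simp
    have hx' : 0 < ‖x‖ := norm_pos_iff.2 hx
    have hn : ‖(δ / ‖x‖) • x‖ ≤ δ := by
      rw [norm_smul, Real.norm_of_nonneg (by positivity)]
      field_simp; exact le_rfl
    have h1 := h _ hn
    have h2 := h (-((δ / ‖x‖) • x)) (by rwa [norm_neg])
    simp only [map_neg, map_smul, smul_eq_mul] at h1 h2
    have h3 : (δ / ‖x‖) * |b x| ≤ R := by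
      rcases abs_cases (b x) with ⟨h, _⟩ | ⟨h, _⟩ <;> rw [h] <;> linarith
    rw [Real.norm_eq_abs]
    rw [div_mul_eq_mul_div, div_le_iff₀ hx'] at h3
    rw [div_mul_eq_mul_div, le_div_iff₀ hδ]
    linarith
  rw [le_div_iff₀ hδ] at this
  linarith

/-- The set of good points of `B`; it is the interior of the domain. -/
def QB (B : Set (X × (X →L[ℝ] ℝ))) : Set X :=
  {u | ∃ δ > 0, ∃ M : ℝ, ∀ v : X, ‖v‖ ≤ δ → ∃ xs : X →L[ℝ] ℝ, ‖xs‖ ≤ M ∧ EF B (u + v) xs M}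

theorem QB_dom {B : Set (X × (X →L[ℝ] ℝ))} (hB : IsMaxMonotoneOp B) {u : X} (hu : u ∈ QB B) :
    ∃ b, (u, b) ∈ B := by
  obtain ⟨δ, hδ, M, hM⟩ := hu
  have hex : ∃ b : X →L[ℝ] ℝ, ∀ v r, (v, r) ∈ {p : X × ℝ | ∃ xs s, EF B (u + p.1) xs s ∧
      s - xs u ≤ p.2} → b v ≤ r := by
    refine hb_core _ ?_ ?_ hδ (M := M + M * ‖u‖) ?_
    · rintro ⟨v, r⟩ ⟨xs, s, h1, h2⟩ ⟨w, q⟩ ⟨ys, t, h3, h4⟩ a b ha hb hab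
      refine ⟨a • xs + b • ys, a * s + b * t, ?_, ?_⟩
      · have := EF_combo h1 h3 ha hb hab
        convert this using 1
        simp only [Prod.smul_mk, Prod.mk_add_mk, smul_add]
        nth_rewrite 1 [← one_smul ℝ u]
        rw [← hab, add_smul]; abel
      · simp only [Prod.smul_mk, Prod.mk_add_mk, smul_eq_mul, _root_.add_apply,
          _root_.smul_apply] at *
        have := mul_le_mul_of_nonneg_left h2 ha
        have := mul_le_mul_of_nonneg_left h4 hb
        linarith
    · rintro r ⟨xs, s, h1, h2⟩
      have := EF_ge hB h1
      simp only [add_zero] at this h2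
      linarith
    · intro v hv
      obtain ⟨xs, h1, h2⟩ := hM v hv
      refine ⟨_, le_rfl, xs, M, h2, ?_⟩
      have h3 := xs.le_opNorm u
      rw [Real.norm_eq_abs] at h3
      have := neg_abs_le (xs u)
      have := mul_le_mul_of_nonneg_right h1 (norm_nonneg u)
      show M - xs u ≤ M + M * ‖u‖
      linarith
  obtain ⟨b, hb⟩ := hex
  refine ⟨b, max_mem hB ?_⟩
  intro a as ha
  have := hb (a - u) (as a - as u) ⟨as, as a, by
    have := EF_graph hB.1 ha
    simpa using this, le_rfl⟩
  rw [map_sub] at this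
  linarith

theorem QB_open (B : Set (X × (X →L[ℝ] ℝ))) : IsOpen (QB B) := by
  rw [Metric.isOpen_iff]
  rintro u ⟨δ, hδ, M, hM⟩
  refine ⟨δ / 2, by positivity, ?_⟩
  intro w hw
  refine ⟨δ / 2, by positivity, M, ?_⟩
  intro v hv
  have hw' : ‖w - u‖ < δ / 2 := by simpa [dist_eq_norm] using hw
  have := hM (w - u + v) (by have := norm_add_le (w - u) v; linarith)
  simpa [← add_assoc] using this

theorem QB_star {B : Set (X × (X →L[ℝ] ℝ))} {u x : X} (hu : u ∈ QB B)
    (hx : ∃ xs s, EF B x xs s) {p q : ℝ} (hp : 0 < p) (hq : 0 ≤ q) (hpq : p + q = 1) :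
    p • u + q • x ∈ QB B := by
  obtain ⟨δ, hδ, M, hM⟩ := hu
  obtain ⟨xs, s, hxs⟩ := hx
  refine ⟨p * δ, by positivity, max (p * M + q * ‖xs‖) (p * M + q * s), ?_⟩
  intro v hv
  obtain ⟨ys, h1, h2⟩ := hM (p⁻¹ • v) (by
    rw [norm_smul, Real.norm_of_nonneg (by positivity), inv_mul_le_iff₀ hp]; exact hv)
  refine ⟨p • ys + q • xs, ?_, ?_⟩
  · refine le_trans ?_ (le_max_left _ _)
    refine (norm_add_le _ _).trans ?_
    rw [norm_smul, norm_smul, Real.norm_of_nonneg hp.le, Real.norm_of_nonneg hq]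
    gcongr
  · refine EF_mono ?_ (le_max_right _ _)
    have := EF_combo h2 hxs hp.le hq hpq
    convert this using 1
    rw [smul_add, smul_inv_smul₀ hp.ne']
    abel

theorem QB_EF {B : Set (X × (X →L[ℝ] ℝ))} {u : X} (hu : u ∈ QB B) : ∃ xs s, EF B u xs s := by
  obtain ⟨δ, hδ, M, hM⟩ := hu
  obtain ⟨xs, _, h⟩ := hM 0 (by simpa using hδ.le)
  exact ⟨xs, M, by simpa using h⟩

theorem QB_convex (B : Set (X × (X →L[ℝ] ℝ))) : Convex ℝ (QB B) := by
  intro u hu x hx p q hp hq hpq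
  rcases hp.eq_or_lt with rfl | hp
  · have : q = 1 := by linarith
    subst this; simpa using hx
  · exact QB_star hu (QB_EF hx) hp hq hpq

/-- points of `dom B` are in the closure of `QB B` -/
theorem dom_closure {B : Set (X × (X →L[ℝ] ℝ))} (hB : IsMonotoneOp B) {u x : X} {xs : X →L[ℝ] ℝ}
    (hu : u ∈ QB B) (hx : (x, xs) ∈ B) : x ∈ closure (QB B) := by
  have hseq : Tendsto (fun p : ℝ => p • u + (1 - p) • x) (𝓝[>] 0) (𝓝 x) := by
    have : Continuous (fun p : ℝ => p • u + (1 - p) • x) := by fun_prop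
    have h := this.tendsto 0
    simp only [zero_smul, sub_zero, one_smul, zero_add] at h
    exact h.mono_left nhdsWithin_le_nhds
  refine mem_closure_of_tendsto hseq ?_
  have h1 : ∀ᶠ p : ℝ in 𝓝[>] 0, p ∈ Ioo (0 : ℝ) 1 := Ioo_mem_nhdsGT one_pos
  filter_upwards [h1] with p hp
  exact QB_star hu ⟨xs, _, EF_graph hB hx⟩ hp.1 (by linarith [hp.2]) (by ring)

theorem QB_bound {B : Set (X × (X →L[ℝ] ℝ))} {u : X} (hu : u ∈ QB B) :
    ∃ δ > 0, ∃ C : ℝ, 0 ≤ C ∧ ∀ x b, (x, b) ∈ B → δ * ‖b‖ ≤ b x - b u + C * (1 + ‖x‖) := by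
  obtain ⟨δ, hδ, M, hM⟩ := hu
  have hM0 : 0 ≤ M := by
    obtain ⟨xs, h1, _⟩ := hM 0 (by simpa using hδ.le)
    exact (norm_nonneg _).trans h1
  refine ⟨δ, hδ, M, hM0, ?_⟩
  intro x b hb
  apply norm_bound hδ
  intro v hv
  obtain ⟨xs, h1, h2⟩ := hM v hv
  have h3 := h2 x b hb
  rw [map_add] at h3
  have h4 := xs.le_opNorm x
  rw [Real.norm_eq_abs] at h4
  have := neg_abs_le (xs x)
  have := mul_le_mul_of_nonneg_right h1 (norm_nonneg x)
  linarith

/-- local boundedness (Rockafellar) through the uniform boundedness principle -/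
theorem int_dom_bound [CompleteSpace X] {B : Set (X × (X →L[ℝ] ℝ))} (hB : IsMonotoneOp B) {u : X}
    (hu : u ∈ interior (opDom B)) :
    ∃ δ > 0, ∃ C : ℝ, 0 ≤ C ∧ ∀ x b, (x, b) ∈ B → δ * ‖b‖ ≤ b x - b u + C * (1 + ‖x‖) := by
  obtain ⟨ρ, hρ, hball⟩ := Metric.isOpen_iff.1 isOpen_interior u hu
  have hfin : ∀ y ∈ opDom B, ∃ k : ℝ, 0 ≤ k ∧ ∀ x b, (x, b) ∈ B → b y - b x ≤ k * (1 + ‖x‖) := by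
    rintro y ⟨ys, hy⟩
    refine ⟨‖ys‖ * (1 + ‖y‖), by positivity, ?_⟩
    intro x b hb
    have h1 := mono_le hB hb hy
    have h2 := (le_abs_self _).trans (ys.le_opNorm (y - x))
    rw [map_sub] at h2
    have h3 := norm_sub_le y x
    have h4 : ‖ys‖ * ‖y - x‖ ≤ ‖ys‖ * (‖y‖ + ‖x‖) := by gcongr
    have h5 : 0 ≤ ‖ys‖ * (1 + ‖y‖ * ‖x‖) := by positivity
    nlinarith
  obtain ⟨k0, hk0, hk⟩ := hfin u (interior_subset hu)
  set d : B → ℝ := fun p => p.1.2 p.1.1 - p.1.2 u + (k0 + 1) * (1 + ‖p.1.1‖) with hd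
  have hd1 : ∀ p : B, 1 + ‖p.1.1‖ ≤ d p := by
    rintro ⟨⟨x, b⟩, hp⟩
    have := hk x b hp
    simp only [hd]
    linarith
  have hd0 : ∀ p : B, 0 < d p := fun p => lt_of_lt_of_le (by positivity) (hd1 p)
  have hup : ∀ w : X, ‖w‖ < ρ → ∃ c, ∀ p : B, (d p)⁻¹ * p.1.2 w ≤ c := by
    intro w hw
    obtain ⟨k, hk', hk2⟩ := hfin (u + w) (interior_subset (hball (by simpa using hw)))
    refine ⟨1 + k, ?_⟩
    rintro ⟨⟨x, b⟩, hp⟩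
    rw [inv_mul_le_iff₀ (hd0 _)]
    have h1 := hk2 x b hp
    have h2 := mul_le_mul_of_nonneg_left (hd1 ⟨⟨x, b⟩, hp⟩) hk'
    rw [map_add] at h1
    simp only [hd] at h2 ⊢
    have h3 : 0 ≤ (k0 + 1) * (1 + ‖x‖) := by positivity
    linarith
  obtain ⟨C', hC'⟩ := banach_steinhaus (g := fun p : B => (d p)⁻¹ • p.1.2) (by
    intro x
    set t : ℝ := ρ / (2 * (‖x‖ + 1)) with ht
    have ht0 : 0 < t := by positivity
    have hn : ‖t • x‖ < ρ := by
      rw [norm_smul, Real.norm_of_nonneg ht0.le, ht, div_mul_eq_mul_div, div_lt_iff₀ (by positivity)]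
      nlinarith [norm_nonneg x]
    obtain ⟨c1, h1⟩ := hup (t • x) hn
    obtain ⟨c2, h2⟩ := hup (-(t • x)) (by rwa [norm_neg])
    refine ⟨max c1 c2 / t, ?_⟩
    intro p
    have h1 := h1 p
    have h2 := h2 p
    simp only [map_neg, map_smul, smul_eq_mul] at h1 h2
    simp only [_root_.smul_apply, smul_eq_mul]
    rw [le_div_iff₀ ht0, Real.norm_eq_abs]
    rcases abs_cases ((d p)⁻¹ * p.1.2 x) with ⟨h, _⟩ | ⟨h, _⟩ <;> rw [h]
    · refine le_trans ?_ (le_max_left _ _); linarith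
    · refine le_trans ?_ (le_max_right _ _); linarith)
  set C := max C' 1 with hC
  have hC1 : 0 < C := lt_of_lt_of_le one_pos (le_max_right _ _)
  refine ⟨C⁻¹, by positivity, k0 + 1, by linarith, ?_⟩
  intro x b hb
  have h := hC' ⟨(x, b), hb⟩
  have hdp := hd0 ⟨(x, b), hb⟩
  rw [norm_smul, norm_inv, Real.norm_of_nonneg hdp.le, inv_mul_le_iff₀ hdp] at h
  have h' : ‖b‖ ≤ C * d ⟨(x, b), hb⟩ := by
    refine h.trans ?_
    rw [mul_comm]
    gcongr
    exact le_max_left _ _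
  rw [inv_mul_le_iff₀ hC1]
  exact h'

theorem int_dom_QB [CompleteSpace X] {B : Set (X × (X →L[ℝ] ℝ))} (hB : IsMonotoneOp B) {u : X}
    (hu : u ∈ interior (opDom B)) : u ∈ QB B := by
  obtain ⟨ρ, hρ, hball⟩ := Metric.isOpen_iff.1 isOpen_interior u hu
  obtain ⟨δ, hδ, C, hC, hb⟩ := int_dom_bound hB hu
  set η := min (ρ / 2) (δ / 2) with hη
  have hη0 : 0 < η := by positivity
  set R := 2 * C * (1 + ‖u‖ + η) / δ with hR
  have hR0 : 0 ≤ R := by positivity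
  refine ⟨η, hη0, max R (R * (‖u‖ + η)), ?_⟩
  intro v hv
  have hη1 : η ≤ ρ / 2 := min_le_left _ _
  have hη2 : η ≤ δ / 2 := min_le_right _ _
  obtain ⟨xs, hxs⟩ := interior_subset (hball (show u + v ∈ Metric.ball u ρ by
    simp; linarith))
  have hn : ‖u + v‖ ≤ ‖u‖ + η := (norm_add_le _ _).trans (by linarith)
  have h1 := hb _ _ hxs
  rw [map_add] at h1
  have h2 := (le_abs_self _).trans (xs.le_opNorm v)
  have h3 : ‖xs‖ * ‖v‖ ≤ ‖xs‖ * (δ / 2) := by gcongr; linarith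
  have h4 : C * (1 + ‖u + v‖) ≤ C * (1 + ‖u‖ + η) :=
    mul_le_mul_of_nonneg_left (by linarith) hC
  have hxR : ‖xs‖ ≤ R := by
    rw [hR, le_div_iff₀ hδ]; nlinarith
  refine ⟨xs, hxR.trans (le_max_left _ _), EF_mono (EF_graph hB hxs) ?_⟩
  refine le_trans ?_ (le_max_right _ _)
  refine ((le_abs_self _).trans (xs.le_opNorm _)).trans ?_
  gcongr

theorem fpv_tube {A : Set (X × (X →L[ℝ] ℝ))} (hF : IsFPV A) {x0 x1 : X} (h0 : x0 ∈ opDom A)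
    (ws : X →L[ℝ] ℝ) {r : ℝ} (hr : 0 < r) :
    ∃ a as, ∃ σ : ℝ, (a, as) ∈ A ∧ 0 ≤ σ ∧ σ ≤ 1 ∧ ‖a - (x0 + σ • (x1 - x0))‖ < r ∧
      0 ≤ as x1 - as a - ws x1 + ws a := by
  set U := Metric.thickening r (segment ℝ x0 x1) with hU
  have hUo : IsOpen U := Metric.isOpen_thickening
  have hUc : Convex ℝ U := (convex_segment x0 x1).thickening r
  have hsub : segment ℝ x0 x1 ⊆ U := Metric.self_subset_thickening hr _
  by_cases hm : MonotonicallyRelated (A ∩ (U ×ˢ (univ : Set (X →L[ℝ] ℝ)))) (x1, ws)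
  · have := hF.2 U hUo hUc ⟨x0, hsub (left_mem_segment ℝ x0 x1), h0⟩ x1 ws
      (hsub (right_mem_segment ℝ x0 x1)) hm
    refine ⟨x1, ws, 1, this, zero_le_one, le_rfl, ?_, ?_⟩
    · simpa using hr
    · simp
  · unfold MonotonicallyRelated at hm
    push Not at hm
    obtain ⟨⟨a, as⟩, ⟨haA, haU, -⟩, hlt⟩ := hm
    obtain ⟨y, hy, hay⟩ := Metric.mem_thickening_iff.1 haU
    rw [segment_eq_image'] at hy
    obtain ⟨σ, hσ, rfl⟩ := hy
    refine ⟨a, as, σ, haA, hσ.1, hσ.2, ?_, ?_⟩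
    · rw [← dist_eq_norm]; exact hay
    · simp only [_root_.sub_apply, map_sub] at hlt
      linarith

theorem blow_up {B : Set (X × (X →L[ℝ] ℝ))} (hB : IsMaxMonotoneOp B) {p : X}
    (hp : ∀ b, (p, b) ∉ B) (hne : ∃ x xs s, EF B x xs s) (N : ℝ) (hN : 0 ≤ N) :
    ∃ ρ > 0, ∀ q b, (q, b) ∈ B → ‖q - p‖ < ρ → N < ‖b‖ := by
  by_contra hcon
  push Not at hcon
  obtain ⟨x0, xs0, s0, hx0⟩ := hne
  have hex : ∃ b : X →L[ℝ] ℝ, ∀ v r, (v, r) ∈ {w : X × ℝ | ∃ v1 xs s, EF B (p + v1) xs s ∧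
      s - xs p + N * ‖w.1 - v1‖ ≤ w.2} → b v ≤ r := by
    refine hb_core _ ?_ ?_ one_pos (M := s0 - xs0 p + N * (1 + ‖x0 - p‖)) ?_
    · rintro ⟨v, r⟩ ⟨v1, xs, s, h1, h2⟩ ⟨w, q⟩ ⟨w1, ys, t, h3, h4⟩ a b ha hb hab
      refine ⟨a • v1 + b • w1, a • xs + b • ys, a * s + b * t, ?_, ?_⟩
      · have := EF_combo h1 h3 ha hb hab
        convert this using 1
        simp only [smul_add]
        nth_rewrite 1 [← one_smul ℝ p]
        rw [← hab, add_smul]; abel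
      · simp only [Prod.smul_mk, Prod.mk_add_mk, smul_eq_mul, _root_.add_apply,
          _root_.smul_apply] at *
        have e1 := mul_le_mul_of_nonneg_left h2 ha
        have e2 := mul_le_mul_of_nonneg_left h4 hb
        have e3 : ‖a • v + b • w - (a • v1 + b • w1)‖ ≤ a * ‖v - v1‖ + b * ‖w - w1‖ := by
          have : a • v + b • w - (a • v1 + b • w1) = a • (v - v1) + b • (w - w1) := by
            simp only [smul_sub]; abel
          rw [this]
          refine (norm_add_le _ _).trans ?_
          rw [norm_smul, norm_smul, Real.norm_of_nonneg ha, Real.norm_of_nonneg hb]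
        have e4 := mul_le_mul_of_nonneg_left e3 hN
        linarith
    · rintro r ⟨v1, xs, s, h1, h2⟩
      simp only [zero_sub, norm_neg] at h2
      refine le_trans ?_ h2
      apply le_of_forall_pos_le_add
      intro e he
      have hc : 0 < N + ‖xs‖ + 1 := by positivity
      obtain ⟨q, b, hqb, hq, hbN⟩ := hcon (e / (N + ‖xs‖ + 1)) (by positivity)
      rw [lt_div_iff₀ hc] at hq
      have h3 := h1 q b hqb
      have h4 := (le_abs_self _).trans (xs.le_opNorm (p - q))
      have h5 := (neg_abs_le _).trans' (neg_le_neg (b.le_opNorm (p + v1 - q)))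
      rw [norm_sub_rev] at h4
      have h6 : ‖p + v1 - q‖ ≤ ‖v1‖ + ‖q - p‖ := by
        have : p + v1 - q = v1 - (q - p) := by abel
        rw [this]; exact norm_sub_le _ _
      have h7 : ‖b‖ * ‖p + v1 - q‖ ≤ N * (‖v1‖ + ‖q - p‖) := by gcongr
      rw [map_sub] at h4 h5
      nlinarith [norm_nonneg (q - p)]
    · intro v hv
      refine ⟨_, le_rfl, x0 - p, xs0, s0, by simpa using hx0, ?_⟩
      have : ‖v - (x0 - p)‖ ≤ 1 + ‖x0 - p‖ := (norm_sub_le _ _).trans (by linarith)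
      have := mul_le_mul_of_nonneg_left this hN
      show s0 - xs0 p + N * ‖v - (x0 - p)‖ ≤ _
      linarith
  obtain ⟨b, hb⟩ := hex
  refine hp b (max_mem hB ?_)
  intro a as ha
  have := hb (a - p) (as a - as p) ⟨a - p, as, as a, by
    have := EF_graph hB.1 ha
    simpa using this, by simp⟩
  rw [map_sub] at this
  linarith

/-- The gap property of the pair `(A, B)`. -/
def NoGap (A B : Set (X × (X →L[ℝ] ℝ))) : Prop :=
  ∀ z : X, ∀ zs : X →L[ℝ] ℝ, ∀ ε > 0, ¬ ∀ a as b, (a, as) ∈ A → (a, b) ∈ B →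
    as z + b z - zs z - as a - b a + zs a ≤ -ε

theorem sum_claim {A B : Set (X × (X →L[ℝ] ℝ))} (hg : NoGap A B) {z w : X}
    {zs us : X →L[ℝ] ℝ} {s : ℝ}
    (hz : ∀ a as b, (a, as) ∈ A → (a, b) ∈ B → as z + b z + zs a - as a - b a ≤ zs z)
    (hw : ∀ a as b, (a, as) ∈ A → (a, b) ∈ B → as w + b w + us a - as a - b a ≤ s) :
    zs w + us z - zs z ≤ s := by
  by_contra hlt
  push Not at hlt
  set D := zs w + us z - zs z - s with hD
  have hD0 : 0 < D := by linarith
  -- small convex parameter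
  set c := us w - zs w - us z + zs z with hc
  obtain ⟨l, hl0, hl1, hl⟩ : ∃ l : ℝ, 0 < l ∧ l ≤ 1 ∧ 0 < D + l * c := by
    refine ⟨min 1 (D / (2 * (|c| + 1))), by positivity, min_le_left _ _, ?_⟩
    set l := min 1 (D / (2 * (|c| + 1)))
    have hl0 : 0 < l := by positivity
    have h1 : l ≤ D / (2 * (|c| + 1)) := min_le_right _ _
    rw [le_div_iff₀ (by positivity)] at h1
    have := neg_abs_le c
    nlinarith [abs_nonneg c]
  refine hg ((1 - l) • z + l • w) ((1 - l) • zs + l • us) (l * (D + l * c)) (by positivity) ?_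
  intro a as b ha hb
  have h1 := mul_le_mul_of_nonneg_left (hz a as b ha hb) (show 0 ≤ 1 - l by linarith)
  have h2 := mul_le_mul_of_nonneg_left (hw a as b ha hb) hl0.le
  simp only [map_add, map_smul, smul_eq_mul, _root_.add_apply, _root_.smul_apply]
  rw [hD, hc]
  nlinarith

theorem sum_max {A B : Set (X × (X →L[ℝ] ℝ))} (hA : IsMaxMonotoneOp A) (hB : IsMaxMonotoneOp B)
    (hg : NoGap A B) {w0 : X} (hw0 : w0 ∈ opDom A) (hw0' : w0 ∈ QB B) :
    IsMaxMonotoneOp (opSum A B) := by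
  have hmono : IsMonotoneOp (opSum A B) := by
    rintro ⟨x, xs⟩ ⟨as, bs, h1, h2, h3⟩ ⟨y, ys⟩ ⟨as', bs', h1', h2', h3'⟩
    simp only at h3 h3' h1 h2 h1' h2'
    subst h3 h3'
    have := mono_le hA.1 h1 h1'
    have := mono_le hB.1 h2 h2'
    simp only [_root_.sub_apply, _root_.add_apply, map_sub]
    linarith
  refine ⟨hmono, ?_⟩
  intro B' hB' hsub
  refine Set.Subset.antisymm ?_ hsub
  rintro ⟨z, zs⟩ hz
  have hz1 : ∀ a as b, (a, as) ∈ A → (a, b) ∈ B → as z + b z + zs a - as a - b a ≤ zs z := by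
    intro a as b ha hb
    have := mono_le hB' hz (hsub (show (a, as + b) ∈ opSum A B from ⟨as, b, ha, hb, rfl⟩))
    simp only [_root_.add_apply] at this
    linarith
  obtain ⟨xs0, hxs0⟩ := hw0
  have hex : ∃ b : X →L[ℝ] ℝ, ∀ v r, (v, r) ∈ {p : X × ℝ | ∃ x xs s y ys t, EF A x xs s ∧
      EF B y ys t ∧ p.1 = y - x ∧ zs z - zs x - xs z + s - ys z + t ≤ p.2} → b v ≤ r := by
    obtain ⟨δ, hδ, M, hM⟩ := hw0'
    refine hb_core _ ?_ ?_ hδ (M := zs z - zs w0 - xs0 z + xs0 w0 + M * ‖z‖ + M) ?_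
    · rintro ⟨v, r⟩ ⟨x, xs, s, y, ys, t, h1, h2, h3, h4⟩ ⟨v', r'⟩
        ⟨x', xs', s', y', ys', t', h1', h2', h3', h4'⟩ a b ha hb hab
      simp only at h3 h3' h4 h4'
      refine ⟨_, _, _, _, _, _, EF_combo h1 h1' ha hb hab, EF_combo h2 h2' ha hb hab, ?_, ?_⟩
      · simp only [Prod.smul_mk, Prod.mk_add_mk, h3, h3', smul_sub]
        abel
      · simp only [Prod.smul_mk, Prod.mk_add_mk, smul_eq_mul, _root_.add_apply,
          _root_.smul_apply, map_add, map_smul]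
        have e1 := mul_le_mul_of_nonneg_left h4 ha
        have e2 := mul_le_mul_of_nonneg_left h4' hb
        have e3 : zs z = a * zs z + b * zs z := by rw [← add_mul, hab, one_mul]
        linarith
    · rintro r ⟨x, xs, s, y, ys, t, h1, h2, h3, h4⟩
      simp only at h3 h4
      obtain rfl : x = y := (sub_eq_zero.1 h3.symm).symm
      have := sum_claim hg (w := x) (us := xs + ys) (s := s + t) hz1 (by
        intro a as b ha hb
        have := h1 a as ha
        have := h2 a b hb
        simp only [_root_.add_apply]
        linarith)
      simp only [_root_.add_apply] at this
      linarith
    · intro v hv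
      obtain ⟨ys, h1, h2⟩ := hM v hv
      refine ⟨_, le_rfl, w0, xs0, xs0 w0, w0 + v, ys, M, EF_graph hA.1 hxs0, h2, by simp, ?_⟩
      have h3 := (neg_abs_le _).trans' (neg_le_neg (ys.le_opNorm z))
      have h4 := mul_le_mul_of_nonneg_right h1 (norm_nonneg z)
      simp only
      linarith
  obtain ⟨b, hb⟩ := hex
  have key : ∀ x xs y ys, (x, xs) ∈ A → (y, ys) ∈ B →
      0 ≤ ((zs - b) z - (zs - b) x - xs z + xs x) + (b z - b y - ys z + ys y) := by
    intro x xs y ys hx hy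
    have := hb (y - x) _ ⟨x, xs, _, y, ys, _, EF_graph hA.1 hx, EF_graph hB.1 hy, rfl, le_rfl⟩
    simp only [_root_.sub_apply, map_sub] at this ⊢
    linarith
  have hzA : (z, zs - b) ∈ A := by
    by_contra hn
    have : ∃ x xs, (x, xs) ∈ A ∧ (zs - b) z - (zs - b) x - xs z + xs x < 0 := by
      by_contra hno
      push Not at hno
      exact hn (max_mem hA hno)
    obtain ⟨x, xs, hx, hlt⟩ := this
    have hzB : (z, b) ∈ B := max_mem hB (fun y ys hy => by
      have := key x xs y ys hx hy; linarith)
    have := key x xs z b hx hzB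
    linarith
  have hzB : (z, b) ∈ B := max_mem hB (fun y ys hy => by
    have := key z _ y ys hzA hy; linarith)
  exact ⟨zs - b, b, hzA, hzB, by simp⟩

theorem exists_small {δ θ S : ℝ} (hδ : 0 < δ) (hθ : 0 < θ) (hS : 0 ≤ S) :
    ∃ r > 0, r ≤ δ ∧ r * S < θ := by
  refine ⟨min δ (θ / (2 * (S + 1))), by positivity, min_le_left _ _, ?_⟩
  have h1 : min δ (θ / (2 * (S + 1))) ≤ θ / (2 * (S + 1)) := min_le_right _ _
  rw [le_div_iff₀ (by positivity)] at h1
  have h2 : 0 < min δ (θ / (2 * (S + 1))) := by positivity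
  nlinarith

theorem tube_bound {B : Set (X × (X →L[ℝ] ℝ))} {u0 u1 : X} (h0 : u0 ∈ QB B) (h1 : u1 ∈ QB B) :
    ∃ δ > 0, ∃ M : ℝ, 0 ≤ M ∧ ∀ t : ℝ, 0 ≤ t → t ≤ 1 → ∀ x, ‖x - (u0 + t • (u1 - u0))‖ < δ →
      x ∈ QB B ∧ ∀ b, (x, b) ∈ B → ‖b‖ ≤ M := by
  obtain ⟨δ0, hδ0, M0, hM0⟩ := h0
  obtain ⟨δ1, hδ1, M1, hM1⟩ := h1
  set δ := min δ0 δ1 with hδ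
  have hδp : 0 < δ := by positivity
  set M := max M0 M1 with hM
  have hMp : 0 ≤ M := by
    obtain ⟨xs, h1, _⟩ := hM0 0 (by simpa using hδ0.le)
    exact ((norm_nonneg _).trans h1).trans (le_max_left _ _)
  have key : ∀ t : ℝ, 0 ≤ t → t ≤ 1 → ∀ v : X, ‖v‖ ≤ δ →
      ∃ xs : X →L[ℝ] ℝ, ‖xs‖ ≤ M ∧ EF B (u0 + t • (u1 - u0) + v) xs M := by
    intro t ht0 ht1 v hv
    obtain ⟨xs, h1, h2⟩ := hM0 v (hv.trans (min_le_left _ _))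
    obtain ⟨ys, h3, h4⟩ := hM1 v (hv.trans (min_le_right _ _))
    have h1' : ‖xs‖ ≤ M := h1.trans (le_max_left _ _)
    have h3' : ‖ys‖ ≤ M := h3.trans (le_max_right _ _)
    have h2' : EF B (u0 + v) xs M := EF_mono h2 (le_max_left _ _)
    have h4' : EF B (u1 + v) ys M := EF_mono h4 (le_max_right _ _)
    have ht2 : 0 ≤ 1 - t := by linarith
    refine ⟨(1 - t) • xs + t • ys, ?_, ?_⟩
    · refine (norm_add_le _ _).trans ?_
      rw [norm_smul, norm_smul, Real.norm_of_nonneg ht2, Real.norm_of_nonneg ht0]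
      nlinarith
    · have := EF_combo h2' h4' ht2 ht0 (by ring)
      have e1 : (1 - t) • (u0 + v) + t • (u1 + v) = u0 + t • (u1 - u0) + v := by module
      have e2 : (1 - t) * M + t * M = M := by ring
      rwa [e1, e2] at this
  set R := M * (1 + ‖u0‖ + ‖u1 - u0‖ + δ) with hR
  refine ⟨δ / 2, by positivity, R / (δ / 2), by positivity, ?_⟩
  intro t ht0 ht1 x hx
  have hshift : ∀ v : X, ‖v‖ ≤ δ / 2 → ∃ xs : X →L[ℝ] ℝ, ‖xs‖ ≤ M ∧ EF B (x + v) xs M := by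
    intro v hv
    have := key t ht0 ht1 (x - (u0 + t • (u1 - u0)) + v)
      ((norm_add_le _ _).trans (by linarith))
    simpa [← add_assoc] using this
  refine ⟨⟨δ / 2, by positivity, M, hshift⟩, ?_⟩
  intro b hb
  rw [le_div_iff₀ (by positivity), mul_comm]
  apply norm_bound (by positivity)
  intro v hv
  obtain ⟨xs, h1, h2⟩ := hshift v hv
  have h3 := h2 x b hb
  rw [map_add] at h3
  have h4 := (neg_abs_le _).trans' (neg_le_neg (xs.le_opNorm x))
  have h5 := mul_le_mul_of_nonneg_right h1 (norm_nonneg x)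
  have h6 : ‖x‖ ≤ ‖u0‖ + ‖u1 - u0‖ + δ := by
    have e : x = u0 + t • (u1 - u0) + (x - (u0 + t • (u1 - u0))) := by abel
    have e2 : ‖t • (u1 - u0)‖ ≤ ‖u1 - u0‖ := by
      rw [norm_smul, Real.norm_of_nonneg ht0]
      nlinarith [norm_nonneg (u1 - u0)]
    have e3 := norm_add_le (u0 + t • (u1 - u0)) (x - (u0 + t • (u1 - u0)))
    rw [← e] at e3
    have e4 := norm_add_le u0 (t • (u1 - u0))
    linarith
  have h7 := mul_le_mul_of_nonneg_left h6 hMp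
  rw [hR]
  linarith

theorem caseII_num {τ σ g ε m L e1 e2 α π β η hr : ℝ} (hτ0 : 0 < τ) (hτ1 : τ < 1)
    (hg : 0 < g) (hσ0 : 0 ≤ σ) (hσ1 : σ ≤ τ) (hm : m = 2 + 2 * L / g + 4 / (τ * g))
    (hL : 0 ≤ L)
    (hs : (m + 1) * e1 + 3 * e2 < min 1 (τ * (ε - (1 - τ) * g)))
    (h1 : 0 ≤ α * (τ - σ) - π - m * ((τ - σ) * g - hr)) (h2 : 0 ≤ α * σ + π)
    (h3 : 0 ≤ β * σ + η) (hr1 : |hr| ≤ e1) (hη : |η| ≤ e2) (hβ : |β| ≤ L)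
    (hgap : (α * (1 - σ) - π) + (β * (1 - σ) - η) ≤ -ε + (1 - σ) * g - hr) : False := by
  have hm1 : 1 ≤ m := by
    rw [hm]
    have : 0 ≤ 2 * L / g := by positivity
    have : 0 ≤ 4 / (τ * g) := by positivity
    linarith
  have hmt : m * (τ / 2 * g) = τ * g + τ * L + 2 := by
    rw [hm]; field_simp; ring
  have hs1 := hs.trans_le (min_le_left _ _)
  have hs2 := hs.trans_le (min_le_right _ _)
  obtain ⟨hra, hrb⟩ := abs_le.1 hr1
  obtain ⟨hηa, hηb⟩ := abs_le.1 hη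
  obtain ⟨hβa, hβb⟩ := abs_le.1 hβ
  have he1 : 0 ≤ e1 := (abs_nonneg _).trans hr1
  have he2 : 0 ≤ e2 := (abs_nonneg _).trans hη
  have hmr : m * hr ≤ m * e1 := mul_le_mul_of_nonneg_left hrb (by linarith)
  have hτr : -(τ * hr) ≤ e1 := by nlinarith
  have hτη : τ * η ≤ e2 := by nlinarith
  -- A part
  have hA : m * ((τ - σ) * g - hr) ≤ τ * (α * (1 - σ) - π) := by
    have a1 : m * ((τ - σ) * g - hr) ≤ α * τ := by linarith
    have a2 := mul_le_mul_of_nonneg_left a1 (show 0 ≤ 1 - τ by linarith)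
    have a3 := mul_le_mul_of_nonneg_left h1 hτ0.le
    linarith
  have hG := mul_le_mul_of_nonneg_left hgap hτ0.le
  have main : m * ((τ - σ) * g) + τ * β * (1 - σ) ≤
      -τ * ε + τ * (1 - σ) * g + (m + 1) * e1 + e2 := by linarith
  rcases le_or_gt (τ / 2) σ with hc | hc
  · have b1 : -(2 * e2) ≤ τ * β * (1 - σ) := by
      rcases le_or_gt 0 β with hb | hb
      · have : 0 ≤ τ * β * (1 - σ) := mul_nonneg (mul_nonneg hτ0.le hb) (by linarith)
        linarith
      · have c1 : 2 * (β * σ) ≤ τ * β := by nlinarith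
        have c2 : τ * β ≤ τ * β * (1 - σ) := by
          have : 0 ≤ τ * (-β) * σ := mul_nonneg (mul_nonneg hτ0.le (by linarith)) hσ0
          nlinarith
        linarith
    have b2 : (τ - σ) * g ≤ m * ((τ - σ) * g) :=
      le_mul_of_one_le_left (mul_nonneg (by linarith) hg.le) hm1
    have b3 : σ * ((1 - τ) * g) ≤ τ * ((1 - τ) * g) :=
      mul_le_mul_of_nonneg_right hσ1 (mul_nonneg (by linarith) hg.le)
    linarith
  · have b1 : -(τ * L) ≤ τ * β * (1 - σ) := by
      rcases le_or_gt 0 β with hb | hb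
      · have : 0 ≤ τ * β * (1 - σ) := mul_nonneg (mul_nonneg hτ0.le hb) (by linarith)
        have : 0 ≤ τ * L := by positivity
        linarith
      · have c2 : τ * β ≤ τ * β * (1 - σ) := by
          have : 0 ≤ τ * (-β) * σ := mul_nonneg (mul_nonneg hτ0.le (by linarith)) hσ0
          nlinarith
        have c3 : τ * (-L) ≤ τ * β := mul_le_mul_of_nonneg_left hβa hτ0.le
        linarith
    have b2 : m * (τ / 2 * g) ≤ m * ((τ - σ) * g) := by
      apply mul_le_mul_of_nonneg_left _ (by linarith)
      exact mul_le_mul_of_nonneg_right (by linarith) hg.le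
    have b3 : τ * (1 - σ) * g ≤ τ * g := by
      have : 0 ≤ τ * σ * g := by positivity
      linarith
    have b4 : 0 < τ * ε := by
      have c1 := mul_pos hτ0 (mul_pos (sub_pos.2 hτ1) hg)
      have c2 := mul_nonneg (show 0 ≤ m + 1 by linarith) he1
      linarith
    linarith

theorem caseII {A B : Set (X × (X →L[ℝ] ℝ))} (hF : IsFPV A) (hB : IsMaxMonotoneOp B)
    {w0 z : X} {xb yb zs : X →L[ℝ] ℝ} {ε : ℝ} (hε : 0 < ε) (hxb : (w0, xb) ∈ A)
    (hyb : (w0, yb) ∈ B)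
    (hgap : ∀ a as b, (a, as) ∈ A → (a, b) ∈ B → as z + b z - zs z - as a - b a + zs a ≤ -ε)
    (hQ : ∀ τ : ℝ, 0 ≤ τ → τ < 1 → w0 + τ • (z - w0) ∈ QB B) : False := by
  set d := z - w0 with hd
  set h : X →L[ℝ] ℝ := zs - xb - yb with hh
  set g := h d with hgdef
  have hz : z = w0 + d := by rw [hd]; abel
  have hgε : ε ≤ g := by
    have := hgap _ _ _ hxb hyb
    rw [hgdef, hh, hd]
    simp only [_root_.sub_apply, map_sub]
    linarith
  have hg : 0 < g := by linarith
  set τ := 1 - ε / (2 * g) with hτ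
  have hεg : 0 < ε / (2 * g) := by positivity
  have hεg2 : ε / (2 * g) ≤ 1 / 2 := by
    rw [div_le_iff₀ (by positivity)]; linarith
  have hτ0 : 0 < τ := by rw [hτ]; linarith
  have hτ1 : τ < 1 := by rw [hτ]; linarith
  have hτg : (1 - τ) * g = ε / 2 := by
    rw [hτ]; field_simp; ring
  have h0Q : w0 ∈ QB B := by simpa using hQ 0 le_rfl one_pos
  obtain ⟨δ, hδ, M, hM, htube⟩ := tube_bound h0Q (hQ τ hτ0.le hτ1)
  set L := (M + ‖yb‖) * ‖d‖ with hL
  have hL0 : 0 ≤ L := by positivity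
  set m := 2 + 2 * L / g + 4 / (τ * g) with hm
  have hm0 : 0 < m := by positivity
  obtain ⟨r, hr, hrδ, hrS⟩ := exists_small (θ := min 1 (τ * (ε - (1 - τ) * g)))
    (S := (m + 1) * ‖h‖ + 3 * (M + ‖yb‖)) hδ (by rw [hτg]; apply lt_min one_pos; apply mul_pos hτ0; linarith) (by positivity)
  obtain ⟨a, as, t, haA, ht0, ht1, hat, hV⟩ := fpv_tube hF (x1 := w0 + τ • d) ⟨xb, hxb⟩ (xb + m • h) hr
  obtain ⟨haQ, hab⟩ := htube t ht0 ht1 a (hat.trans_le hrδ)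
  obtain ⟨b, hb⟩ := QB_dom hB haQ
  have hbM := hab b hb
  set ρ := a - (w0 + t • (w0 + τ • d - w0)) with hρ
  set σ := t * τ with hσ
  have haeq : a = w0 + σ • d + ρ := by
    rw [hρ, hσ, add_sub_cancel_left, smul_smul]; abel
  have m1 := mono_le hF.1.1 haA hxb
  have m2 := mono_le hB.1 hb hyb
  have m3 := hgap a as b haA hb
  have hby : ‖b - yb‖ ≤ M + ‖yb‖ := (norm_sub_le _ _).trans (by linarith)
  have n1 : |h ρ| ≤ ‖h‖ * r := (h.le_opNorm ρ).trans (by gcongr)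
  have n2 : |(b - yb) ρ| ≤ (M + ‖yb‖) * r := ((b - yb).le_opNorm ρ).trans (by gcongr)
  have n3 : |(b - yb) d| ≤ L := ((b - yb).le_opNorm d).trans (by rw [hL]; gcongr)
  have hσ0 : 0 ≤ σ := by positivity
  have hστ : σ ≤ τ := mul_le_of_le_one_left hτ0.le ht1
  refine caseII_num (α := (as - xb) d) (π := (as - xb) ρ) (ε := ε) hτ0 hτ1 hg hσ0 hστ hm hL0
    (hs := ?_) ?_ ?_ ?_ n1 n2 n3 ?_
  · linarith
  · rw [haeq] at hV
    rw [hgdef]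
    simp only [_root_.sub_apply, _root_.add_apply, _root_.smul_apply, map_add, map_smul, smul_eq_mul] at hV ⊢
    linarith
  · rw [haeq] at m1
    simp only [_root_.sub_apply, _root_.add_apply, _root_.smul_apply, map_add, map_smul, smul_eq_mul] at m1 ⊢
    linarith
  · rw [haeq] at m2
    simp only [_root_.sub_apply, _root_.add_apply, _root_.smul_apply, map_add, map_smul, smul_eq_mul] at m2 ⊢
    linarith
  · rw [haeq, hz] at m3
    rw [hgdef, hh]
    simp only [_root_.sub_apply, _root_.add_apply, _root_.smul_apply, map_add, map_smul, smul_eq_mul] at m3 ⊢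
    linarith

theorem caseP_num {C c1 ν α β s : ℝ} (hC : 0 ≤ C) (hc0 : 0 < c1) (hc1 : c1 ≤ 1 / 2) (hν0 : 0 < ν)
    (hν1 : ν ≤ 1 / 2) (h1 : 0 ≤ -α + c1 * β) (h2 : -C ≤ (1 - ν) * α + ν * (c1 * β))
    (h3 : β + ν * α - ν * (c1 * β) ≤ s) : -(C / c1) - C ≤ s := by
  have hb : -C ≤ c1 * β := by nlinarith
  have hb' : -(C / c1) ≤ β := by
    rw [neg_le, div_eq_mul_inv, ← div_eq_mul_inv, le_div_iff₀ hc0] at *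
    linarith
  have hC1 : 0 ≤ C / c1 := by positivity
  refine le_trans ?_ h3
  have hq : 0 < 1 - ν := by linarith
  rw [← mul_le_mul_iff_right₀ hq]
  have hcoef : 0 ≤ 1 - ν - ν * c1 := by nlinarith
  have e1 := mul_le_mul_of_nonneg_left hb' hcoef
  have e2 := mul_le_mul_of_nonneg_left h2 hν0.le
  have e3 : (1 - ν - ν * c1) * (C / c1) ≤ (1 - ν) * (C / c1) :=
    mul_le_mul_of_nonneg_right (by nlinarith) hC1
  nlinarith

theorem caseP {A B : Set (X × (X →L[ℝ] ℝ))} (hF : IsFPV A) (hconv : Convex ℝ (opDom A))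
    (hB : IsMaxMonotoneOp B)
    {w0 z p u : X} {xb zs ps : X →L[ℝ] ℝ} {ε c : ℝ} (hε : 0 < ε) (hxb : (w0, xb) ∈ A)
    (hw0 : w0 ∈ QB B)
    (hgap : ∀ a as b, (a, as) ∈ A → (a, b) ∈ B → as z + b z - zs z - as a - b a + zs a ≤ -ε)
    (hp : (p, ps) ∈ A) (hpc : p ∈ closure (QB B)) (hpn : p ∉ QB B)
    (hu : u ∈ QB B) (hc : 0 ≤ c) (hup : p - u = c • (z - p))
    {ρ0 κ C1 : ℝ} (hρ0 : 0 < ρ0) (hκ : 0 < κ)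
    (hH : ∀ q b, (q, b) ∈ B → ‖q - p‖ < ρ0 → κ * ‖b‖ - C1 ≤ b (z - q)) : False := by
  by_cases hpB : ∃ b, (p, b) ∈ B
  · obtain ⟨b, hb⟩ := hpB
    obtain ⟨n, hn⟩ := geometric_hahn_banach_open_point (QB_convex B) (QB_open B) hpn
    have hn' : ∀ a as, (a, as) ∈ B → n a ≤ n p := by
      intro a as ha
      have : closure (QB B) ⊆ {x | n x ≤ n p} :=
        closure_minimal (fun x hx => (hn x hx).le) (isClosed_le n.continuous continuous_const)
      exact this (dom_closure hB.1 hw0 ha)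
    have hpos : 0 < n (z - p) := by
      have h1 := hn u hu
      have h2 : n (p - u) = c * n (z - p) := by rw [hup, map_smul, smul_eq_mul]
      rw [map_sub] at h2
      by_contra hneg
      push Not at hneg
      nlinarith
    set E := ps (z - p) + b (z - p) - zs (z - p) with hE
    set k := (|E| + 1) / n (z - p) with hk
    have hk0 : 0 ≤ k := by positivity
    have hkn : k * n (z - p) = |E| + 1 := by rw [hk]; field_simp
    have hmem : (p, b + k • n) ∈ B := by
      apply max_mem hB
      intro a as ha
      have e1 := mono_le hB.1 hb ha
      have e2 := mul_le_mul_of_nonneg_left (hn' a as ha) hk0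
      simp only [_root_.add_apply, _root_.smul_apply, smul_eq_mul]
      linarith
    have := hgap p ps _ hp hmem
    simp only [_root_.add_apply, _root_.smul_apply, smul_eq_mul] at this
    have h3 := neg_abs_le E
    rw [hE] at h3
    rw [hE] at hkn
    simp only [map_sub] at h3 hkn
    linarith
  · push Not at hpB
    -- the point `w0 + c1 (z - p)`
    obtain ⟨η, hη, hball⟩ := Metric.isOpen_iff.1 (QB_open B) w0 hw0
    obtain ⟨c1, hc0, hc1, hcs⟩ := exists_small (δ := 1 / 2) (by norm_num) hη (norm_nonneg (z - p))
    have hu1 : w0 + c1 • (z - p) ∈ QB B := by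
      apply hball
      rw [mem_ball_iff_norm, add_sub_cancel_left, norm_smul, Real.norm_of_nonneg hc0.le]
      exact hcs
    set C := ‖xb - ps‖ * (‖w0 - p‖ + 1) with hC
    have hC0 : 0 ≤ C := by positivity
    set C3 := (‖zs‖ + ‖ps‖) * (‖z - p‖ + 1) + C / c1 + C with hC3
    have hC30 : 0 ≤ C3 := by positivity
    obtain ⟨xsE, sE, hEF⟩ := QB_EF hw0
    obtain ⟨ρ1, hρ1, hblow⟩ := blow_up hB hpB ⟨w0, xsE, sE, hEF⟩ ((C3 + |C1|) / κ) (by positivity)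
    set ρ' := min (min ρ0 ρ1) 1 with hρ'
    have hρ'0 : 0 < ρ' := by positivity
    obtain ⟨ν, hν0, hν1, hνs⟩ := exists_small (δ := 1 / 2) (θ := ρ' / 2) (by norm_num)
      (by positivity) (S := ‖w0 - p‖ + ‖z - p‖) (by positivity)
    have hQint : interior (QB B) = QB B := (QB_open B).interior_eq
    have hq1 : ν • w0 + (1 - ν) • p ∈ QB B := by
      have := (QB_convex B).combo_interior_closure_mem_interior (hQint.symm ▸ hw0) hpc hν0
        (show 0 ≤ 1 - ν by linarith) (by ring)
      rwa [hQint] at this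
    have hq2 : ν • (w0 + c1 • (z - p)) + (1 - ν) • p ∈ QB B := by
      have := (QB_convex B).combo_interior_closure_mem_interior (hQint.symm ▸ hu1) hpc hν0
        (show 0 ≤ 1 - ν by linarith) (by ring)
      rwa [hQint] at this
    have hq1A : ν • w0 + (1 - ν) • p ∈ opDom A :=
      hconv ⟨xb, hxb⟩ ⟨ps, hp⟩ hν0.le (by linarith) (by ring)
    obtain ⟨δ, hδ, M, hM, htube⟩ := tube_bound hq1 hq2
    obtain ⟨q, qs, t, hqA, ht0, ht1, hqt, hV⟩ := fpv_tube hF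
      (x1 := ν • (w0 + c1 • (z - p)) + (1 - ν) • p) hq1A ps
      (r := min δ (ρ' / 2)) (by positivity)
    obtain ⟨hqQ, -⟩ := htube t ht0 ht1 q (hqt.trans_le (min_le_left _ _))
    obtain ⟨b, hb⟩ := QB_dom hB hqQ
    have hqp : ‖q - p‖ < ρ' := by
      have h1 := hqt.trans_le (min_le_right _ _)
      set y := ν • w0 + (1 - ν) • p + t • (ν • (w0 + c1 • (z - p)) + (1 - ν) • p -
        (ν • w0 + (1 - ν) • p)) with hy
      have h2 : y - p = ν • ((w0 - p) + (t * c1) • (z - p)) := by rw [hy]; module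
      have h3 : ‖y - p‖ ≤ ν * (‖w0 - p‖ + ‖z - p‖) := by
        rw [h2, norm_smul, Real.norm_of_nonneg hν0.le]
        gcongr
        refine (norm_add_le _ _).trans ?_
        rw [norm_smul, Real.norm_of_nonneg (by positivity)]
        have : t * c1 ≤ 1 := by nlinarith
        have := mul_le_mul_of_nonneg_right this (norm_nonneg (z - p))
        linarith
      have h4 := norm_add_le (q - y) (y - p)
      rw [sub_add_sub_cancel] at h4
      linarith
    have hqp0 : ‖q - p‖ < ρ0 := hqp.trans_le ((min_le_left _ _).trans (min_le_left _ _))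
    have hqp1 : ‖q - p‖ < ρ1 := hqp.trans_le ((min_le_left _ _).trans (min_le_right _ _))
    have hqp2 : ‖q - p‖ < 1 := hqp.trans_le (min_le_right _ _)
    have hzq : ‖z - q‖ ≤ ‖z - p‖ + 1 := by
      have := norm_sub_le (z - p) (q - p)
      rw [sub_sub_sub_cancel_right] at this
      linarith
    have hwq : ‖w0 - q‖ ≤ ‖w0 - p‖ + 1 := by
      have := norm_sub_le (w0 - p) (q - p)
      rw [sub_sub_sub_cancel_right] at this
      linarith
    have k1 := hblow q b hb hqp1
    have k2 := hH q b hb hqp0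
    have k3 := hgap q qs b hqA hb
    have k4 := mono_le hF.1.1 hqA hp
    have k5 := mono_le hF.1.1 hqA hxb
    have k6 : (xb - ps) (w0 - q) ≤ C :=
      ((le_abs_self _).trans ((xb - ps).le_opNorm _)).trans (by rw [hC]; gcongr)
    have k7 : zs (z - q) ≤ ‖zs‖ * (‖z - p‖ + 1) :=
      ((le_abs_self _).trans (zs.le_opNorm _)).trans (by gcongr)
    have k8 : -(‖ps‖ * (‖z - p‖ + 1)) ≤ ps (z - q) :=
      (neg_le_neg ((ps.le_opNorm _).trans (by gcongr))).trans (neg_abs_le _)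
    have k9 : -(C / c1) - C ≤ (qs - ps) (z - q) := by
      refine caseP_num (ν := ν) (α := (qs - ps) (p - w0)) (β := (qs - ps) (z - p)) hC0 hc0 hc1 hν0 hν1 ?_ ?_ ?_
      · simp only [_root_.sub_apply, map_sub, _root_.add_apply, _root_.smul_apply, map_add,
          map_smul, smul_eq_mul] at hV k4 k5 k6 ⊢
        have : 0 ≤ ν * (-(qs p - qs w0 - (ps p - ps w0)) + c1 * (qs z - qs p - (ps z - ps p))) := by
          linarith
        have := nonneg_of_mul_nonneg_right this hν0
        linarith
      · simp only [_root_.sub_apply, map_sub, _root_.add_apply, _root_.smul_apply, map_add,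
          map_smul, smul_eq_mul] at hV k4 k5 k6 ⊢
        linarith
      · simp only [_root_.sub_apply, map_sub, _root_.add_apply, _root_.smul_apply, map_add,
          map_smul, smul_eq_mul] at hV k4 k5 k6 ⊢
        linarith
    rw [div_lt_iff₀ hκ] at k1
    have := le_abs_self C1
    rw [hC3] at k1
    simp only [_root_.sub_apply, map_sub] at k2 k7 k8 k9
    linarith

theorem factG {Q : Set X} (hQo : IsOpen Q) (hQc : Convex ℝ Q) {w0 d : X} (hw0 : w0 ∈ Q) {τ : ℝ}
    (hτ0 : 0 ≤ τ) (hτ1 : τ < 1) (hτ : w0 + τ • d ∉ Q) :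
    ∃ r > 0, ∀ x ∈ closure Q, ∀ μ : ℝ, ‖x - (w0 + μ • d)‖ < r → μ ≤ (1 + τ) / 2 := by
  obtain ⟨η, hη, hball⟩ := Metric.isOpen_iff.1 hQo w0 hw0
  have h1τ : 0 < 1 - τ := by linarith
  refine ⟨η * ((1 - τ) / 2), by positivity, ?_⟩
  intro x hx μ hxμ
  by_contra hμ
  push Not at hμ
  have hμτ : (1 - τ) / 2 < μ - τ := by linarith
  have hμτ0 : 0 < μ - τ := by linarith
  have hμ0 : 0 < μ := by linarith
  set ρ := x - (w0 + μ • d) with hρ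
  have hy : w0 - (τ / (μ - τ)) • ρ ∈ Q := by
    apply hball
    rw [mem_ball_iff_norm, sub_sub_cancel_left, norm_neg, norm_smul,
      Real.norm_of_nonneg (by positivity), div_mul_eq_mul_div, div_lt_iff₀ hμτ0]
    have e1 : τ * ‖ρ‖ ≤ ‖ρ‖ := mul_le_of_le_one_left (norm_nonneg _) hτ1.le
    have e2 : η * ((1 - τ) / 2) < η * (μ - τ) := mul_lt_mul_of_pos_left hμτ hη
    linarith
  apply hτ
  have hc := hQc.combo_interior_closure_mem_interior (hQo.interior_eq.symm ▸ hy) hx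
    (a := (μ - τ) / μ) (b := τ / μ) (by positivity) (by positivity) (by field_simp; ring)
  rw [hQo.interior_eq] at hc
  convert hc using 1
  have hxe : x = w0 + μ • d + ρ := by rw [hρ]; abel
  rw [hxe]
  have e1 : (μ - τ) / μ * (τ / (μ - τ)) = τ / μ := by field_simp
  have e2 : τ / μ * μ = τ := by field_simp
  have e3 : (μ - τ) / μ = 1 - τ / μ := by field_simp
  rw [smul_sub, smul_smul, e1, smul_add, smul_add, smul_smul, e2, e3]
  module

theorem factH {B : Set (X × (X →L[ℝ] ℝ))} {w0 d z : X} (hz : z = w0 + d) (hw0 : w0 ∈ QB B) {κ0 : ℝ}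
    (hκ0 : 0 < κ0) :
    ∃ r > 0, ∃ κ > 0, ∃ C : ℝ, 0 ≤ C ∧ ∀ x b (μ : ℝ), (x, b) ∈ B → 0 ≤ μ → μ ≤ 1 - κ0 →
      ‖x - (w0 + μ • d)‖ < r → κ * ‖b‖ - C ≤ b (z - x) := by
  obtain ⟨δ, hδ, C, hC, hbd⟩ := QB_bound hw0
  set κ := κ0 * δ / 2 with hκ
  have hκp : 0 < κ := by positivity
  set C' := C * (2 + ‖w0‖ + ‖d‖) with hC'
  have hC'0 : 0 ≤ C' := by positivity
  refine ⟨min κ 1, by positivity, κ, hκp, C' + C' * (‖d‖ + 1) / κ, by positivity, ?_⟩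
  intro x b μ hb hμ0 hμ1 hx
  have hx1 := hx.trans_le (min_le_left _ _)
  have hx2 := hx.trans_le (min_le_right _ _)
  set ρ := x - (w0 + μ • d) with hρ
  have hxe : x = w0 + μ • d + ρ := by rw [hρ]; abel
  have hμd : ‖μ • d‖ ≤ ‖d‖ := by
    rw [norm_smul, Real.norm_of_nonneg hμ0]
    exact mul_le_of_le_one_left (norm_nonneg _) (by linarith)
  have hxn : ‖x‖ ≤ ‖w0‖ + ‖d‖ + 1 := by
    rw [hxe]
    have e1 := norm_add_le (w0 + μ • d) ρ
    have e2 := norm_add_le w0 (μ • d)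
    linarith
  have hzx : ‖z - x‖ ≤ ‖d‖ + 1 := by
    have e : z - x = (1 - μ) • d - ρ := by rw [hz, hxe]; module
    have e1 := norm_sub_le ((1 - μ) • d) ρ
    have e2 : ‖(1 - μ) • d‖ ≤ ‖d‖ := by
      rw [norm_smul, Real.norm_of_nonneg (by linarith)]
      exact mul_le_of_le_one_left (norm_nonneg _) (by linarith)
    rw [e]; linarith
  have hT : -(‖b‖ * (‖d‖ + 1)) ≤ b (z - x) :=
    (neg_le_neg ((b.le_opNorm _).trans (by gcongr))).trans (neg_abs_le _)
  have h1 := hbd x b hb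
  have hid : (1 - μ) * (b x - b w0) = μ * b (z - x) + b ρ := by
    rw [hz, hxe]
    simp only [map_add, map_sub, map_smul, smul_eq_mul]
    ring
  have hbρ : b ρ ≤ ‖b‖ * κ := ((le_abs_self _).trans (b.le_opNorm _)).trans (by gcongr)
  have hC2 : (1 - μ) * (C * (1 + ‖x‖)) ≤ C' := by
    have e1 : C * (1 + ‖x‖) ≤ C' := mul_le_mul_of_nonneg_left (by linarith) hC
    exact (mul_le_of_le_one_left (by positivity) (by linarith)).trans e1
  have h2 := mul_le_mul_of_nonneg_left h1 (show 0 ≤ 1 - μ by linarith)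
  have h3 : κ0 * (δ * ‖b‖) ≤ (1 - μ) * (δ * ‖b‖) :=
    mul_le_mul_of_nonneg_right (by linarith) (by positivity)
  have h4 : κ * ‖b‖ - C' ≤ μ * b (z - x) := by
    rw [hκ] at hbρ ⊢
    linarith
  have hq : 0 ≤ C' * (‖d‖ + 1) / κ := by positivity
  rcases le_or_gt (κ * ‖b‖ - C') 0 with hneg | hpos
  · have e1 : ‖b‖ * (‖d‖ + 1) ≤ C' * (‖d‖ + 1) / κ := by
      rw [le_div_iff₀ hκp]
      have : κ * ‖b‖ * (‖d‖ + 1) ≤ C' * (‖d‖ + 1) := by gcongr; linarith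
      linarith
    linarith
  · have hT0 : 0 < b (z - x) := by
      by_contra hn
      push Not at hn
      have := mul_nonneg hμ0 (neg_nonneg.2 hn)
      linarith
    have : μ * b (z - x) ≤ b (z - x) := mul_le_of_le_one_left hT0.le (by linarith)
    linarith

theorem caseIII {A B : Set (X × (X →L[ℝ] ℝ))} (hF : IsFPV A) (hconv : Convex ℝ (opDom A))
    (hB : IsMaxMonotoneOp B)
    {w0 z : X} {xb yb zs : X →L[ℝ] ℝ} {ε : ℝ} (hε : 0 < ε) (hxb : (w0, xb) ∈ A)
    (hyb : (w0, yb) ∈ B) (hw0 : w0 ∈ QB B)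
    (hgap : ∀ a as b, (a, as) ∈ A → (a, b) ∈ B → as z + b z - zs z - as a - b a + zs a ≤ -ε)
    {τ : ℝ} (hτ0 : 0 ≤ τ) (hτ1 : τ < 1) (hτ : w0 + τ • (z - w0) ∉ QB B) : False := by
  set d := z - w0 with hd
  set h : X →L[ℝ] ℝ := zs - xb - yb with hh
  set g := h d with hgdef
  have hz : z = w0 + d := by rw [hd]; abel
  have hgε : ε ≤ g := by
    have := hgap _ _ _ hxb hyb
    rw [hgdef, hh, hd]
    simp only [_root_.sub_apply, map_sub]
    linarith
  have hg : 0 < g := by linarith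
  set κ0 := (1 - τ) / 2 with hκ0
  have hκ0p : 0 < κ0 := by rw [hκ0]; linarith
  obtain ⟨η, hη, hball⟩ := Metric.isOpen_iff.1 (QB_open B) w0 hw0
  obtain ⟨r1, hr1, hG⟩ := factG (QB_open B) (QB_convex B) hw0 hτ0 hτ1 hτ
  obtain ⟨r2, hr2, κ, hκ, C1, hC1, hH⟩ := factH hz hw0 hκ0p
  set m := (C1 + ‖zs‖ * (‖d‖ + 1) + 1) / (κ0 * g) with hm
  have hm0 : 0 < m := by positivity
  have hmg : κ0 * (m * g) = C1 + ‖zs‖ * (‖d‖ + 1) + 1 := by rw [hm]; field_simp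
  obtain ⟨r, hr, hrδ, hrS⟩ := exists_small (δ := min (min r1 (r2 / 2)) (min 1 (η * κ0)))
    (θ := 1) (S := m * ‖h‖) (by positivity) one_pos (by positivity)
  have hrr1 : r ≤ r1 := hrδ.trans ((min_le_left _ _).trans (min_le_left _ _))
  have hrr2 : r ≤ r2 / 2 := hrδ.trans ((min_le_left _ _).trans (min_le_right _ _))
  have hr11 : r ≤ 1 := hrδ.trans ((min_le_right _ _).trans (min_le_left _ _))
  have hrη : r ≤ η * κ0 := hrδ.trans ((min_le_right _ _).trans (min_le_right _ _))
  obtain ⟨a, as, σ, haA, hσ0, hσ1, haσ, hV⟩ := fpv_tube hF (x1 := z) ⟨xb, hxb⟩ (m • h) hr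
  rw [← hd] at haσ
  set ρ := a - (w0 + σ • d) with hρ
  have hae : a = w0 + σ • d + ρ := by rw [hρ]; abel
  by_cases haQ : a ∈ QB B
  · have hσμ := hG a (subset_closure haQ) σ (haσ.trans_le hrr1)
    obtain ⟨b, hb⟩ := QB_dom hB haQ
    have h1 := hH a b σ hb hσ0 (by rw [hκ0]; linarith) (by linarith)
    have h2 := hgap a as b haA hb
    have hzx : ‖z - a‖ ≤ ‖d‖ + 1 := by
      have e : z - a = (1 - σ) • d - ρ := by rw [hz, hae]; module
      have e1 := norm_sub_le ((1 - σ) • d) ρ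
      have e2 : ‖(1 - σ) • d‖ ≤ ‖d‖ := by
        rw [norm_smul, Real.norm_of_nonneg (by linarith)]
        exact mul_le_of_le_one_left (norm_nonneg _) (by linarith)
      rw [e]; linarith
    have h3 : zs (z - a) ≤ ‖zs‖ * (‖d‖ + 1) :=
      ((le_abs_self _).trans (zs.le_opNorm _)).trans (by gcongr)
    have h4 : h ρ ≤ ‖h‖ * r := ((le_abs_self _).trans (h.le_opNorm _)).trans (by gcongr)
    have h5 := mul_le_mul_of_nonneg_left h4 hm0.le
    have h6 : κ0 * (m * g) ≤ (1 - σ) * (m * g) :=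
      mul_le_mul_of_nonneg_right (by rw [hκ0]; linarith) (by positivity)
    have h7 : (m • h) (z - a) = (1 - σ) * (m * g) - m * h ρ := by
      rw [hgdef, hz, hae]
      simp only [map_add, map_sub, map_smul, smul_eq_mul, _root_.smul_apply]
      ring
    have h8 : 0 ≤ κ * ‖b‖ := by positivity
    simp only [map_sub] at h7 h1 h3
    linarith
  · -- the segment meets the frontier
    obtain ⟨p, hpseg, hpc, hpn⟩ : ∃ p ∈ segment ℝ w0 a, p ∈ closure (QB B) ∧ p ∉ QB B := by
      by_contra hno
      push Not at hno
      obtain ⟨y, -, hy1, hy2⟩ := (convex_segment w0 a).isPreconnected (QB B) (closure (QB B))ᶜ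
        (QB_open B) isClosed_closure.isOpen_compl
        (fun x hx => by
          by_cases hxc : x ∈ closure (QB B)
          · exact Or.inl (hno x hx hxc)
          · exact Or.inr hxc)
        ⟨w0, left_mem_segment ℝ w0 a, hw0⟩
        ⟨a, right_mem_segment ℝ w0 a, fun hac => haQ (hno a (right_mem_segment ℝ w0 a) hac)⟩
      exact hy2 (subset_closure hy1)
    have hpA : p ∈ opDom A := hconv.segment_subset ⟨xb, hxb⟩ ⟨as, haA⟩ hpseg
    obtain ⟨ps, hps⟩ := hpA
    rw [segment_eq_image'] at hpseg
    obtain ⟨l, ⟨hl0, hl1⟩, hlp⟩ := hpseg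
    simp only at hlp
    set μ := l * σ with hμ
    have hμ0 : 0 ≤ μ := by positivity
    have hpe : p = w0 + μ • d + l • ρ := by
      rw [← hlp, hμ]
      nth_rewrite 1 [hae]
      module
    have hpd : p - (w0 + μ • d) = l • ρ := by rw [hpe]; abel
    have hlρ : ‖l • ρ‖ < r := by
      rw [norm_smul, Real.norm_of_nonneg hl0]
      exact (mul_le_of_le_one_left (norm_nonneg _) hl1).trans_lt haσ
    have hμ1 : μ ≤ (1 + τ) / 2 := hG p hpc μ (by rw [hpd]; linarith)
    have hμκ : μ ≤ 1 - κ0 := by rw [hκ0]; linarith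
    have h1μ : 0 < 1 - μ := by linarith
    refine caseP hF hconv hB (u := w0 + (1 - μ)⁻¹ • (l • ρ)) (c := μ / (1 - μ)) hε hxb hw0 hgap
      hps hpc hpn ?_ (by positivity) ?_ (ρ0 := r2 / 2) (κ := κ) (C1 := C1) (by positivity) hκ ?_
    · apply hball
      rw [mem_ball_iff_norm, add_sub_cancel_left, norm_smul, Real.norm_of_nonneg (by positivity),
        inv_mul_lt_iff₀ h1μ]
      have : η * κ0 ≤ (1 - μ) * η := by
        rw [mul_comm]; exact mul_le_mul_of_nonneg_right (by linarith) hη.le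
      linarith
    · rw [hpe, hz]
      have e1 : μ / (1 - μ) * (1 - μ) = μ := by field_simp
      have e2 : (1 - μ)⁻¹ = 1 + μ / (1 - μ) := by field_simp; ring
      have e3 : w0 + d - (w0 + μ • d + l • ρ) = (1 - μ) • d - l • ρ := by module
      rw [e3, smul_sub (μ / (1 - μ)), smul_smul (μ / (1 - μ)), e1, e2]
      module
    · intro q b hb hq
      refine hH q b μ hb hμ0 hμκ ?_
      have := norm_add_le (q - p) (p - (w0 + μ • d))
      rw [sub_add_sub_cancel, hpd] at this
      linarith

theorem no_gap {A B : Set (X × (X →L[ℝ] ℝ))} (hF : IsFPV A) (hconv : Convex ℝ (opDom A))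
    (hB : IsMaxMonotoneOp B) {w0 : X} (hw0A : w0 ∈ opDom A) (hw0 : w0 ∈ QB B) : NoGap A B := by
  intro z zs ε hε hgap
  obtain ⟨xb, hxb⟩ := hw0A
  obtain ⟨yb, hyb⟩ := QB_dom hB hw0
  by_cases hQ : ∀ τ : ℝ, 0 ≤ τ → τ < 1 → w0 + τ • (z - w0) ∈ QB B
  · exact caseII hF hB hε hxb hyb hgap hQ
  · push Not at hQ
    obtain ⟨τ, h0, h1, h2⟩ := hQ
    exact caseIII hF hconv hB hε hxb hyb hw0 hgap h0 h1 h2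

/-- sum theorem when `A` is (FPV) with convex domain. -/
theorem fpv_sum_theorem_convex_domain {X : Type*} [NormedAddCommGroup X] [NormedSpace ℝ X]
    [CompleteSpace X]
    (A B : Set (X × (X →L[ℝ] ℝ)))
    (hA : IsMaxMonotoneOp A) (hB : IsMaxMonotoneOp B)
    (hFPV : IsFPV A) (hconv : Convex ℝ (opDom A))
    (hdom : (opDom A ∩ interior (opDom B)).Nonempty) :
    IsMaxMonotoneOp (opSum A B) := by
  obtain ⟨w0, hw0A, hw0B⟩ := hdom
  have hw0 := int_dom_QB hB.1 hw0B
  exact sum_max hA hB (no_gap hFPV hconv hB hw0A hw0) hw0A hw0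
end
end
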